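/- Let q ≥ 2 be a prime power, let H = PSL₃(F_q) be the projective special linear group of degree 3 over the field with q elements, and let G = Hᵏ for some k ≥ 1. Then the following are equivalent: (a) G admits an unmixed Beauville structure; (b) G can be generated by two elements; (c) k·|Aut H| ≤ φ₂(H). -/

import Mathlib

open scoped MatrixGroups

/-- `Σ(T)`: the union of all conjugates of the cyclic subgroups generated by the
three entries of the triple `T = (a, b, c)`. -/
def SigmaSet {G : Type*} [Group G] (T : G × G × G) : Set G :=
  {x | ∃ g : G, g * x * g⁻¹ ∈
    (Subgroup.zpowers T.1 : Set G) ∪ (Subgroup.zpowers T.2.1 : Set G) ∪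
      (Subgroup.zpowers T.2.2 : Set G)}

/-- `T = (a,b,c)` is a generating triple: `a*b*c = 1` and `{a,b,c}` generates. -/
def IsGenTriple {G : Type*} [Group G] (T : G × G × G) : Prop :=
  T.1 * T.2.1 * T.2.2 = 1 ∧ Subgroup.closure {T.1, T.2.1, T.2.2} = ⊤

/-- `T` is hyperbolic: the reciprocals of the orders of its entries sum to less than 1. -/
def IsHyperbolic {G : Type*} [Group G] (T : G × G × G) : Prop :=
  (orderOf T.1 : ℚ)⁻¹ + (orderOf T.2.1 : ℚ)⁻¹ + (orderOf T.2.2 : ℚ)⁻¹ < 1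

/-- An unmixed Beauville structure on `G`: a pair of hyperbolic generating triples
`T₁, T₂` with `Σ(T₁) ∩ Σ(T₂) = {1}`. -/
def HasBeauvilleStructure (G : Type*) [Group G] : Prop :=
  ∃ T₁ T₂ : G × G × G, IsGenTriple T₁ ∧ IsHyperbolic T₁ ∧ IsGenTriple T₂ ∧ IsHyperbolic T₂ ∧
    SigmaSet T₁ ∩ SigmaSet T₂ = {1}

/-- `φ₂(H)`: the number of ordered generating pairs of `H`. -/
noncomputable def phi2 (H : Type*) [Group H] : ℕ :=
  Nat.card {p : H × H // Subgroup.closure {p.1, p.2} = ⊤}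

/-- Two triples are equivalent if some automorphism carries one to the other entrywise. -/
def TripleEquiv {H : Type*} [Group H] (T T' : H × H × H) : Prop :=
  ∃ α : MulAut H, α T.1 = T'.1 ∧ α T.2.1 = T'.2.1 ∧ α T.2.2 = T'.2.2

section Powers

variable {H : Type*} [Group H]

theorem closure_pi_eq_top [Finite H] [IsSimpleGroup H] (hperf : commutator H = ⊤)
    {ι : Type*} [Finite ι] (x y : ι → H)
    (hgen : ∀ i, Subgroup.closure {x i, y i} = ⊤)
    (hne : ∀ i j, i ≠ j → ∀ α : MulAut H, α (x i) = x j → α (y i) ≠ y j) :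
    Subgroup.closure {x, y} = ⊤ := by
  classical
  have := Fintype.ofFinite ι
  set K : Subgroup (ι → H) := Subgroup.closure {x, y} with hK
  have hxK : x ∈ K := Subgroup.subset_closure (by simp)
  have hyK : y ∈ K := Subgroup.subset_closure (by simp)
  have hsurj : ∀ i, ∀ h : H, ∃ κ ∈ K, κ i = h := by
    intro i h
    have : K.map (Pi.evalMonoidHom (fun _ : ι => H) i) = ⊤ := by
      rw [hK, MonoidHom.map_closure, ← hgen i]
      congr 1
      simp [Set.image_pair]
    have hm : h ∈ K.map (Pi.evalMonoidHom (fun _ : ι => H) i) := this ▸ Subgroup.mem_top h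
    obtain ⟨κ, hκ, rfl⟩ := hm
    exact ⟨κ, hκ, rfl⟩
  -- elements of `K` with trivial coordinates on `S`, projected to `i`
  let M : Finset ι → ι → Subgroup H := fun S i =>
    { carrier := {h | ∃ κ ∈ K, κ i = h ∧ ∀ j ∈ S, κ j = 1}
      one_mem' := ⟨1, K.one_mem, rfl, fun _ _ => rfl⟩
      mul_mem' := by
        rintro _ _ ⟨κ, hκ, rfl, h1⟩ ⟨κ', hκ', rfl, h1'⟩
        exact ⟨κ * κ', K.mul_mem hκ hκ', rfl, fun j hj => by simp [h1 j hj, h1' j hj]⟩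
      inv_mem' := by
        rintro _ ⟨κ, hκ, rfl, h1⟩
        exact ⟨κ⁻¹, K.inv_mem hκ, rfl, fun j hj => by simp [h1 j hj]⟩ }
  have hM2 : ∀ i j, i ≠ j → M {j} i = ⊤ := by
    intro i j hij
    have hnorm : (M {j} i).Normal := by
      constructor
      rintro _ ⟨κ, hκ, rfl, h1⟩ g
      obtain ⟨γ, hγ, rfl⟩ := hsurj i g
      refine ⟨γ * κ * γ⁻¹, K.mul_mem (K.mul_mem hγ hκ) (K.inv_mem hγ), rfl, ?_⟩
      intro l hl
      simp [h1 l hl]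
    rcases hnorm.eq_bot_or_eq_top with hbot | htop
    · exfalso
      let f : K →* H := (Pi.evalMonoidHom (fun _ : ι => H) j).comp K.subtype
      let g : K →* H := (Pi.evalMonoidHom (fun _ : ι => H) i).comp K.subtype
      have hf : Function.Surjective f := fun h => by
        obtain ⟨κ, hκ, hh⟩ := hsurj j h
        exact ⟨⟨κ, hκ⟩, hh⟩
      have hg : Function.Surjective g := fun h => by
        obtain ⟨κ, hκ, hh⟩ := hsurj i h
        exact ⟨⟨κ, hκ⟩, hh⟩
      have hker : f.ker ≤ g.ker := by
        intro κ hκ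
        have hmem : g κ ∈ M {j} i := ⟨κ, κ.2, rfl, fun l hl => by
          rw [Finset.mem_singleton] at hl
          subst hl
          exact hκ⟩
        rw [hbot] at hmem
        simpa using hmem
      let φ : H →* H := f.liftOfSurjective hf ⟨g, hker⟩
      have hφ : ∀ κ, φ (f κ) = g κ := fun κ =>
        f.liftOfRightInverse_comp_apply _ (Function.rightInverse_surjInv hf) ⟨g, hker⟩ κ
      have hφs : Function.Surjective φ := fun h => by
        obtain ⟨κ, rfl⟩ := hg h
        exact ⟨f κ, hφ κ⟩
      have hφb : Function.Bijective φ := Finite.injective_iff_surjective.mpr hφs |>.bijective_of_finite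
      exact hne j i hij.symm (MulEquiv.ofBijective φ hφb) (hφ ⟨x, hxK⟩) (hφ ⟨y, hyK⟩)
    · exact htop
  have hMS : ∀ S : Finset ι, ∀ i, i ∉ S → M S i = ⊤ := by
    intro S
    induction S using Finset.induction_on with
    | empty =>
      intro i _
      rw [eq_top_iff]
      intro h _
      obtain ⟨κ, hκ, hh⟩ := hsurj i h
      exact ⟨κ, hκ, hh, by simp⟩
    | insert j S hj ih =>
      intro i hi
      rw [Finset.mem_insert, not_or] at hi
      rw [eq_top_iff, ← hperf, commutator_def, Subgroup.commutator_le]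
      intro a _ b _
      have ha : a ∈ M S i := ih i hi.2 ▸ Subgroup.mem_top a
      have hb : b ∈ M {j} i := hM2 i j hi.1 ▸ Subgroup.mem_top b
      obtain ⟨κ, hκ, rfl, h1⟩ := ha
      obtain ⟨γ, hγ, rfl, h2⟩ := hb
      refine ⟨κ * γ * κ⁻¹ * γ⁻¹, ?_, rfl, ?_⟩
      · exact K.mul_mem (K.mul_mem (K.mul_mem hκ hγ) (K.inv_mem hκ)) (K.inv_mem hγ)
      · intro l hl
        rw [Finset.mem_insert] at hl
        rcases hl with rfl | hl
        · simp [h2 l (by simp)]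
        · simp [h1 l hl]
  rw [eq_top_iff]
  intro f _
  refine Subgroup.pi_mem_of_mulSingle_mem f fun i => ?_
  have hm : f i ∈ M (Finset.univ.erase i) i := hMS (Finset.univ.erase i) i (by simp) ▸ Subgroup.mem_top _
  obtain ⟨κ, hκ, h1, h2⟩ := hm
  convert hκ
  ext j
  rcases eq_or_ne j i with rfl | hj
  · simp [h1]
  · simp [hj, h2 j (by simp [hj])]

theorem not_equiv_of_closure_pi_eq_top [Nontrivial H] {ι : Type*} (x y : ι → H)
    (h : Subgroup.closure {x, y} = ⊤) (i j : ι) (hij : i ≠ j) (α : MulAut H)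
    (hx : α (x i) = x j) : α (y i) ≠ y j := by
  classical
  intro hy
  let E : Subgroup (ι → H) :=
    MonoidHom.eqLocus (α.toMonoidHom.comp (Pi.evalMonoidHom (fun _ : ι => H) i))
      (Pi.evalMonoidHom (fun _ : ι => H) j)
  have hle : Subgroup.closure {x, y} ≤ E := by
    rw [Subgroup.closure_le]
    rintro z (rfl | rfl)
    · exact hx
    · exact hy
  obtain ⟨a, ha⟩ := exists_ne (1 : H)
  have : Pi.mulSingle j a ∈ E := hle (h ▸ Subgroup.mem_top _)
  have h2 : α (Pi.mulSingle (M := fun _ => H) j a i) = Pi.mulSingle (M := fun _ => H) j a j := this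
  rw [Pi.mulSingle_eq_of_ne hij, Pi.mulSingle_eq_same, map_one] at h2
  exact ha h2.symm

theorem MulAut.eq_of_closure_pair {x y : H} (h : Subgroup.closure {x, y} = ⊤) {α β : MulAut H}
    (hx : α x = β x) (hy : α y = β y) : α = β := by
  have : α.toMonoidHom = β.toMonoidHom :=
    MonoidHom.eq_of_eqOn_dense h (by rintro z (rfl | rfl); exacts [hx, hy])
  ext z
  exact DFunLike.congr_fun this z

theorem closure_pair_map {x y : H} (h : Subgroup.closure {x, y} = ⊤) (α : MulAut H) :
    Subgroup.closure {α x, α y} = ⊤ := by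
  have : (Subgroup.closure {x, y}).map α.toMonoidHom = ⊤ := by
    rw [h]
    exact Subgroup.map_top_of_surjective _ α.surjective
  rw [MonoidHom.map_closure, Set.image_pair] at this
  exact this

theorem mul_card_mulAut_le_phi2 [Finite H] [Nontrivial H] {k : ℕ} (x y : Fin k → H)
    (h : Subgroup.closure {x, y} = ⊤) : k * Nat.card (MulAut H) ≤ phi2 H := by
  have hgen : ∀ i, Subgroup.closure {x i, y i} = ⊤ := by
    intro i
    have : (Subgroup.closure {x, y}).map (Pi.evalMonoidHom (fun _ : Fin k => H) i) = ⊤ := by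
      rw [h]
      exact Subgroup.map_top_of_surjective _ (Function.surjective_eval i)
    rwa [MonoidHom.map_closure, Set.image_pair] at this
  have hcard : k * Nat.card (MulAut H) = Nat.card (Fin k × MulAut H) := by
    rw [Nat.card_prod, Nat.card_fin]
  rw [hcard, phi2]
  refine Nat.card_le_card_of_injective
    (fun p => ⟨(p.2 (x p.1), p.2 (y p.1)), closure_pair_map (hgen p.1) p.2⟩) ?_
  rintro ⟨i, α⟩ ⟨j, β⟩ hp
  simp only [Subtype.mk.injEq, Prod.mk.injEq] at hp
  by_cases hij : i = j
  · subst hij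
    rw [MulAut.eq_of_closure_pair (hgen i) hp.1 hp.2]
  · exfalso
    refine not_equiv_of_closure_pi_eq_top x y h i j hij (β⁻¹ * α) ?_ ?_
    · rw [MulAut.mul_apply, hp.1, MulAut.inv_apply_self]
    · rw [MulAut.mul_apply, hp.2, MulAut.inv_apply_self]

/-- Pairwise inequivalent generating pairs can be continued as long as the counting bound
permits. -/
theorem exists_inequivalent_extension [Finite H] (c k : ℕ) (hck : c ≤ k)
    (hk : k * Nat.card (MulAut H) ≤ phi2 H) (p : ℕ → H × H)
    (hgen : ∀ i < c, Subgroup.closure {(p i).1, (p i).2} = ⊤)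
    (hne : ∀ i < c, ∀ j < c, i ≠ j → ∀ α : MulAut H, α (p i).1 = (p j).1 → α (p i).2 ≠ (p j).2) :
    ∃ p' : ℕ → H × H, (∀ i < c, p' i = p i) ∧
      (∀ i < k, Subgroup.closure {(p' i).1, (p' i).2} = ⊤) ∧
      ∀ i < k, ∀ j < k, i ≠ j →
        ∀ α : MulAut H, α (p' i).1 = (p' j).1 → α (p' i).2 ≠ (p' j).2 := by
  induction k, hck using Nat.le_induction with
  | base => exact ⟨p, fun _ _ => rfl, hgen, hne⟩
  | succ k hck ih =>
    have hpos : 0 < Nat.card (MulAut H) := Nat.card_pos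
    obtain ⟨f, hf, hfg, hfn⟩ := ih ((Nat.mul_le_mul_right _ (Nat.le_succ k)).trans hk)
    have hlt : Nat.card (Fin k × MulAut H) <
        Nat.card {p : H × H // Subgroup.closure {p.1, p.2} = ⊤} := by
      rw [Nat.card_prod, Nat.card_fin]
      refine lt_of_lt_of_le ?_ hk
      exact Nat.mul_lt_mul_of_pos_right (Nat.lt_succ_self k) hpos
    let g : Fin k × MulAut H → {p : H × H // Subgroup.closure {p.1, p.2} = ⊤} :=
      fun q => ⟨(q.2 (f q.1).1, q.2 (f q.1).2), closure_pair_map (hfg q.1 q.1.2) q.2⟩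
    have hns : ¬ Function.Surjective g := fun hs =>
      absurd (Nat.card_le_card_of_surjective g hs) (not_le.mpr hlt)
    rw [Function.Surjective] at hns
    push Not at hns
    obtain ⟨⟨w, hw⟩, hwn⟩ := hns
    have key : ∀ i < k, ∀ α : MulAut H, α (f i).1 = w.1 → α (f i).2 ≠ w.2 := by
      intro i hi α h1 h2
      refine hwn ⟨⟨i, hi⟩, α⟩ (Subtype.ext (Prod.ext h1 h2))
    refine ⟨Function.update f k w, ?_, ?_, ?_⟩
    · intro i hi
      rw [Function.update_of_ne (by omega), hf i hi]
    · intro i hi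
      rcases eq_or_ne i k with rfl | hik
      · simpa using hw
      · rw [Function.update_of_ne hik]
        exact hfg i (by omega)
    · intro i hi j hj hij α
      rcases eq_or_ne i k with rfl | hik
      · rw [Function.update_self, Function.update_of_ne hij.symm]
        intro h1 h2
        refine key j (by omega) α⁻¹ ?_ ?_
        · rw [← h1, MulAut.inv_apply_self]
        · rw [← h2, MulAut.inv_apply_self]
      · rw [Function.update_of_ne hik]
        rcases eq_or_ne j k with rfl | hjk
        · rw [Function.update_self]
          exact key i (by omega) α
        · rw [Function.update_of_ne hjk]
          exact hfn i (by omega) j (by omega) hij α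

end Powers

section Assembly

variable {H : Type*} [Group H]

/-- A power of `e` is trivial only when the corresponding powers of all elements of `H`
have no `r`-torsion left. -/
def IsFull (r : ℕ) (e : H) : Prop :=
  ∀ (g : H) (s : ℕ), e ^ s = 1 → (g ^ s) ^ r = 1 → g ^ s = 1

theorem orderOf_pow_dvd_orderOf_conj {x e : H} {s : ℕ} {g : H} (h : g * x * g⁻¹ = e ^ s) :
    orderOf x ∣ orderOf e := by
  have h1 : orderOf (MulAut.conj g x) = orderOf x := MulEquiv.orderOf_eq (MulAut.conj g) x
  rw [← h1, MulAut.conj_apply, h]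
  exact orderOf_pow_dvd s

theorem mem_sigmaSet_iff [Finite H] (a : Fin 3 → H) (x : H) :
    x ∈ SigmaSet (a 0, a 1, a 2) ↔ ∃ (j : Fin 3) (g : H) (s : ℕ), g * x * g⁻¹ = a j ^ s := by
  have key : ∀ (g y e : H), g * y * g⁻¹ ∈ Subgroup.zpowers e ↔ ∃ s : ℕ, g * y * g⁻¹ = e ^ s := by
    intro g y e
    rw [← mem_powers_iff_mem_zpowers, Submonoid.mem_powers_iff]
    exact ⟨fun ⟨s, h⟩ => ⟨s, h.symm⟩, fun ⟨s, h⟩ => ⟨s, h.symm⟩⟩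
  simp only [SigmaSet, Set.mem_ofPred_eq, Set.mem_union, SetLike.mem_coe, key]
  constructor
  · rintro ⟨g, (⟨s, h⟩ | ⟨s, h⟩) | ⟨s, h⟩⟩
    exacts [⟨0, g, s, h⟩, ⟨1, g, s, h⟩, ⟨2, g, s, h⟩]
  · rintro ⟨j, g, s, h⟩
    fin_cases j
    exacts [⟨g, Or.inl (Or.inl ⟨s, h⟩)⟩, ⟨g, Or.inl (Or.inr ⟨s, h⟩)⟩, ⟨g, Or.inr ⟨s, h⟩⟩]

/-- A generating triple, given as a function on `Fin 3`, that is hyperbolic. -/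
structure IsGoodTriple (a : Fin 3 → H) : Prop where
  prod : a 0 * a 1 * a 2 = 1
  gen : Subgroup.closure {a 0, a 1} = ⊤
  hyp : IsHyperbolic (a 0, a 1, a 2)

theorem isHyperbolic_pi [Finite H] {k : ℕ} (i : Fin k) (a : Fin k → Fin 3 → H)
    (h : IsHyperbolic (a i 0, a i 1, a i 2)) :
    IsHyperbolic ((fun i => a i 0), (fun i => a i 1), (fun i => a i 2)) := by
  have key : ∀ j : Fin 3, ((orderOf (fun i => a i j) : ℕ) : ℚ)⁻¹ ≤ ((orderOf (a i j) : ℕ) : ℚ)⁻¹ := by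
    intro j
    have hd : orderOf (a i j) ∣ orderOf (fun i => a i j) :=
      orderOf_map_dvd (Pi.evalMonoidHom (fun _ : Fin k => H) i) (fun i => a i j)
    have h1 : 0 < orderOf (a i j) := orderOf_pos _
    have h2 : 0 < orderOf (fun i => a i j) := orderOf_pos _
    have h3 := Nat.le_of_dvd h2 hd
    gcongr
  unfold IsHyperbolic at *
  have h0 := key 0
  have h1 := key 1
  have h2 := key 2
  simp only at *
  linarith

theorem sigmaSet_inter_eq [Finite H] {k c : ℕ} (A B : ℕ → Fin 3 → H)
    (hcop : ∀ i < c, ∀ j j', Nat.Coprime (orderOf (A i j)) (orderOf (B i j')))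
    (hfull : ∀ r : ℕ, r.Prime → (∀ j, ∃ i < c, IsFull r (A i j)) ∨
      (∀ j, ∃ i < c, IsFull r (B i j))) (hck : k ≤ c ∨ c ≤ k) :
    SigmaSet ((fun i : Fin k => A i 0), (fun i : Fin k => A i 1), (fun i : Fin k => A i 2)) ∩
      SigmaSet ((fun i : Fin k => B i 0), (fun i : Fin k => B i 1), (fun i : Fin k => B i 2)) =
        {1} := by
  apply Set.eq_singleton_iff_unique_mem.mpr
  have hA := mem_sigmaSet_iff (H := Fin k → H) (fun j i => A i j)
  have hB := mem_sigmaSet_iff (H := Fin k → H) (fun j i => B i j)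
  refine ⟨⟨(hA 1).mpr ⟨0, 1, 0, by simp⟩, (hB 1).mpr ⟨0, 1, 0, by simp⟩⟩, ?_⟩
  rintro z ⟨hzA, hzB⟩
  obtain ⟨j, g, s, hz⟩ := (hA z).mp hzA
  obtain ⟨j', g', s', hz'⟩ := (hB z).mp hzB
  have one_of_lt : ∀ (n : ℕ) (i : Fin k), (i : ℕ) < c → z i ^ n = 1 := by
    intro n i hi
    have h1 : orderOf (z i) ∣ orderOf (A i j) := orderOf_pow_dvd_orderOf_conj (congrFun hz i)
    have h2 : orderOf (z i) ∣ orderOf (B i j') := orderOf_pow_dvd_orderOf_conj (congrFun hz' i)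
    have h3 : orderOf (z i) = 1 := Nat.eq_one_of_dvd_coprimes (hcop i hi j j') h1 h2
    rw [orderOf_eq_one_iff.mp h3, one_pow]
  rcases hck with hkc | hck
  · ext i
    simpa using one_of_lt 1 i (i.2.trans_le hkc)
  by_contra hne
  obtain ⟨r, hr, hrd⟩ := Nat.exists_prime_and_dvd (mt orderOf_eq_one_iff.mp hne)
  obtain ⟨n, hn⟩ := hrd
  have hz1 : z ^ n ≠ 1 := by
    intro h
    have h1 := orderOf_dvd_of_pow_eq_one h
    have h2 : 0 < orderOf z := orderOf_pos z
    have h3 : 0 < n := Nat.pos_of_ne_zero (by rintro rfl; omega)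
    have h4 := Nat.le_of_dvd h3 h1
    rw [hn] at h4
    have := hr.two_le
    nlinarith
  have hzr : (z ^ n) ^ r = 1 := by rw [← pow_mul, mul_comm, ← hn, pow_orderOf_eq_one]
  have main : ∀ (e : ℕ → H) (g : Fin k → H) (s : ℕ),
      (∀ i : Fin k, g i * z i * (g i)⁻¹ = e i ^ s) → (∃ i < c, IsFull r (e i)) → False := by
    rintro e g s h ⟨i, hi, hF⟩
    have h' : ∀ i : Fin k, g i * z i ^ n * (g i)⁻¹ = e i ^ (s * n) := by
      intro i
      rw [pow_mul, ← h i, conj_pow]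
    have hone : e i ^ (s * n) = 1 := by
      have := h' ⟨i, hi.trans_le hck⟩
      simp only at this
      rw [← this, one_of_lt n ⟨i, hi.trans_le hck⟩ hi]
      simp
    refine hz1 ?_
    ext l
    have h2 := hF (e l) (s * n) hone (by
      rw [← h' l, conj_pow]
      have : (z l ^ n) ^ r = 1 := congrFun hzr l
      rw [this]
      simp)
    rw [← h' l] at h2
    have h3 : z l ^ n = 1 := by
      have := congrArg (fun t => (g l)⁻¹ * t * g l) h2
      simpa [mul_assoc] using this
    exact h3
  rcases hfull r hr with hf | hf
  · exact main (fun i => A i j) g s (fun i => congrFun hz i) (hf j)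
  · exact main (fun i => B i j') g' s' (fun i => congrFun hz' i) (hf j')

theorem exists_good_extension [Finite H] [IsSimpleGroup H] (hperf : commutator H = ⊤)
    {k c : ℕ} (hck : k ≤ c ∨ c ≤ k) (hk : k * Nat.card (MulAut H) ≤ phi2 H) (A : ℕ → Fin 3 → H)
    (hA : ∀ i < c, IsGoodTriple (A i))
    (hne : ∀ i < c, ∀ j < c, i ≠ j → ∀ α : MulAut H, α (A i 0) = A j 0 → α (A i 1) ≠ A j 1) :
    ∃ A' : ℕ → Fin 3 → H, (∀ i < c, A' i = A i) ∧
      IsGenTriple ((fun i : Fin k => A' i 0), (fun i : Fin k => A' i 1),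
        (fun i : Fin k => A' i 2)) := by
  have finish : ∀ A' : ℕ → Fin 3 → H, (∀ i < k, A' i 0 * A' i 1 * A' i 2 = 1) →
      (∀ i < k, Subgroup.closure {A' i 0, A' i 1} = ⊤) →
      (∀ i < k, ∀ j < k, i ≠ j → ∀ α : MulAut H, α (A' i 0) = A' j 0 → α (A' i 1) ≠ A' j 1) →
      IsGenTriple ((fun i : Fin k => A' i 0), (fun i : Fin k => A' i 1),
        (fun i : Fin k => A' i 2)) := by
    intro A' h1 h2 h3
    refine ⟨funext fun i => h1 i i.2, top_unique ?_⟩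
    rw [← closure_pi_eq_top hperf (fun i : Fin k => A' i 0) (fun i : Fin k => A' i 1)
      (fun i => h2 i i.2) (fun i j hij => h3 i i.2 j j.2 (Fin.val_ne_of_ne hij))]
    exact Subgroup.closure_mono (by
      intro z hz
      simp only [Set.mem_insert_iff, Set.mem_singleton_iff] at hz ⊢
      tauto)
  rcases hck with hkc | hck
  · exact ⟨A, fun _ _ => rfl, finish A (fun i hi => (hA i (by omega)).prod)
      (fun i hi => (hA i (by omega)).gen)
      (fun i hi j hj => hne i (by omega) j (by omega))⟩
  · obtain ⟨p, hp, hpg, hpn⟩ := exists_inequivalent_extension c k hck hk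
      (fun i => (A i 0, A i 1)) (fun i hi => (hA i hi).gen) hne
    refine ⟨fun i => ![(p i).1, (p i).2, ((p i).1 * (p i).2)⁻¹], ?_, ?_⟩
    · intro i hi
      have h1 := (hA i hi).prod
      ext l
      simp only [hp i hi]
      fin_cases l
      · rfl
      · rfl
      · exact (eq_inv_of_mul_eq_one_right h1).symm
    · refine finish (fun i => ![(p i).1, (p i).2, ((p i).1 * (p i).2)⁻¹]) ?_ ?_ ?_
      · intro i _
        simp
      · exact hpg
      · exact hpn

/-- Building a Beauville structure on `H ^ k` from finitely many special triples. -/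
theorem hasBeauvilleStructure_of_special [Finite H] [IsSimpleGroup H] (hperf : commutator H = ⊤)
    {c : ℕ} (hc : 0 < c) (A B : ℕ → Fin 3 → H)
    (hA : ∀ i < c, IsGoodTriple (A i)) (hB : ∀ i < c, IsGoodTriple (B i))
    (hAne : ∀ i < c, ∀ j < c, i ≠ j → ∀ α : MulAut H, α (A i 0) = A j 0 → α (A i 1) ≠ A j 1)
    (hBne : ∀ i < c, ∀ j < c, i ≠ j → ∀ α : MulAut H, α (B i 0) = B j 0 → α (B i 1) ≠ B j 1)
    (hcop : ∀ i < c, ∀ j j', Nat.Coprime (orderOf (A i j)) (orderOf (B i j')))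
    (hfull : ∀ r : ℕ, r.Prime → (∀ j, ∃ i < c, IsFull r (A i j)) ∨
      (∀ j, ∃ i < c, IsFull r (B i j)))
    {k : ℕ} (hk1 : 1 ≤ k) (hk : k * Nat.card (MulAut H) ≤ phi2 H) :
    HasBeauvilleStructure (Fin k → H) := by
  have hck : k ≤ c ∨ c ≤ k := le_total k c
  obtain ⟨A', hA', hAg⟩ := exists_good_extension hperf hck hk A hA hAne
  obtain ⟨B', hB', hBg⟩ := exists_good_extension hperf hck hk B hB hBne
  refine ⟨_, _, hAg, isHyperbolic_pi ⟨0, hk1⟩ (fun i => A' i) ?_, hBg,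
    isHyperbolic_pi ⟨0, hk1⟩ (fun i => B' i) ?_, sigmaSet_inter_eq (c := c) A' B' ?_ ?_ hck⟩
  · simp only [hA' 0 hc]
    exact (hA 0 hc).hyp
  · simp only [hB' 0 hc]
    exact (hB 0 hc).hyp
  · intro i hi
    rw [hA' i hi, hB' i hi]
    exact hcop i hi
  · refine fun r hr => (hfull r hr).imp ?_ ?_
    · intro h j
      obtain ⟨i, hi, h⟩ := h j
      exact ⟨i, hi, by rwa [hA' i hi]⟩
    · intro h j
      obtain ⟨i, hi, h⟩ := h j
      exact ⟨i, hi, by rwa [hB' i hi]⟩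

/-- The three implications of the equivalence which do not involve the construction of triples. -/
theorem tfae_of_construction [Finite H] [IsSimpleGroup H] {k : ℕ}
    (hcon : k * Nat.card (MulAut H) ≤ phi2 H → HasBeauvilleStructure (Fin k → H)) :
    List.TFAE [HasBeauvilleStructure (Fin k → H), ∃ x y : Fin k → H, Subgroup.closure {x, y} = ⊤,
      k * Nat.card (MulAut H) ≤ phi2 H] := by
  tfae_have 1 → 2 := by
    rintro ⟨⟨a, b, c⟩, -, ⟨h1, h2⟩, -⟩
    refine ⟨a, b, top_unique ?_⟩
    rw [← h2, Subgroup.closure_le]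
    have ha : a ∈ Subgroup.closure {a, b} := Subgroup.subset_closure (by simp)
    have hb : b ∈ Subgroup.closure {a, b} := Subgroup.subset_closure (by simp)
    rintro z (rfl | rfl | rfl)
    · exact ha
    · exact hb
    · have h3 := eq_inv_of_mul_eq_one_right h1
      simp only at h3
      rw [h3]
      exact Subgroup.inv_mem _ (Subgroup.mul_mem _ ha hb)
  tfae_have 2 → 3 := by
    rintro ⟨x, y, h⟩
    exact mul_card_mulAut_le_phi2 x y h
  tfae_have 3 → 1 := hcon
  tfae_finish

theorem IsGoodTriple.rotate {a : Fin 3 → H} (h : IsGoodTriple a) :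
    IsGoodTriple ![a 1, a 2, a 0] where
  prod := by
    have := h.prod
    simp only [Matrix.cons_val]
    rw [mul_assoc] at this
    exact mul_eq_one_iff_eq_inv'.mp this ▸ inv_mul_cancel _
  gen := by
    simp only [Matrix.cons_val]
    refine top_unique ?_
    rw [← h.gen, Subgroup.closure_le]
    have h1 : a 1 ∈ Subgroup.closure {a 1, a 2} := Subgroup.subset_closure (by simp)
    have h2 : a 2 ∈ Subgroup.closure {a 1, a 2} := Subgroup.subset_closure (by simp)
    rintro z (rfl | rfl)
    · have := h.prod
      rw [mul_assoc] at this
      rw [eq_inv_of_mul_eq_one_left this]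
      exact Subgroup.inv_mem _ (Subgroup.mul_mem _ h1 h2)
    · exact h1
  hyp := by
    have := h.hyp
    unfold IsHyperbolic at *
    simp only [Matrix.cons_val] at *
    linarith

/-- The list of the three cyclic rotations of a triple. -/
def rotations {X : Type*} (a : Fin 3 → X) (i : ℕ) : Fin 3 → X :=
  if i = 0 then a else if i = 1 then ![a 1, a 2, a 0] else ![a 2, a 0, a 1]

theorem rotations_isGoodTriple {a : Fin 3 → H} (h : IsGoodTriple a) (i : ℕ) :
    IsGoodTriple (rotations a i) := by
  unfold rotations
  split_ifs
  · exact h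
  · exact h.rotate
  · exact h.rotate.rotate

theorem rotations_inequivalent {a : Fin 3 → H} (h01 : orderOf (a 0) = orderOf (a 1))
    (h12 : orderOf (a 1) ≠ orderOf (a 2)) (i : ℕ) (hi : i < 3) (j : ℕ) (hj : j < 3) (hij : i ≠ j)
    (α : MulAut H) (h0 : α (rotations a i 0) = rotations a j 0) :
    α (rotations a i 1) ≠ rotations a j 1 := by
  intro h1
  have e0 := congrArg orderOf h0
  have e1 := congrArg orderOf h1
  rw [MulEquiv.orderOf_eq] at e0 e1
  interval_cases i <;> interval_cases j <;>
    simp [rotations] at e0 e1 hij <;> omega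

theorem exists_rotations_eq {X : Type*} (a : Fin 3 → X) (l j : Fin 3) : ∃ i < 3, rotations a i j = a l := by
  fin_cases l <;> fin_cases j
  exacts [⟨0, by simp, rfl⟩, ⟨2, by simp, rfl⟩, ⟨1, by simp, rfl⟩, ⟨1, by simp, rfl⟩,
    ⟨0, by simp, rfl⟩, ⟨2, by simp, rfl⟩, ⟨2, by simp, rfl⟩, ⟨1, by simp, rfl⟩, ⟨0, by simp, rfl⟩]

theorem exists_eq_rotations {X : Type*} (a : Fin 3 → X) (i : ℕ) (j : Fin 3) : ∃ l, rotations a i j = a l := by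
  unfold rotations
  split_ifs <;> fin_cases j
  exacts [⟨0, rfl⟩, ⟨1, rfl⟩, ⟨2, rfl⟩, ⟨1, rfl⟩, ⟨2, rfl⟩, ⟨0, rfl⟩, ⟨2, rfl⟩, ⟨0, rfl⟩, ⟨1, rfl⟩]

/-- Building a Beauville structure on `H ^ k` from the rotations of two triples of coprime
orders. -/
theorem hasBeauvilleStructure_of_rotations [Finite H] [IsSimpleGroup H]
    (hperf : commutator H = ⊤) (a b : Fin 3 → H) (ha : IsGoodTriple a) (hb : IsGoodTriple b)
    (ha01 : orderOf (a 0) = orderOf (a 1)) (ha12 : orderOf (a 1) ≠ orderOf (a 2))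
    (hb01 : orderOf (b 0) = orderOf (b 1)) (hb12 : orderOf (b 1) ≠ orderOf (b 2))
    (hcop : ∀ j j', Nat.Coprime (orderOf (a j)) (orderOf (b j')))
    (hfull : ∀ r : ℕ, r.Prime → (∃ j, IsFull r (a j)) ∨ (∃ j, IsFull r (b j)))
    {k : ℕ} (hk1 : 1 ≤ k) (hk : k * Nat.card (MulAut H) ≤ phi2 H) :
    HasBeauvilleStructure (Fin k → H) := by
  refine hasBeauvilleStructure_of_special hperf three_pos (rotations a) (rotations b)
    (fun i _ => rotations_isGoodTriple ha i) (fun i _ => rotations_isGoodTriple hb i)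
    (rotations_inequivalent ha01 ha12) (rotations_inequivalent hb01 hb12) ?_ ?_ hk1 hk
  · intro i _ j j'
    obtain ⟨l, hl⟩ := exists_eq_rotations a i j
    obtain ⟨l', hl'⟩ := exists_eq_rotations b i j'
    rw [hl, hl']
    exact hcop l l'
  · intro r hr
    refine (hfull r hr).imp ?_ ?_
    · rintro ⟨l, h⟩ j
      obtain ⟨i, hi, he⟩ := exists_rotations_eq a l j
      exact ⟨i, hi, he ▸ h⟩
    · rintro ⟨l, h⟩ j
      obtain ⟨i, hi, he⟩ := exists_rotations_eq b l j
      exact ⟨i, hi, he ▸ h⟩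

end Assembly

section Simplicity

variable {F : Type*} [Field F]

open Matrix Matrix.SpecialLinearGroup

theorem diag2n_eq_transvections {i j : Fin 3} (hij : i ≠ j) {a : F} (ha : a ≠ 0) :
    diag2n hij a ha = transvection hij a * transvection hij.symm (-a⁻¹) * transvection hij a *
      transvection hij (-1) * transvection hij.symm 1 * transvection hij (-1) := by
  have hji := hij.symm
  ext k l
  simp only [diag2n_coe, coe_mul, transvection_coe, mul_add, add_mul,
    single_mul_single_same, mul_inv_cancel₀ ha, ne_eq, not_false_eq_true,
    single_mul_single_of_ne, hij, hji, mul_neg, neg_mul, mul_one, one_mul, add_zero,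
    Matrix.add_apply, neg_neg, inv_mul_cancel₀ ha]
  simp only [diagonal_apply, single_apply, one_apply]
  by_cases h1 : k = i <;> by_cases h2 : k = j <;> by_cases h3 : l = i <;> by_cases h4 : l = j <;>
    by_cases h5 : k = l <;> grind

theorem eq_top_of_transvection_mem (K : Subgroup SL(3, F))
    (h : ∀ (i j : Fin 3) (hij : i ≠ j) (a : F), transvection hij a ∈ K) : K = ⊤ := by
  refine top_unique fun M _ => diagonal_transvection_induction' (fun g => g ∈ K) M ?_ h
    fun _ _ => K.mul_mem
  intro i j hij c hc
  rw [diag2n_eq_transvections hij hc]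
  exact K.mul_mem (K.mul_mem (K.mul_mem (K.mul_mem (K.mul_mem (h _ _ _ _) (h _ _ _ _))
    (h _ _ _ _)) (h _ _ _ _)) (h _ _ _ _)) (h _ _ _ _)

open scoped commutatorElement in
theorem transvection_eq_commutator {i j k : Fin 3} (hij : i ≠ j) (hik : i ≠ k) (hkj : k ≠ j)
    (a : F) :
    ⁅transvection hik a, transvection hkj 1⁆ = transvection hij a := by
  rw [commutatorElement_def, transvection_inv, transvection_inv]
  ext r s
  simp [transvection_coe, mul_add, add_mul, single_mul_single_same,
    single_mul_single_of_ne, hij.symm, hik.symm, hkj.symm, ← single_neg]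
  ring

theorem commutator_SL3 : commutator SL(3, F) = ⊤ := by
  refine eq_top_of_transvection_mem _ fun i j hij a => ?_
  obtain ⟨k, hik, hkj⟩ : ∃ k, i ≠ k ∧ k ≠ j := by
    revert hij; clear a; revert i j; decide
  rw [← transvection_eq_commutator hij hik hkj]
  exact Subgroup.commutator_mem_commutator (Subgroup.mem_top _) (Subgroup.mem_top _)

theorem commutator_PSL3 : commutator PSL(3, F) = ⊤ := by
  have : Group.IsPerfect SL(3, F) := ⟨commutator_SL3⟩
  have : Group.IsPerfect (Matrix.ProjectiveSpecialLinearGroup (Fin 3) F) := inferInstance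
  exact this.commutator_eq_top

open scoped LinearAlgebra.Projectivization

theorem iSup_lineStab_SL3 :
    (⨆ p : ℙ F (Fin 3 → F), lineStab p.submodule) = (⊤ : Subgroup SL(3, F)) := by
  refine eq_top_of_transvection_mem _ fun i j hij a => ?_
  have h := SL2Gen.transvection_mem_lineStab hij a
  rw [← Projectivization.submodule_mk (K := F) _ (Pi.single_ne_zero_iff.2 one_ne_zero)] at h
  exact Subgroup.mem_iSup_of_mem _ h

/-- The Iwasawa structure given by the groups of elations with a given centre. -/
noncomputable abbrev iwasawaPSL3 : MulAction.IwasawaStructure PSL(3, F) (ℙ F (Fin 3 → F)) where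
  T := PSL.iwasawaT
  is_comm p := by
    have hSL : IsMulCommutative (lineStab (F := F) (ι := Fin 3) p.submodule) := by
      rw [← Projectivization.mk_rep p, Projectivization.submodule_mk]
      exact lineStab_isMulCommutative_of_span p.rep p.rep_nonzero
    exact Subgroup.map_isMulCommutative _ _
  is_conj g p := by
    obtain ⟨g, rfl⟩ := QuotientGroup.mk_surjective g
    rw [Matrix.ProjectiveSpecialLinearGroup.smul_proj_mk]
    change Subgroup.map _ _ = _
    rw [PSL.smul_submodule, Matrix.SpecialLinearGroup.lineStab_smul, PSL.iwasawaT_map_conj]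
  is_generator := by
    rw [show iSup (PSL.iwasawaT (F := F) (ι := Fin 3)) =
      Subgroup.map (QuotientGroup.mk' (Subgroup.center (Matrix.SpecialLinearGroup (Fin 3) F)))
        (⨆ p : ℙ F (Fin 3 → F), lineStab p.submodule) by rw [Subgroup.map_iSup],
      iSup_lineStab_SL3]
    exact Subgroup.map_top_of_surjective _ (QuotientGroup.mk'_surjective _)

instance isSimpleGroup_PSL3 : IsSimpleGroup PSL(3, F) :=
  MulAction.IwasawaStructure.isSimpleGroup commutator_PSL3 iwasawaPSL3 inferInstance

end Simplicity

section Exponent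

open Polynomial

variable {F : Type*} [Field F]

theorem exists_algebraMap_eq_of_pow_card_eq [Finite F] {K : Type*} [Field K] [Algebra F K]
    {c : K} (hc : c ^ Nat.card F = c) : ∃ a : F, algebraMap F K a = c := by
  have := Fintype.ofFinite F
  have h : (aeval c) (X ^ Fintype.card F - X : F[X]) = 0 := by
    simp [← Nat.card_eq_fintype_card, hc]
  have hs : (X ^ Fintype.card F - X : F[X]) = ∏ a : F, (X - C a) := by
    have h1 := Polynomial.prod_multiset_X_sub_C_of_monic_of_roots_card_eq
      (p := (X ^ Fintype.card F - X : F[X]))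
      (monic_X_pow_sub (by simpa using Fintype.one_lt_card))
      (by rw [FiniteField.roots_X_pow_card_sub_X,
        FiniteField.X_pow_card_sub_X_natDegree_eq _ Fintype.one_lt_card]; rfl)
    rw [← h1, FiniteField.roots_X_pow_card_sub_X]
    rfl
  rw [hs, map_prod, Finset.prod_eq_zero_iff] at h
  obtain ⟨a, -, ha⟩ := h
  simp only [map_sub, aeval_X, aeval_C] at ha
  exact ⟨a, (sub_eq_zero.1 ha).symm⟩

theorem root_pow_eq_one [Finite F] {f : F[X]} (hm : f.Monic) (hf : Irreducible f)
    (hd : f.natDegree = 3) (h0 : f.coeff 0 = -1) :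
    AdjoinRoot.root f ^ (Nat.card F ^ 2 + Nat.card F + 1) = 1 := by
  have : Fact (Irreducible f) := ⟨hf⟩
  let pb := AdjoinRoot.powerBasis hf.ne_zero
  have hfin : Module.Finite F (AdjoinRoot f) := pb.finite
  have : Finite (AdjoinRoot f) := Module.finite_of_finite F
  have hdim : Module.finrank F (AdjoinRoot f) = 3 := by
    rw [pb.finrank, AdjoinRoot.powerBasis_dim, hd]
  have h1 := FiniteField.algebraMap_norm_eq_pow_sum F (AdjoinRoot f) (AdjoinRoot.root f)
  have h2 : Algebra.norm F (AdjoinRoot.root f) = 1 := by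
    have h := Algebra.PowerBasis.norm_gen_eq_coeff_zero_minpoly pb
    rw [AdjoinRoot.minpoly_powerBasis_gen_of_monic hm, AdjoinRoot.powerBasis_dim, hd, h0] at h
    simpa [pb, Odd.neg_one_pow (by decide : Odd 3)] using h
  rw [hdim, h2, map_one] at h1
  rw [h1]
  congr 1
  simp [Finset.sum_range_succ]
  ring

/-- The order of the image in `PSL₃` of a generator of a Singer cycle of determinant one. -/
noncomputable def singerOrder (F : Type*) : ℕ :=
  (Nat.card F ^ 2 + Nat.card F + 1) / Nat.gcd 3 (Nat.card F - 1)

theorem one_lt_natCard [Finite F] : 1 < Nat.card F := Finite.one_lt_card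

theorem gcd_three_dvd {q : ℕ} (hq : 1 ≤ q) : Nat.gcd 3 (q - 1) ∣ q ^ 2 + q + 1 := by
  obtain ⟨r, rfl⟩ : ∃ r, q = r + 1 := ⟨q - 1, by omega⟩
  rw [show (r + 1) ^ 2 + (r + 1) + 1 = r * (r + 3) + 3 by ring]
  exact dvd_add (Dvd.dvd.mul_right (by simpa using Nat.gcd_dvd_right 3 r) _) (Nat.gcd_dvd_left _ _)

theorem singerOrder_mul (F : Type*) [Field F] [Finite F] :
    singerOrder F * Nat.gcd 3 (Nat.card F - 1) = Nat.card F ^ 2 + Nat.card F + 1 :=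
  Nat.div_mul_cancel (gcd_three_dvd (one_lt_natCard (F := F)).le)

theorem dvd_X_pow_singerOrder_sub_C [Finite F] {f : F[X]} (hm : f.Monic) (hf : Irreducible f)
    (hd : f.natDegree = 3) (h0 : f.coeff 0 = -1) :
    ∃ c : F, f ∣ X ^ singerOrder F - C c := by
  have : Fact (Irreducible f) := ⟨hf⟩
  have hr := root_pow_eq_one hm hf hd h0
  rw [← singerOrder_mul F, pow_mul] at hr
  obtain ⟨s, hs⟩ := Nat.gcd_dvd_right 3 (Nat.card F - 1)
  have hq := one_lt_natCard (F := F)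
  have hc : (AdjoinRoot.root f ^ singerOrder F) ^ Nat.card F =
      AdjoinRoot.root f ^ singerOrder F := by
    rw [show Nat.card F = Nat.gcd 3 (Nat.card F - 1) * s + 1 by omega, pow_succ, pow_mul _ _ s, hr, one_pow,
      one_mul]
  obtain ⟨c, hc⟩ := exists_algebraMap_eq_of_pow_card_eq hc
  refine ⟨c, ?_⟩
  rw [← AdjoinRoot.mk_eq_zero, map_sub, map_pow, AdjoinRoot.mk_X, AdjoinRoot.mk_C, ← hc]
  exact sub_self _

open Matrix

theorem pow_eq_one_of_sq_sub_one_nilpotent {R : Type*} [Ring R] (p : ℕ) [Fact p.Prime] [CharP R p]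
    {x : R} {k : ℕ} (h : (x ^ k - 1) ^ 3 = 0) : x ^ (k * (if p = 2 then 4 else p)) = 1 := by
  obtain ⟨j, hj, hj3⟩ : ∃ j, (if p = 2 then 4 else p) = p ^ j ∧ 3 ≤ p ^ j := by
    by_cases hp : p = 2
    · exact ⟨2, by simp [hp], by simp [hp]⟩
    · have := (Fact.out : p.Prime).two_le
      exact ⟨1, by simp [hp], by simp; omega⟩
  rw [hj, pow_mul, ← sub_eq_zero, ← one_pow (p ^ j),
    ← sub_pow_char_pow_of_commute _ _ (Commute.one_right _)]
  exact pow_eq_zero_of_le hj3 h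

theorem dvd_X_pow_sub_X_pow_three [Finite F] {f : F[X]} (hm : f.Monic) (hf : ¬ Irreducible f)
    (hd : f.natDegree = 3) : f ∣ (X ^ (Nat.card F ^ 2) - X) ^ 3 := by
  have h1 : ∀ g ∈ UniqueFactorizationMonoid.factors f,
      g ∣ X ^ (Nat.card F ^ 2) - X := by
    intro g hg
    have hgi := UniqueFactorizationMonoid.irreducible_of_factor g hg
    have hgf := UniqueFactorizationMonoid.dvd_of_mem_factors hg
    rw [← hgi.natDegree_dvd_iff_dvd_X_pow_card_pow_sub_X]
    have hle := natDegree_le_of_dvd hgf hm.ne_zero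
    have hpos := hgi.natDegree_pos
    have hne : g.natDegree ≠ 3 := by
      intro h
      obtain ⟨u, hu⟩ := hgf
      have hu0 : u ≠ 0 := by rintro rfl; exact hm.ne_zero (by simp [hu])
      have : u.natDegree = 0 := by
        have := natDegree_mul hgi.ne_zero hu0
        rw [← hu] at this
        omega
      have hunit : IsUnit u := by
        rw [eq_C_of_natDegree_eq_zero this] at hu0 ⊢
        exact isUnit_C.2 (isUnit_iff_ne_zero.2 (by simpa using hu0))
      exact hf (hu ▸ (irreducible_mul_isUnit hunit).2 hgi)
    have : g.natDegree = 1 ∨ g.natDegree = 2 := by omega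
    rcases this with h | h <;> simp [h]
  have h2 : f ∣ (X ^ (Nat.card F ^ 2) - X) ^
      Multiset.card (UniqueFactorizationMonoid.factors f) := by
    refine (UniqueFactorizationMonoid.factors_prod hm.ne_zero).symm.dvd.trans ?_
    generalize UniqueFactorizationMonoid.factors f = s at h1
    induction s using Multiset.induction_on with
    | empty => simp
    | cons a s ih =>
      rw [Multiset.prod_cons, Multiset.card_cons, pow_succ']
      exact mul_dvd_mul (h1 a (Multiset.mem_cons_self _ _))
        (ih fun g hg => h1 g (Multiset.mem_cons_of_mem hg))
  refine h2.trans (pow_dvd_pow _ ?_)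
  have h3 : f.natDegree =
      ((UniqueFactorizationMonoid.factors f).map natDegree).sum := by
    rw [← natDegree_multiset_prod _ fun h0 => (UniqueFactorizationMonoid.irreducible_of_factor 0 h0).ne_zero rfl]
    exact (natDegree_eq_of_degree_eq (degree_eq_degree_of_associated
      (UniqueFactorizationMonoid.factors_prod hm.ne_zero))).symm
  rw [← hd, h3]
  conv_lhs => rw [← mul_one (Multiset.card _), ← smul_eq_mul]
  refine (Multiset.card_nsmul_le_sum (s := Multiset.map natDegree _) (a := 1) ?_).trans' (by simp)
  intro x hx
  obtain ⟨g, hg, rfl⟩ := Multiset.mem_map.1 hx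
  exact (UniqueFactorizationMonoid.irreducible_of_factor g hg).natDegree_pos

theorem matrix_pow_dichotomy [Finite F] (p : ℕ) [Fact p.Prime] [CharP F p]
    (M : Matrix (Fin 3) (Fin 3) F) (hM : M.det = 1) :
    (∃ c : F, M ^ singerOrder F = scalar (Fin 3) c) ∨
      M ^ ((Nat.card F ^ 2 - 1) * (if p = 2 then 4 else p)) = 1 := by
  have h0 : M.charpoly.coeff 0 = -1 := by
    have := det_eq_sign_charpoly_coeff M
    rw [hM] at this
    linear_combination this + (by simp; ring_nf : (-1 : F) ^ Fintype.card (Fin 3) * M.charpoly.coeff 0 = - M.charpoly.coeff 0)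
  have hd : M.charpoly.natDegree = 3 := by simp
  by_cases hf : Irreducible M.charpoly
  · left
    obtain ⟨c, u, hu⟩ := dvd_X_pow_singerOrder_sub_C M.charpoly_monic hf hd h0
    refine ⟨c, ?_⟩
    have := congrArg (aeval M) hu
    rw [map_mul, aeval_self_charpoly, zero_mul] at this
    rw [map_sub, map_pow, aeval_X, aeval_C, sub_eq_zero] at this
    exact this
  · right
    obtain ⟨u, hu⟩ := dvd_X_pow_sub_X_pow_three M.charpoly_monic hf hd
    have h := congrArg (aeval M) hu
    rw [map_mul, aeval_self_charpoly, zero_mul, map_pow, map_sub, map_pow, aeval_X] at h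
    have hq := Nat.pos_of_ne_zero (pow_ne_zero 2 (one_lt_natCard (F := F)).ne_bot)
    have hfac : M ^ (Nat.card F ^ 2) - M = M * (M ^ (Nat.card F ^ 2 - 1) - 1) := by
      rw [mul_sub, mul_one, ← pow_succ', Nat.sub_add_cancel hq]
    have hcomm : Commute M (M ^ (Nat.card F ^ 2 - 1) - 1) :=
      ((Commute.refl M).pow_right _).sub_right (Commute.one_right _)
    rw [hfac, hcomm.mul_pow] at h
    have hu : IsUnit (M ^ 3) := ((Matrix.isUnit_iff_isUnit_det M).2 (by simp [hM])).pow 3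
    exact pow_eq_one_of_sq_sub_one_nilpotent p ((hu.mul_right_eq_zero).1 h)

theorem mk_pow_eq_one_iff {g : SL(3, F)} (s : ℕ) :
    (QuotientGroup.mk g : PSL(3, F)) ^ s = 1 ↔
      ∃ c : F, (g : Matrix (Fin 3) (Fin 3) F) ^ s = scalar (Fin 3) c := by
  rw [← QuotientGroup.mk_pow, QuotientGroup.eq_one_iff, Matrix.SpecialLinearGroup.mem_center_iff]
  constructor
  · rintro ⟨c, -, hc⟩
    exact ⟨c, by rw [hc, Matrix.SpecialLinearGroup.coe_pow]⟩
  · rintro ⟨c, hc⟩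
    refine ⟨c, ?_, by rw [Matrix.SpecialLinearGroup.coe_pow, hc]⟩
    have := (g ^ s).det_coe
    rw [Matrix.SpecialLinearGroup.coe_pow, hc] at this
    simpa using this

theorem PSL3_pow_dichotomy [Finite F] (p : ℕ) [Fact p.Prime] [CharP F p] (g : PSL(3, F)) :
    g ^ singerOrder F = 1 ∨ g ^ ((Nat.card F ^ 2 - 1) * (if p = 2 then 4 else p)) = 1 := by
  obtain ⟨g, rfl⟩ := QuotientGroup.mk_surjective g
  rcases matrix_pow_dichotomy p g.1 g.det_coe with h | h
  · exact Or.inl ((mk_pow_eq_one_iff _).2 h)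
  · exact Or.inr ((mk_pow_eq_one_iff _).2 ⟨1, by rw [h, map_one]⟩)

theorem isFull_of_dichotomy {H : Type*} [Group H] {X Y : ℕ} (h : ∀ g : H, g ^ X = 1 ∨ g ^ Y = 1)
    {r : ℕ} {e : H} (hX : ∃ A, Nat.Coprime A r ∧ X ∣ A * orderOf e)
    (hY : ∃ A, Nat.Coprime A r ∧ Y ∣ A * orderOf e) : IsFull r e := by
  intro g s hes hg
  rw [← pow_mul, ← orderOf_dvd_iff_pow_eq_one] at hg
  have hs := orderOf_dvd_of_pow_eq_one hes
  have key : ∀ Z, g ^ Z = 1 → (∃ A, Nat.Coprime A r ∧ Z ∣ A * orderOf e) → g ^ s = 1 := by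
    rintro Z hZ ⟨A, hA, hd⟩
    rw [← orderOf_dvd_iff_pow_eq_one]
    have h1 := ((orderOf_dvd_of_pow_eq_one hZ).trans hd).trans (mul_dvd_mul_left A hs)
    have h2 := Nat.dvd_gcd h1 (mul_comm s r ▸ hg)
    rwa [Nat.gcd_mul_right, hA, one_mul] at h2
  exact (h g).elim (fun h => key X h hX) (fun h => key Y h hY)

theorem singerOrder_coprime_sq_sub_one [Finite F] :
    Nat.Coprime (singerOrder F) (Nat.card F ^ 2 - 1) := by
  have hmul := singerOrder_mul F
  obtain ⟨r, hr⟩ : ∃ r, Nat.card F = r + 1 := ⟨Nat.card F - 1, by have := one_lt_natCard (F := F); omega⟩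
  rw [hr, Nat.add_sub_cancel] at hmul
  rw [hr, show (r + 1) ^ 2 - 1 = (r + 1 + 1) * r by
    rw [Nat.sub_eq_iff_eq_add (by nlinarith)]; ring]
  refine Nat.Coprime.mul_right ?_ ?_
  · refine Nat.Coprime.coprime_dvd_left ⟨_, hmul.symm⟩ ?_
    rw [show (r + 1) ^ 2 + (r + 1) + 1 = (r + 1) * (r + 1 + 1) + 1 by ring]
    simp
  · rcases (Nat.dvd_prime Nat.prime_three).1 (Nat.gcd_dvd_left 3 r) with h | h
    · rw [h, mul_one] at hmul
      rw [hmul, show (r + 1) ^ 2 + (r + 1) + 1 = 3 + (r + 3) * r by ring]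
      simpa using h
    · obtain ⟨t, rfl⟩ : 3 ∣ r := by rw [← h]; exact Nat.gcd_dvd_right 3 r
      rw [h] at hmul
      have : singerOrder F = (t + 1) * (3 * t) + 1 := by nlinarith
      rw [this]
      simp

theorem singerOrder_coprime_card [Finite F] : Nat.Coprime (singerOrder F) (Nat.card F) := by
  refine Nat.Coprime.coprime_dvd_left ⟨_, (singerOrder_mul F).symm⟩ ?_
  rw [show Nat.card F ^ 2 + Nat.card F + 1 = (Nat.card F + 1) * Nat.card F + 1 by ring]
  simp

end Exponent

section Elations

open Matrix Projectivization
open scoped LinearAlgebra.Projectivization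

variable {F : Type*} [Field F]

/-- The inverse transpose, i.e. the action of `SL₃` on the dual space. -/
def inverseTranspose : SL(3, F) →* SL(3, F) where
  toFun g := (g⁻¹).transpose
  map_one' := by
    apply Subtype.ext
    change (1⁻¹ : SL(3, F)).1.transpose = 1
    rw [inv_one, Matrix.SpecialLinearGroup.coe_one, transpose_one]
  map_mul' g h := by
    apply Subtype.ext
    change ((g * h)⁻¹ : SL(3, F)).1.transpose = (g⁻¹ : SL(3, F)).1.transpose *
      (h⁻¹ : SL(3, F)).1.transpose
    rw [_root_.mul_inv_rev, Matrix.SpecialLinearGroup.coe_mul, transpose_mul]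

@[simp]
theorem inverseTranspose_inverseTranspose (g : SL(3, F)) :
    inverseTranspose (inverseTranspose g) = g := by
  rw [← _root_.inv_inj]
  refine inv_eq_of_mul_eq_one_right ?_ |>.trans ?_ (b := (inverseTranspose g).transpose)
  · apply Subtype.ext
    change ((inverseTranspose g)⁻¹ : SL(3, F)).1.transpose * (inverseTranspose g).1.transpose = 1
    rw [← transpose_mul, ← Matrix.SpecialLinearGroup.coe_mul, mul_inv_cancel,
      Matrix.SpecialLinearGroup.coe_one, transpose_one]
  · rfl

theorem SL_smul_eq (g : SL(3, F)) (v : Fin 3 → F) : g • v = g.1 *ᵥ v := rfl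

theorem inverseTranspose_smul (g : SL(3, F)) (φ : Fin 3 → F) :
    inverseTranspose g • φ = φ ᵥ* (g⁻¹ : SL(3, F)).1 :=
  mulVec_transpose _ _

theorem inverseTranspose_smul_dotProduct_smul (g : SL(3, F)) (φ v : Fin 3 → F) :
    (inverseTranspose g • φ) ⬝ᵥ (g • v) = φ ⬝ᵥ v := by
  rw [inverseTranspose_smul, SL_smul_eq, ← dotProduct_mulVec, mulVec_mulVec,
    ← Matrix.SpecialLinearGroup.coe_mul, inv_mul_cancel, Matrix.SpecialLinearGroup.coe_one,
    one_mulVec]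

theorem orthogonal_smul (g : SL(3, F)) (x l : ℙ F (Fin 3 → F)) :
    orthogonal (g • x) (inverseTranspose g • l) ↔ orthogonal x l := by
  induction x with | h v hv
  induction l with | h φ hφ
  rw [smul_mk, smul_mk, orthogonal_mk, orthogonal_mk, dotProduct_comm,
    inverseTranspose_smul_dotProduct_smul, dotProduct_comm]

/-- The image of a subgroup of `SL₃` under the inverse transpose. -/
def dualSubgroup (K : Subgroup SL(3, F)) : Subgroup SL(3, F) := K.map inverseTranspose

theorem inverseTranspose_mem_dualSubgroup {K : Subgroup SL(3, F)} {g : SL(3, F)} :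
    inverseTranspose g ∈ dualSubgroup K ↔ g ∈ K :=
  Subgroup.mem_map_iff_mem (fun a b h => by
    rw [← inverseTranspose_inverseTranspose a, h, inverseTranspose_inverseTranspose])

theorem mem_dualSubgroup {K : Subgroup SL(3, F)} {g : SL(3, F)} :
    g ∈ dualSubgroup K ↔ inverseTranspose g ∈ K := by
  rw [← inverseTranspose_mem_dualSubgroup (K := K), inverseTranspose_inverseTranspose]

theorem dualSubgroup_dualSubgroup (K : Subgroup SL(3, F)) :
    dualSubgroup (dualSubgroup K) = K := by
  ext g
  rw [mem_dualSubgroup, inverseTranspose_mem_dualSubgroup]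

theorem eq_top_of_dualSubgroup_eq_top {K : Subgroup SL(3, F)} (h : dualSubgroup K = ⊤) :
    K = ⊤ := by
  refine top_unique fun g _ => ?_
  rw [← inverseTranspose_mem_dualSubgroup, h]
  trivial

/-- `K` contains the elation `x ↦ x + φ(x) v`. -/
def HasElation (K : Subgroup SL(3, F)) (v φ : Fin 3 → F) : Prop :=
  ∃ g ∈ K, (g : Matrix (Fin 3) (Fin 3) F) = 1 + vecMulVec v φ

theorem det_one_add_vecMulVec' (v φ : Fin 3 → F) : (1 + vecMulVec v φ).det = 1 + φ ⬝ᵥ v := by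
  rw [vecMulVec_eq Unit, det_one_add_replicateCol_mul_replicateRow]

theorem smul_of_coe_eq {g : SL(3, F)} {v φ : Fin 3 → F} (hg : g.1 = 1 + vecMulVec v φ)
    (x : Fin 3 → F) : g • x = x + (φ ⬝ᵥ x) • v := by
  rw [SL_smul_eq, hg, add_mulVec, one_mulVec, vecMulVec_mulVec]
  simp

theorem dotProduct_eq_zero_of_coe_eq {g : SL(3, F)} {v φ : Fin 3 → F}
    (hg : g.1 = 1 + vecMulVec v φ) : φ ⬝ᵥ v = 0 := by
  have h := det_one_add_vecMulVec' v φ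
  rw [← hg, g.det_coe] at h
  simpa using h.symm

theorem coe_inv_of_coe_eq {g : SL(3, F)} {v φ : Fin 3 → F} (hg : g.1 = 1 + vecMulVec v φ) :
    (g⁻¹ : SL(3, F)).1 = 1 + vecMulVec (-v) φ := by
  have h0 := dotProduct_eq_zero_of_coe_eq hg
  have h1 : (1 + vecMulVec (-v) φ).det = 1 := by
    rw [det_one_add_vecMulVec', dotProduct_neg, h0, neg_zero, add_zero]
  have h2 : g * ⟨1 + vecMulVec (-v) φ, h1⟩ = 1 := by
    apply Subtype.ext
    change g.1 * (1 + vecMulVec (-v) φ) = 1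
    rw [hg]
    simp [mul_add, add_mul, vecMulVec_mul_vecMulVec, h0, neg_vecMulVec]
  rw [inv_eq_of_mul_eq_one_right h2]

namespace HasElation

variable {K : Subgroup SL(3, F)} {v w φ ψ : Fin 3 → F}

theorem dotProduct_eq_zero (h : HasElation K v φ) : φ ⬝ᵥ v = 0 := by
  obtain ⟨g, -, hg⟩ := h
  exact dotProduct_eq_zero_of_coe_eq hg

theorem neg (h : HasElation K v φ) : HasElation K (-v) φ := by
  obtain ⟨g, hK, hg⟩ := h
  exact ⟨g⁻¹, K.inv_mem hK, coe_inv_of_coe_eq hg⟩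

theorem zero (φ : Fin 3 → F) : HasElation K 0 φ := ⟨1, K.one_mem, by simp⟩

theorem add_centre (h : HasElation K v φ) (h' : HasElation K w φ) : HasElation K (v + w) φ := by
  have h0 := h'.dotProduct_eq_zero
  obtain ⟨g, hK, hg⟩ := h
  obtain ⟨g', hK', hg'⟩ := h'
  refine ⟨g * g', K.mul_mem hK hK', ?_⟩
  rw [Matrix.SpecialLinearGroup.coe_mul, hg, hg']
  simp [mul_add, add_mul, vecMulVec_mul_vecMulVec, h0, add_vecMulVec]
  abel

theorem smul_comm_iff (c : F) : HasElation K (c • v) φ ↔ HasElation K v (c • φ) := by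
  unfold HasElation
  rw [smul_vecMulVec, vecMulVec_smul]

theorem conj {g : SL(3, F)} (hg : g ∈ K) (h : HasElation K v φ) :
    HasElation K (g • v) (inverseTranspose g • φ) := by
  obtain ⟨t, hK, ht⟩ := h
  refine ⟨g * t * g⁻¹, K.mul_mem (K.mul_mem hg hK) (K.inv_mem hg), ?_⟩
  rw [inverseTranspose_smul, Matrix.SpecialLinearGroup.coe_mul, Matrix.SpecialLinearGroup.coe_mul, ht, mul_add,
    add_mul, mul_one, ← Matrix.SpecialLinearGroup.coe_mul, mul_inv_cancel,
    Matrix.SpecialLinearGroup.coe_one, mul_vecMulVec, vecMulVec_mul,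
    SL_smul_eq]

theorem dual (h : HasElation K v φ) : HasElation (dualSubgroup K) φ v := by
  obtain ⟨t, hK, ht⟩ := h.neg
  refine ⟨inverseTranspose t, inverseTranspose_mem_dualSubgroup.2 hK, ?_⟩
  change (t⁻¹ : SL(3, F)).1.transpose = _
  rw [coe_inv_of_coe_eq ht, neg_neg, transpose_add, transpose_one, transpose_vecMulVec]

theorem of_dual (h : HasElation (dualSubgroup K) v φ) : HasElation K φ v := by
  have := h.dual
  rwa [dualSubgroup_dualSubgroup] at this

end HasElation

end Elations

section Generation

open Matrix Projectivization
open scoped LinearAlgebra.Projectivization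

variable {F : Type*} [Field F]

/-- `K` has no fixed point on the projective plane. -/
def NoFixedPoint (K : Subgroup SL(3, F)) : Prop :=
  ∀ x : ℙ F (Fin 3 → F), ∃ g ∈ K, g • x ≠ x

/-- `K` contains all the elations with axis `φ`. -/
def FullAxis (K : Subgroup SL(3, F)) (φ : Fin 3 → F) : Prop :=
  ∀ v, φ ⬝ᵥ v = 0 → HasElation K v φ

theorem FullAxis.add {K : Subgroup SL(3, F)} {φ ψ : Fin 3 → F} (hφ : FullAxis K φ)
    (hψ : FullAxis K ψ) : FullAxis K (φ + ψ) := by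
  by_cases h : ∀ v, φ ⬝ᵥ v = 0 → ψ ⬝ᵥ v = 0
  · by_cases h0 : φ = 0
    · simpa [h0] using hψ
    obtain ⟨x, hx⟩ : ∃ x, φ ⬝ᵥ x ≠ 0 := by
      by_contra! hc
      exact h0 (dotProduct_eq_zero φ hc)
    have hψ' : ψ = (ψ ⬝ᵥ x / φ ⬝ᵥ x) • φ := by
      refine dotProduct_eq _ _ fun w => ?_
      have h1 := h (w - (φ ⬝ᵥ w / φ ⬝ᵥ x) • x) (by
        rw [dotProduct_sub, dotProduct_smul, smul_eq_mul, div_mul_cancel₀ _ hx, sub_self])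
      rw [dotProduct_sub, dotProduct_smul, smul_eq_mul, sub_eq_zero] at h1
      rw [h1, smul_dotProduct, smul_eq_mul]
      ring
    intro v hv
    rw [hψ'] at hv ⊢
    generalize ψ ⬝ᵥ x / φ ⬝ᵥ x = c at hv ⊢
    have h2 : φ + c • φ = (1 + c) • φ := by rw [add_smul, one_smul]
    rw [h2] at hv ⊢
    rw [← HasElation.smul_comm_iff]
    refine hφ _ ?_
    rwa [dotProduct_smul, ← smul_dotProduct]
  · push Not at h
    obtain ⟨v, hv, hv'⟩ := h
    obtain ⟨g, hg, hgv⟩ := hφ ((-(ψ ⬝ᵥ v)⁻¹) • v) (by rw [dotProduct_smul, hv, smul_zero])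
    have hσ : inverseTranspose g • ψ = φ + ψ := by
      rw [inverseTranspose_smul, coe_inv_of_coe_eq hgv, vecMul_add, vecMul_one, vecMul_vecMulVec,
        neg_smul, neg_neg, dotProduct_smul, smul_eq_mul, inv_mul_cancel₀ hv', one_smul, add_comm]
    intro w hw
    have hw' : ψ ⬝ᵥ (g⁻¹ • w) = 0 := by
      rw [← inverseTranspose_smul_dotProduct_smul g, hσ, smul_inv_smul, hw]
    have := (hψ _ hw').conj hg
    rwa [hσ, smul_inv_smul] at this

theorem FullAxis.smul {K : Subgroup SL(3, F)} {φ : Fin 3 → F} (c : F) (hφ : FullAxis K φ) :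
    FullAxis K (c • φ) := by
  intro v hv
  rw [← HasElation.smul_comm_iff]
  exact hφ _ (by rwa [dotProduct_smul, ← smul_dotProduct])

theorem FullAxis.conj {K : Subgroup SL(3, F)} {φ : Fin 3 → F} (hφ : FullAxis K φ) {g : SL(3, F)}
    (hg : g ∈ K) : FullAxis K (inverseTranspose g • φ) := by
  intro w hw
  have := (hφ (g⁻¹ • w) (by rw [← inverseTranspose_smul_dotProduct_smul g, smul_inv_smul, hw])).conj
    hg
  rwa [smul_inv_smul] at this

/-- The forms which are axes of a full group of elations in `K`. -/
def fullAxes (K : Subgroup SL(3, F)) : Submodule F (Fin 3 → F) where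
  carrier := {φ | FullAxis K φ}
  add_mem' := FullAxis.add
  zero_mem' := fun v _ => ⟨1, K.one_mem, by simp⟩
  smul_mem' c _ := FullAxis.smul c

theorem eq_top_of_fullAxis {K : Subgroup SL(3, F)} {φ : Fin 3 → F} (hφ : φ ≠ 0)
    (h : FullAxis K φ) (hK : NoFixedPoint K) (hK' : NoFixedPoint (dualSubgroup K)) : K = ⊤ := by
  obtain ⟨g, hg, hgφ⟩ := hK' (mk F φ hφ)
  rw [mem_dualSubgroup] at hg
  rw [← inverseTranspose_inverseTranspose g] at hgφ
  generalize inverseTranspose g = g at hg hgφ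
  rw [smul_mk] at hgφ
  have hφ' := h.conj hg
  have htop : fullAxes K = ⊤ := by
    by_contra hne
    obtain ⟨f, hf0, hf⟩ := Submodule.exists_le_ker_of_lt_top _ (lt_top_iff_ne_top.2 hne)
    set v : Fin 3 → F := fun i => f (fun j => if i = j then 1 else 0) with hv
    have hfv : ∀ x, f x = x ⬝ᵥ v := fun x => by
      rw [LinearMap.pi_apply_eq_sum_univ f x]
      rfl
    have hv0 : v ≠ 0 := by
      intro h0
      exact hf0 (LinearMap.ext fun x => by rw [hfv, h0, dotProduct_zero]; rfl)
    have hperp : ∀ ψ, FullAxis K ψ → ψ ⬝ᵥ v = 0 := fun ψ hψ => by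
      rw [← hfv]
      exact hf hψ
    obtain ⟨k, hk, hkv⟩ := hK (mk F v hv0)
    rw [smul_mk] at hkv
    have hperp' : ∀ ψ, FullAxis K ψ → ψ ⬝ᵥ (k • v) = 0 := fun ψ hψ => by
      have := hperp _ (hψ.conj (K.inv_mem hk))
      rwa [← inverseTranspose_smul_dotProduct_smul k, ← mul_smul, ← map_mul, mul_inv_cancel,
        map_one, one_smul] at this
    rcases Configuration.ofField.eq_or_eq_of_orthogonal
      ((orthogonal_mk ((smul_ne_zero_iff_ne _).2 hφ) ((smul_ne_zero_iff_ne _).2 hv0)).2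
        (hperp' _ hφ'))
      ((orthogonal_mk hφ ((smul_ne_zero_iff_ne _).2 hv0)).2 (hperp' _ h))
      ((orthogonal_mk ((smul_ne_zero_iff_ne _).2 hφ) hv0).2 (hperp _ hφ'))
      ((orthogonal_mk hφ hv0).2 (hperp _ h)) with h1 | h1
    · exact hgφ h1
    · exact hkv h1
  refine eq_top_of_transvection_mem K fun i j hij a => ?_
  have hj : FullAxis K (Pi.single j 1) := by
    change _ ∈ fullAxes K
    rw [htop]
    trivial
  obtain ⟨t, ht, htm⟩ := hj (Pi.single i a) (by simp [hij])
  have : t = SpecialLinearGroup.transvection hij a := by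
    apply Subtype.ext
    rw [htm, SpecialLinearGroup.transvection_coe]
    ext r s
    simp only [Matrix.add_apply, vecMulVec_apply, Pi.single_apply, single_apply]
    grind
  rwa [← this]

theorem eq_of_dvd_of_one_add_mul_dvd {p f h : ℕ} (hp : p.Prime) (hh : h ∣ p ^ f) (h1 : 1 < h)
    (hN : 1 + (p ^ f + 1) * (h - 1) ∣ (p ^ f) ^ 2) : h = p ^ f := by
  obtain ⟨e, he⟩ := hh
  by_cases he1 : e = 1
  · rw [he, he1, mul_one]
  have hpe : p ∣ e := by
    obtain ⟨j, -, hj⟩ := (Nat.dvd_prime_pow hp).1 (Dvd.intro_left _ he.symm)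
    rw [hj]
    exact dvd_pow_self p (by rintro rfl; exact he1 (by simpa using hj))
  have hpos : 0 < p ^ f := pow_pos hp.pos f
  have hele : e ≤ p ^ f := Nat.le_of_dvd hpos (Dvd.intro_left _ he.symm)
  have hfac : 1 + (p ^ f + 1) * (h - 1) = h * (p ^ f + 1 - e) := by
    zify [h1.le, (by omega : e ≤ p ^ f + 1)]
    have : (p : ℤ) ^ f = h * e := by exact_mod_cast he
    linear_combination (-1) * this
  have hcop : Nat.Coprime (p ^ f + 1 - e) ((p ^ f) ^ 2) := by
    rw [← pow_mul]
    refine Nat.Coprime.pow_right _ (Nat.Coprime.symm ((Nat.Prime.coprime_iff_not_dvd hp).2 ?_))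
    intro hd
    have h2 : p ∣ p ^ f := hpe.trans (Dvd.intro_left _ he.symm)
    have h3 : p ∣ (p ^ f - e) := Nat.dvd_sub h2 hpe
    have h4 := (Nat.dvd_add_right h3).1 (by rwa [Nat.sub_add_comm hele] at hd)
    exact hp.one_lt.ne' (Nat.dvd_one.1 h4)
  have h5 := Nat.Coprime.eq_one_of_dvd hcop ((Dvd.intro_left _ hfac.symm).trans hN)
  have h6 : e = p ^ f := by omega
  rw [h6] at he
  have := Nat.eq_of_mul_eq_mul_right hpos ((one_mul _).trans he)
  omega

/-- The centres of the elations in `K` with axis `φ`. -/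
def elationCentres (K : Subgroup SL(3, F)) (φ : Fin 3 → F) : AddSubgroup (Fin 3 → F) where
  carrier := {v | HasElation K v φ}
  add_mem' := HasElation.add_centre
  zero_mem' := HasElation.zero φ
  neg_mem' := HasElation.neg

theorem mem_elationCentres {K : Subgroup SL(3, F)} {v φ : Fin 3 → F} :
    v ∈ elationCentres K φ ↔ HasElation K v φ := Iff.rfl

theorem elationCentres_le (K : Subgroup SL(3, F)) (φ : Fin 3 → F) :
    elationCentres K φ ≤ (LinearMap.ker (dotProductEquiv F (Fin 3) φ)).toAddSubgroup :=
  fun _ hv => hv.dotProduct_eq_zero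

/-- The scalars `c` such that `c • x` is the centre of an elation in `K` with axis `φ`. -/
def elationScalars (K : Subgroup SL(3, F)) (φ x : Fin 3 → F) : AddSubgroup F :=
  (elationCentres K φ).comap (LinearMap.toSpanSingleton F (Fin 3 → F) x).toAddMonoidHom

theorem mem_elationScalars {K : Subgroup SL(3, F)} {φ x : Fin 3 → F} {c : F} :
    c ∈ elationScalars K φ x ↔ HasElation K (c • x) φ := Iff.rfl

theorem mk_smul_eq_mk_iff {g : SL(3, F)} {x y : Fin 3 → F} (hx : x ≠ 0) (hy : y ≠ 0) :
    g • mk F x hx = mk F y hy ↔ ∃ c : F, c ≠ 0 ∧ g • x = c • y := by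
  rw [smul_mk, mk_eq_mk_iff]
  constructor
  · rintro ⟨c, hc⟩
    exact ⟨c, c.ne_zero, hc.symm⟩
  · rintro ⟨c, hc, h⟩
    exact ⟨Units.mk0 c hc, h.symm⟩

theorem natCard_elationScalars_le [Finite F] {K : Subgroup SL(3, F)} {φ x y : Fin 3 → F}
    (hφ : φ ≠ 0) (hx : x ≠ 0) (hy : y ≠ 0)
    (h : ∃ g ∈ K, inverseTranspose g • mk F φ hφ = mk F φ hφ ∧ g • mk F x hx = mk F y hy) :
    Nat.card (elationScalars K φ x) ≤ Nat.card (elationScalars K φ y) := by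
  obtain ⟨g, hg, h1, h2⟩ := h
  obtain ⟨u, hu, h1⟩ := (mk_smul_eq_mk_iff hφ hφ).1 h1
  obtain ⟨w, hw, h2⟩ := (mk_smul_eq_mk_iff hx hy).1 h2
  refine Nat.card_le_card_of_injective (fun a => ⟨u * (a.1 * w), ?_⟩) fun a b hab => ?_
  · have := (mem_elationScalars.1 a.2).conj hg
    rw [h1, smul_comm, h2, ← HasElation.smul_comm_iff] at this
    rwa [mem_elationScalars, mul_smul, mul_smul]
  · have := congrArg Subtype.val hab
    exact Subtype.ext (mul_right_cancel₀ hw (mul_left_cancel₀ hu this))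

theorem fullAxis_of_transitive [Finite F] {K : Subgroup SL(3, F)} {v φ : Fin 3 → F}
    (hφ : φ ≠ 0) (hv : v ≠ 0) (hel : HasElation K v φ)
    (htrans : ∀ x y (hx : x ≠ 0) (hy : y ≠ 0), φ ⬝ᵥ x = 0 → φ ⬝ᵥ y = 0 →
      ∃ g ∈ K, inverseTranspose g • mk F φ hφ = mk F φ hφ ∧ g • mk F x hx = mk F y hy) :
    FullAxis K φ := by
  classical
  have := Fintype.ofFinite F
  set V := LinearMap.ker (dotProductEquiv F (Fin 3) φ) with hV
  have hmemV : ∀ x, x ∈ V ↔ φ ⬝ᵥ x = 0 := fun _ => Iff.rfl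
  have hcardV : Nat.card V = Nat.card F ^ 2 := by
    have h1 := Module.Dual.finrank_ker_add_one_of_ne_zero (f := dotProductEquiv F (Fin 3) φ)
      (by simpa using hφ)
    rw [Module.finrank_fin_fun] at h1
    have h2 : Module.finrank F V = 2 := by
      rw [hV]
      exact Nat.succ_injective h1
    rw [Module.natCard_eq_pow_finrank (K := F) (V := V), h2]
  set h := Nat.card (elationScalars K φ v) with hh
  have hpos : 0 < h := Nat.card_pos
  have hall : ∀ x, x ≠ 0 → φ ⬝ᵥ x = 0 → Nat.card (elationScalars K φ x) = h := fun x hx hx' =>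
    le_antisymm (natCard_elationScalars_le hφ hx hv (htrans _ _ hx hv hx' hel.dotProduct_eq_zero))
      (natCard_elationScalars_le hφ hv hx (htrans _ _ hv hx hel.dotProduct_eq_zero hx'))
  have hdc := Finset.sum_card_bipartiteAbove_eq_sum_card_bipartiteBelow
    (s := Finset.univ.erase (0 : F)) (t := (Finset.univ.filter (· ∈ V)).erase 0)
    (fun c x => HasElation K (c • x) φ)
  have hA : ∀ c ∈ Finset.univ.erase (0 : F), (((Finset.univ.filter (· ∈ V)).erase 0).bipartiteAbove
      (fun c x => HasElation K (c • x) φ) c).card = Nat.card (elationCentres K φ) - 1 := by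
    intro c hc
    have hc0 := Finset.ne_of_mem_erase hc
    rw [Nat.card_eq_fintype_card, Fintype.card_subtype, ← Finset.card_erase_of_mem
      (a := (0 : Fin 3 → F)) (by simp [zero_mem])]
    refine Finset.card_bij' (fun x _ => c • x) (fun x _ => c⁻¹ • x) ?_ ?_ ?_ ?_
    · intro x hx
      simp only [Finset.mem_bipartiteAbove, Finset.mem_erase, Finset.mem_filter] at hx
      simp [mem_elationCentres, hx, hc0]
    · intro x hx
      simp only [Finset.mem_erase, Finset.mem_filter, mem_elationCentres] at hx
      simp [Finset.mem_bipartiteAbove, hx, hc0, hmemV, hx.2.2.dotProduct_eq_zero]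
    · intro x _
      exact inv_smul_smul₀ hc0 x
    · intro x _
      exact smul_inv_smul₀ hc0 x
  have hB : ∀ x ∈ (Finset.univ.filter (· ∈ V)).erase 0, ((Finset.univ.erase (0 : F)).bipartiteBelow
      (fun c x => HasElation K (c • x) φ) x).card = h - 1 := by
    intro x hx
    simp only [Finset.mem_erase, Finset.mem_filter, Finset.mem_univ, true_and, hmemV] at hx
    rw [← hall x hx.1 hx.2, Nat.card_eq_fintype_card, Fintype.card_subtype,
      ← Finset.card_erase_of_mem (a := (0 : F)) (by simp [zero_mem])]
    congr 1
    ext c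
    simp [Finset.mem_bipartiteBelow, mem_elationScalars]
  rw [Finset.sum_congr rfl hA, Finset.sum_congr rfl hB, Finset.sum_const, Finset.sum_const,
    Finset.card_erase_of_mem (Finset.mem_univ _), Finset.card_erase_of_mem (by simp [zero_mem]),
    ← Fintype.card_subtype, ← Nat.card_eq_fintype_card, Finset.card_univ,
    ← Nat.card_eq_fintype_card (α := F), hcardV, smul_eq_mul, smul_eq_mul] at hdc
  have hq := one_lt_natCard (F := F)
  have hApos : 0 < Nat.card (elationCentres K φ) := Nat.card_pos
  have hcardA : Nat.card (elationCentres K φ) = 1 + (Nat.card F + 1) * (h - 1) := by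
    have : Nat.card F ^ 2 - 1 = (Nat.card F - 1) * (Nat.card F + 1) := by
      rw [mul_comm, ← Nat.sq_sub_sq, one_pow]
    rw [this, mul_assoc] at hdc
    have := Nat.eq_of_mul_eq_mul_left (by omega) hdc
    omega
  have hdvd : Nat.card (elationCentres K φ) ∣ Nat.card F ^ 2 := by
    have h1 : elationCentres K φ ≤ V.toAddSubgroup := elationCentres_le K φ
    have h2 : Nat.card V.toAddSubgroup = Nat.card F ^ 2 := hcardV
    exact h2 ▸ AddSubgroup.card_dvd_of_le h1
  have h1 : 1 < h := by
    have : (1 : F) ∈ elationScalars K φ v := by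
      rw [mem_elationScalars, one_smul]
      exact hel
    rw [hh, Finite.one_lt_card_iff_nontrivial]
    exact ⟨⟨0, ⟨1, this⟩, fun h => zero_ne_one (congrArg Subtype.val h)⟩⟩
  obtain ⟨p, _⟩ := CharP.exists F
  obtain ⟨f, hp, hf⟩ := FiniteField.card F p
  rw [← Nat.card_eq_fintype_card] at hf
  have hhq : h = Nat.card F := by
    rw [hf]
    refine eq_of_dvd_of_one_add_mul_dvd hp ?_ h1 ?_
    · rw [← hf]
      exact AddSubgroup.card_addSubgroup_dvd_card _
    · rw [← hf, ← hcardA]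
      exact hdvd
  intro w hw
  by_cases hw0 : w = 0
  · rw [hw0]
    exact HasElation.zero φ
  have htop : elationScalars K φ w = ⊤ := by
    rw [← AddSubgroup.card_eq_iff_eq_top, hall w hw0 hw, hhq]
  have h1 : (1 : F) ∈ elationScalars K φ w := by rw [htop]; trivial
  rwa [mem_elationScalars, one_smul] at h1

end Generation

section Counting

open Finset

theorem dvd_card_of_blocks {α : Type*} [DecidableEq α] {N : ℕ} (Y : Finset α) (O : α → Finset α)
    (hN : ∀ x ∈ Y, (O x).card = N) (hmem : ∀ x ∈ Y, x ∈ O x) (hsub : ∀ x ∈ Y, O x ⊆ Y)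
    (heq : ∀ x ∈ Y, ∀ y ∈ O x, O y = O x) : N ∣ Y.card := by
  rw [card_eq_sum_card_image O Y]
  refine dvd_sum fun b hb => ?_
  obtain ⟨x, hx, rfl⟩ := mem_image.1 hb
  rw [← hN x hx]
  refine dvd_of_eq (congrArg card (Subset.antisymm ?_ ?_))
  · intro y hy
    exact mem_filter.2 ⟨hsub x hx hy, heq x hx y hy⟩
  · intro y hy
    obtain ⟨hy, hxy⟩ := mem_filter.1 hy
    exact hxy ▸ hmem y hy

section CyclicOrbit

variable {G α : Type*} [Group G] [MulAction G α]

theorem pow_smul_mem {a : G} {Y : Finset α} (hY : ∀ x ∈ Y, a • x ∈ Y) (i : ℕ) {x : α}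
    (hx : x ∈ Y) : a ^ i • x ∈ Y := by
  induction i with
  | zero => rwa [pow_zero, one_smul]
  | succ k ih => rw [pow_succ', mul_smul]; exact hY _ ih

variable [DecidableEq α]

/-- The orbit of `x` under the powers of `a`, if `a ^ n` fixes `x`. -/
def cyclicOrbit (a : G) (n : ℕ) (x : α) : Finset α := (range n).image fun i => a ^ i • x

theorem mem_cyclicOrbit {a : G} {n : ℕ} {x y : α} (hn : 0 < n) (hx : a ^ n • x = x) :
    y ∈ cyclicOrbit a n x ↔ ∃ i : ℕ, a ^ i • x = y := by
  simp only [cyclicOrbit, mem_image, mem_range]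
  constructor
  · rintro ⟨i, -, h⟩
    exact ⟨i, h⟩
  · rintro ⟨i, h⟩
    refine ⟨i % n, Nat.mod_lt _ hn, ?_⟩
    rw [← h]
    conv_rhs => rw [← Nat.mod_add_div i n, pow_add, mul_smul, pow_mul]
    congr 1
    induction i / n with
    | zero => rw [pow_zero, one_smul]
    | succ k ih => rw [pow_succ, mul_smul, hx, ← ih]

theorem card_cyclicOrbit {a : G} {n : ℕ} {x : α} (hx : ∀ s : ℕ, a ^ s • x = x → n ∣ s) :
    (cyclicOrbit a n x).card = n := by
  rw [cyclicOrbit, card_image_of_injOn, card_range]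
  have key : ∀ i j : ℕ, i ≤ j → j < n → a ^ i • x = a ^ j • x → i = j := by
    intro i j hij hj h
    have h1 : a ^ (j - i) • x = x := by
      rw [← smul_left_cancel_iff (a ^ i), ← mul_smul, ← pow_add, Nat.add_sub_cancel' hij, h]
    have := Nat.eq_zero_of_dvd_of_lt (hx _ h1) (by omega)
    omega
  intro i hi j hj h
  rw [coe_range, Set.mem_Iio] at hi hj
  rcases le_total i j with hij | hij
  · exact key i j hij hj h
  · exact (key j i hij hi h.symm).symm

theorem cyclicOrbit_eq_of_mem {a : G} {n : ℕ} {x y : α} (hn : 0 < n) (hx : a ^ n • x = x)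
    (hy : a ^ n • y = y) (h : y ∈ cyclicOrbit a n x) : cyclicOrbit a n y = cyclicOrbit a n x := by
  obtain ⟨i, rfl⟩ := (mem_cyclicOrbit hn hx).1 h
  ext z
  rw [mem_cyclicOrbit hn hy, mem_cyclicOrbit hn hx]
  constructor
  · rintro ⟨j, rfl⟩
    exact ⟨j + i, by rw [pow_add, mul_smul]⟩
  · rintro ⟨j, rfl⟩
    refine ⟨j + i * (n - 1), ?_⟩
    rw [← mul_smul, ← pow_add]
    have h1 : j + i * (n - 1) + i = j + n * i := by
      obtain ⟨m, rfl⟩ : ∃ m, n = m + 1 := ⟨n - 1, by omega⟩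
      rw [Nat.add_sub_cancel]
      ring
    rw [h1, pow_add, mul_smul, pow_mul]
    congr 1
    clear hy h h1
    induction i with
    | zero => rw [pow_zero, one_smul]
    | succ k ih => rw [pow_succ, mul_smul, hx, ih]

theorem dvd_card_of_forall_pow_smul_eq_iff {a : G} {n : ℕ} (hn : 0 < n) {Y : Finset α}
    (hY : ∀ x ∈ Y, a • x ∈ Y) (ha : ∀ x ∈ Y, ∀ s : ℕ, a ^ s • x = x ↔ n ∣ s) : n ∣ Y.card := by
  have hfix : ∀ x ∈ Y, a ^ n • x = x := fun x hx => (ha x hx n).2 dvd_rfl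
  have hsub : ∀ x ∈ Y, cyclicOrbit a n x ⊆ Y := by
    intro x hx y hy
    obtain ⟨i, rfl⟩ := (mem_cyclicOrbit hn (hfix x hx)).1 hy
    exact pow_smul_mem hY i hx
  refine dvd_card_of_blocks Y (cyclicOrbit a n) (fun x hx => card_cyclicOrbit fun s => (ha x hx s).1)
    (fun x hx => (mem_cyclicOrbit hn (hfix x hx)).2 ⟨0, by rw [pow_zero, one_smul]⟩) hsub
    fun x hx y hy => cyclicOrbit_eq_of_mem hn (hfix x hx) (hfix y (hsub x hx hy)) hy

theorem prime_dvd_card_of_smul_ne {a : G} {p : ℕ} (hp : p.Prime) (hap : a ^ p = 1) {Y : Finset α}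
    (hY : ∀ x ∈ Y, a • x ∈ Y) (ha : ∀ x ∈ Y, a • x ≠ x) : p ∣ Y.card := by
  refine dvd_card_of_forall_pow_smul_eq_iff hp.pos hY fun x hx s => ⟨fun h => ?_, ?_⟩
  · by_contra hps
    have h1 : a ^ Nat.gcd s p • x = x := by
      have h2 : a ^ s ∈ MulAction.stabilizer G x := h
      rw [← MulAction.mem_stabilizer_iff, ← zpow_natCast, Nat.gcd_eq_gcd_ab, zpow_add, zpow_mul,
        zpow_mul, zpow_natCast, zpow_natCast, hap, one_zpow, mul_one]
      exact Subgroup.zpow_mem _ h2 _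
    rw [((Nat.Prime.coprime_iff_not_dvd hp).2 hps).symm, pow_one] at h1
    exact ha x hx h1
  · rintro ⟨k, rfl⟩
    rw [pow_mul, hap, one_pow, one_smul]

theorem four_dvd_card_of_involutions {Y : Finset α} {s t : G} (hst : s * t = t * s)
    (hs : s * s = 1) (ht : t * t = 1) (hsY : ∀ x ∈ Y, s • x ∈ Y) (htY : ∀ x ∈ Y, t • x ∈ Y)
    (hs' : ∀ x ∈ Y, s • x ≠ x) (ht' : ∀ x ∈ Y, t • x ≠ x) (hst' : ∀ x ∈ Y, (s * t) • x ≠ x) :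
    4 ∣ Y.card := by
  have h1 : ∀ x : α, s • s • x = x := fun x => by rw [← mul_smul, hs, one_smul]
  have h2 : ∀ x : α, t • t • x = x := fun x => by rw [← mul_smul, ht, one_smul]
  have h3 : ∀ x : α, t • s • x = s • t • x := fun x => by rw [← mul_smul, ← mul_smul, hst]
  simp only [mul_smul] at hst'
  refine dvd_card_of_blocks Y (fun x => {x, s • x, t • x, s • t • x}) (fun x hx => ?_)
    (fun x _ => mem_insert_self _ _) (fun x hx y hy => ?_) fun x hx y hy => ?_
  · have e1 : s • x ≠ t • x := fun h => hst' x hx (by rw [← h, h1])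
    have e2 : s • x ≠ s • t • x := fun h => ht' x hx ((smul_left_cancel_iff s).1 h).symm
    have e3 : t • x ≠ s • t • x := fun h => hs' _ (htY x hx) h.symm
    rw [card_insert_of_notMem, card_insert_of_notMem, card_pair e3]
    · simp [e1, e2]
    · simp [(hs' x hx).symm, (ht' x hx).symm, (hst' x hx).symm]
  · simp only [mem_insert, mem_singleton] at hy
    rcases hy with rfl | rfl | rfl | rfl
    exacts [hx, hsY _ hx, htY _ hx, hsY _ (htY _ hx)]
  · simp only [mem_insert, mem_singleton] at hy
    rcases hy with rfl | rfl | rfl | rfl <;> ext z <;>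
      simp only [mem_insert, mem_singleton, h1, h2, h3] <;> tauto

end CyclicOrbit

open Matrix Projectivization
open scoped LinearAlgebra.Projectivization Classical

/-- The projective plane over `F`; its points and its lines are both represented this way. -/
abbrev Plane (F : Type*) [Field F] := ℙ F (Fin 3 → F)

variable {F : Type*} [Field F] [Finite F]

noncomputable instance : Fintype (Plane F) := Fintype.ofFinite _

/-- The points on a line, or the lines through a point. -/
noncomputable def polar (x : Plane F) : Finset (Plane F) := univ.filter fun y => orthogonal x y

theorem mem_polar {x y : Plane F} : y ∈ polar x ↔ orthogonal x y := by simp [polar]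

theorem mem_polar_comm {x y : Plane F} : y ∈ polar x ↔ x ∈ polar y := by
  rw [mem_polar, mem_polar, orthogonal_comm]

theorem card_plane : Fintype.card (Plane F) = Nat.card F ^ 2 + Nat.card F + 1 := by
  rw [← Nat.card_eq_fintype_card, Projectivization.card_of_finrank F _ (Module.finrank_fin_fun F)]
  simp [sum_range_succ]
  ring

theorem order_plane : Configuration.ProjectivePlane.order (Plane F) (Plane F) = Nat.card F := by
  have h := Configuration.ProjectivePlane.card_points (Plane F) (Plane F)
  rw [card_plane] at h
  nlinarith

theorem card_polar (x : Plane F) : (polar x).card = Nat.card F + 1 := by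
  have h := Configuration.ProjectivePlane.lineCount_eq (Plane F) x
  rw [order_plane, Configuration.lineCount, Nat.card_eq_fintype_card, Fintype.card_subtype] at h
  exact h

theorem card_polar_inter {x y : Plane F} (h : x ≠ y) : (polar x ∩ polar y).card = 1 := by
  rw [card_eq_one]
  refine ⟨cross x y, ?_⟩
  ext z
  rw [mem_inter, mem_singleton, mem_polar, mem_polar]
  constructor
  · rintro ⟨h1, h2⟩
    exact (Configuration.ofField.eq_or_eq_of_orthogonal h1 h2 (orthogonal_cross_left h)
      (orthogonal_cross_right h)).resolve_left h
  · rintro rfl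
    exact ⟨orthogonal_cross_left h, orthogonal_cross_right h⟩

theorem eq_of_mem_polar {x y z w : Plane F} (h : x ≠ y) (h1 : z ∈ polar x) (h2 : z ∈ polar y)
    (h3 : w ∈ polar x) (h4 : w ∈ polar y) : z = w := by
  rw [mem_polar] at *
  exact (Configuration.ofField.eq_or_eq_of_orthogonal h1 h2 h3 h4).resolve_left h

theorem card_erase_eq_sum (X : Finset (Plane F)) (P : Plane F) :
    (X.erase P).card = ∑ m ∈ polar P, ((X ∩ polar m).erase P).card := by
  have h := sum_card_bipartiteAbove_eq_sum_card_bipartiteBelow (s := polar P) (t := X.erase P)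
    (fun m x => x ∈ polar m)
  have h1 : ∀ m ∈ polar P, ((X ∩ polar m).erase P).card =
      ((X.erase P).bipartiteAbove (fun m x => x ∈ polar m) m).card := by
    refine fun m _ => congrArg card ?_
    ext x
    simp only [mem_bipartiteAbove, mem_erase, mem_inter]
    tauto
  rw [Finset.sum_congr rfl h1, h, Finset.sum_congr rfl (g := fun _ => 1), sum_const, smul_eq_mul,
    mul_one]
  intro x hx
  rw [← card_polar_inter (ne_of_mem_erase hx)]
  refine congrArg card ?_
  ext m
  rw [mem_bipartiteBelow, mem_inter, mem_polar_comm (x := m), and_comm]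

theorem sum_card_inter_polar (X : Finset (Plane F)) :
    ∑ l, (X ∩ polar l).card = (Nat.card F + 1) * X.card := by
  have h := sum_card_bipartiteAbove_eq_sum_card_bipartiteBelow (s := univ) (t := X)
    (fun l x => x ∈ polar l)
  have h1 : ∀ l ∈ univ, (X ∩ polar l).card = (X.bipartiteAbove (fun l x => x ∈ polar l) l).card :=
    fun l _ => congrArg card (by ext; rw [mem_bipartiteAbove, mem_inter])
  rw [Finset.sum_congr rfl h1, h, Finset.sum_congr rfl (g := fun _ => Nat.card F + 1), sum_const,
    smul_eq_mul, mul_comm]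
  intro x _
  rw [← card_polar x]
  refine congrArg card ?_
  ext m
  simp [mem_bipartiteBelow, mem_polar_comm (x := m)]

theorem sum_card_inter_polar_sq (X : Finset (Plane F)) :
    ∑ l, (X ∩ polar l).card ^ 2 = X.card ^ 2 + Nat.card F * X.card := by
  have h := sum_card_bipartiteAbove_eq_sum_card_bipartiteBelow (s := univ) (t := X ×ˢ X)
    (fun l x => x.1 ∈ polar l ∧ x.2 ∈ polar l)
  have h1 : ∀ l ∈ univ, (X ∩ polar l).card ^ 2 =
      ((X ×ˢ X).bipartiteAbove (fun l x => x.1 ∈ polar l ∧ x.2 ∈ polar l) l).card := by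
    intro l _
    rw [sq, ← card_product]
    refine congrArg card ?_
    ext x
    simp only [mem_product, mem_inter, mem_bipartiteAbove]
    tauto
  have h2 : ∀ x ∈ X ×ˢ X, ((univ : Finset (Plane F)).bipartiteBelow
      (fun l x => x.1 ∈ polar l ∧ x.2 ∈ polar l) x).card =
        1 + if x.1 = x.2 then Nat.card F else 0 := by
    rintro ⟨x, y⟩ _
    have : (univ : Finset (Plane F)).bipartiteBelow
        (fun l x => x.1 ∈ polar l ∧ x.2 ∈ polar l) (x, y) = polar x ∩ polar y := by
      ext m
      simp [mem_bipartiteBelow, mem_polar_comm (x := m)]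
    rw [this]
    by_cases hxy : x = y
    · rw [hxy, inter_self, card_polar, if_pos rfl, add_comm]
    · rw [card_polar_inter hxy, if_neg hxy]
  rw [Finset.sum_congr rfl h1, h, Finset.sum_congr rfl h2, sum_add_distrib, sum_const, card_product,
    smul_eq_mul, mul_one, ← sq, sum_product]
  simp [mul_comm]

end Counting

section Flags

open Matrix Projectivization Finset
open scoped LinearAlgebra.Projectivization Classical

variable {F : Type*} [Field F]

/-- `K` contains a nontrivial elation with centre `P` and axis `m`. -/
def IsElationFlag (K : Subgroup SL(3, F)) (P m : Plane F) : Prop :=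
  ∃ (v φ : Fin 3 → F) (hv : v ≠ 0) (hφ : φ ≠ 0), P = mk F v hv ∧ m = mk F φ hφ ∧ HasElation K v φ

namespace IsElationFlag

variable {K : Subgroup SL(3, F)} {P m : Plane F}

theorem conj (h : IsElationFlag K P m) {g : SL(3, F)} (hg : g ∈ K) :
    IsElationFlag K (g • P) (inverseTranspose g • m) := by
  obtain ⟨v, φ, hv, hφ, rfl, rfl, hel⟩ := h
  exact ⟨g • v, inverseTranspose g • φ, (smul_ne_zero_iff_ne _).2 hv, (smul_ne_zero_iff_ne _).2 hφ,
    smul_mk _ _, smul_mk _ _, hel.conj hg⟩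

theorem dual (h : IsElationFlag K P m) : IsElationFlag (dualSubgroup K) m P := by
  obtain ⟨v, φ, hv, hφ, rfl, rfl, hel⟩ := h
  exact ⟨φ, v, hφ, hv, rfl, rfl, hel.dual⟩

theorem of_dual (h : IsElationFlag (dualSubgroup K) m P) : IsElationFlag K P m := by
  have := h.dual
  rwa [dualSubgroup_dualSubgroup] at this

end IsElationFlag

theorem smul_mk_eq_iff_of_coe_eq {g : SL(3, F)} {v φ : Fin 3 → F}
    (hg : g.1 = 1 + vecMulVec v φ) (hv : v ≠ 0) (hφ : φ ≠ 0) (x : Plane F) :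
    g • x = x ↔ orthogonal (mk F φ hφ) x := by
  induction x using Projectivization.ind with | h w hw
  rw [orthogonal_mk, mk_smul_eq_mk_iff, smul_of_coe_eq hg]
  constructor
  · rintro ⟨c, -, hc⟩
    by_contra h0
    have h1 : (φ ⬝ᵥ w) • v = (c - 1) • w := by rw [sub_smul, one_smul, ← hc]; abel
    have h2 := congrArg (φ ⬝ᵥ ·) h1
    simp only [dotProduct_smul, dotProduct_eq_zero_of_coe_eq hg, smul_eq_mul, mul_zero] at h2
    rcases mul_eq_zero.1 h2.symm with h3 | h3
    · rw [h3, zero_smul] at h1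
      exact (smul_ne_zero h0 hv) h1
    · exact h0 h3
  · intro h0
    exact ⟨1, one_ne_zero, by rw [h0, zero_smul, add_zero, one_smul]⟩

theorem pow_coe_of_coe_eq {g : SL(3, F)} {v φ : Fin 3 → F} (hg : g.1 = 1 + vecMulVec v φ) (k : ℕ) :
    (g ^ k : SL(3, F)).1 = 1 + vecMulVec ((k : F) • v) φ := by
  have h0 := dotProduct_eq_zero_of_coe_eq hg
  induction k with
  | zero => simp
  | succ k ih =>
    rw [pow_succ, Matrix.SpecialLinearGroup.coe_mul, ih, hg]
    simp [mul_add, add_mul, vecMulVec_mul_vecMulVec, h0, add_vecMulVec, smul_vecMulVec, add_smul]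
    abel

theorem coe_inverseTranspose_of_coe_eq {g : SL(3, F)} {v φ : Fin 3 → F}
    (hg : g.1 = 1 + vecMulVec v φ) : (inverseTranspose g).1 = 1 + vecMulVec φ (-v) := by
  change (g⁻¹ : SL(3, F)).1.transpose = _
  rw [coe_inv_of_coe_eq hg, transpose_add, transpose_one, transpose_vecMulVec]

theorem inverseTranspose_smul_eq_self {g : SL(3, F)} {v φ : Fin 3 → F}
    (hg : g.1 = 1 + vecMulVec v φ) (hv : v ≠ 0) (hφ : φ ≠ 0) {l : Plane F}
    (hl : orthogonal l (mk F v hv)) : inverseTranspose g • l = l := by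
  rw [smul_mk_eq_iff_of_coe_eq (coe_inverseTranspose_of_coe_eq hg) hφ (neg_ne_zero.2 hv)]
  induction l using Projectivization.ind with | h w hw
  rw [orthogonal_mk] at hl ⊢
  rw [neg_dotProduct, dotProduct_comm, hl, neg_zero]

theorem IsElationFlag.exists_elation {K : Subgroup SL(3, F)} {P m : Plane F}
    (h : IsElationFlag K P m) (p : ℕ) [CharP F p] : ∃ t ∈ K, t ^ p = 1 ∧
      (∀ x, t • x = x ↔ orthogonal m x) ∧ ∀ l, orthogonal l P → inverseTranspose t • l = l := by
  obtain ⟨v, φ, hv, hφ, rfl, rfl, t, ht, htm⟩ := h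
  refine ⟨t, ht, ?_, smul_mk_eq_iff_of_coe_eq htm hv hφ,
    fun l hl => inverseTranspose_smul_eq_self htm hv hφ hl⟩
  apply Subtype.ext
  rw [pow_coe_of_coe_eq htm, CharP.cast_eq_zero, zero_smul, zero_vecMulVec, add_zero,
    Matrix.SpecialLinearGroup.coe_one]

variable [Finite F]

theorem IsElationFlag.mem_polar {K : Subgroup SL(3, F)} {P m : Plane F}
    (h : IsElationFlag K P m) : P ∈ polar m := by
  obtain ⟨v, φ, hv, hφ, rfl, rfl, hel⟩ := h
  rw [_root_.mem_polar, orthogonal_mk, hel.dotProduct_eq_zero]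

theorem smul_mem_polar_iff (g : SL(3, F)) (x l : Plane F) :
    g • x ∈ polar (inverseTranspose g • l) ↔ x ∈ polar l := by
  rw [_root_.mem_polar, _root_.mem_polar, orthogonal_comm, orthogonal_smul, orthogonal_comm]

theorem IsElationFlag.prime_dvd_card {K : Subgroup SL(3, F)} {P m l : Plane F}
    (h : IsElationFlag K P m) {p : ℕ} (hp : p.Prime) [CharP F p] (hl : P ∈ polar l) (hlm : l ≠ m)
    {X : Finset (Plane F)}
    (hX : ∀ g ∈ K, inverseTranspose g • l = l → ∀ x ∈ X, g • x ∈ X) :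
    p ∣ ((X ∩ polar l).erase P).card := by
  obtain ⟨t, ht, htp, hfix, hline⟩ := h.exists_elation p
  have htl := hline l (_root_.mem_polar.1 hl)
  have htP : t • P = P := (hfix P).2 (_root_.mem_polar.1 h.mem_polar)
  refine prime_dvd_card_of_smul_ne hp htp (fun x hx => ?_) fun x hx hx' => ?_
  · rw [mem_erase, mem_inter] at hx ⊢
    refine ⟨fun h => hx.1 ?_, hX t ht htl x hx.2.1, ?_⟩
    · rwa [← htP, smul_left_cancel_iff] at h
    · rw [← htl, smul_mem_polar_iff]
      exact hx.2.2
  · rw [mem_erase, mem_inter] at hx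
    rw [hfix, ← _root_.mem_polar] at hx'
    exact hx.1 (eq_of_mem_polar hlm hx.2.2 hx' hl h.mem_polar)

/-- The orbit of a point under `K`. -/
noncomputable def pointOrbit (K : Subgroup SL(3, F)) (P : Plane F) : Finset (Plane F) :=
  univ.filter fun x => ∃ g ∈ K, g • P = x

theorem mem_pointOrbit {K : Subgroup SL(3, F)} {P x : Plane F} :
    x ∈ pointOrbit K P ↔ ∃ g ∈ K, g • P = x := by simp [pointOrbit]

theorem self_mem_pointOrbit (K : Subgroup SL(3, F)) (P : Plane F) : P ∈ pointOrbit K P :=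
  mem_pointOrbit.2 ⟨1, K.one_mem, one_smul _ _⟩

theorem smul_mem_pointOrbit {K : Subgroup SL(3, F)} {P x : Plane F} {g : SL(3, F)} (hg : g ∈ K)
    (hx : x ∈ pointOrbit K P) : g • x ∈ pointOrbit K P := by
  obtain ⟨k, hk, rfl⟩ := mem_pointOrbit.1 hx
  exact mem_pointOrbit.2 ⟨g * k, K.mul_mem hg hk, mul_smul _ _ _⟩

end Flags

section Singer

open Matrix Projectivization Finset
open scoped LinearAlgebra.Projectivization Classical

variable {F : Type*} [Field F]

/-- `a` acts on the points and on the lines with all orbits of length `singerOrder F`. -/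
structure IsSinger (a : SL(3, F)) : Prop where
  point : ∀ (x : Plane F) (s : ℕ), a ^ s • x = x ↔ singerOrder F ∣ s
  line : ∀ (x : Plane F) (s : ℕ), inverseTranspose a ^ s • x = x ↔ singerOrder F ∣ s

theorem IsSinger.dual {a : SL(3, F)} (h : IsSinger a) : IsSinger (inverseTranspose a) :=
  ⟨h.line, by rw [inverseTranspose_inverseTranspose]; exact h.point⟩

variable [Finite F]

theorem one_lt_singerOrder : 1 < singerOrder F := by
  have h := singerOrder_mul (F := F)
  have h1 := one_lt_natCard (F := F)
  have h2 : Nat.gcd 3 (Nat.card F - 1) ≤ 3 := Nat.gcd_le_left _ (by norm_num)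
  by_contra! h3
  have : singerOrder F * Nat.gcd 3 (Nat.card F - 1) ≤ 1 * 3 := Nat.mul_le_mul h3 h2
  nlinarith

theorem IsSinger.noFixedPoint {a : SL(3, F)} (h : IsSinger a) {K : Subgroup SL(3, F)}
    (ha : a ∈ K) : NoFixedPoint K := by
  refine fun x => ⟨a, ha, fun hx => ?_⟩
  have := (h.point x 1).1 (by rwa [pow_one])
  exact one_lt_singerOrder.ne' (Nat.dvd_one.1 this)

theorem IsSinger.sum_eq {a : SL(3, F)} (h : IsSinger a)
    (h3 : singerOrder F * 3 = Nat.card F ^ 2 + Nat.card F + 1) (x : Plane F) :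
    ∃ y z, ∀ f : Plane F → ℕ, (∀ w, f (a • w) = f w) →
      ∑ w, f w = singerOrder F * (f x + f y + f z) := by
  set n := singerOrder F with hn
  have hn1 : 1 < n := one_lt_singerOrder
  set O := fun w : Plane F => cyclicOrbit a n w with hO
  have hcard : ∀ w, (O w).card = n := fun w => card_cyclicOrbit fun s => (h.point w s).1
  have hfix : ∀ w : Plane F, a ^ n • w = w := fun w => (h.point w n).2 dvd_rfl
  have hmem : ∀ w w', w' ∈ O w ↔ ∃ i : ℕ, a ^ i • w = w' := fun w w' =>
    mem_cyclicOrbit (by omega) (hfix w)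
  have hself : ∀ w, w ∈ O w := fun w => (hmem w w).2 ⟨0, by rw [pow_zero, one_smul]⟩
  have hdisj : ∀ w w', w' ∉ O w → Disjoint (O w) (O w') := by
    intro w w' hw
    rw [Finset.disjoint_left]
    intro u hu hu'
    apply hw
    have h1 : O u = O w := cyclicOrbit_eq_of_mem (by omega) (hfix _) (hfix _) hu
    have h2 : O u = O w' := cyclicOrbit_eq_of_mem (by omega) (hfix _) (hfix _) hu'
    rw [← h1, h2]
    exact hself w'
  have huniv : (univ : Finset (Plane F)).card = 3 * n := by
    rw [card_univ, card_plane, ← h3, mul_comm]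
  obtain ⟨y, hy⟩ : ∃ y, y ∉ O x := by
    by_contra! hc
    have := congrArg card (eq_univ_iff_forall.2 hc)
    rw [huniv, hcard] at this
    omega
  obtain ⟨z, hz⟩ : ∃ z, z ∉ O x ∪ O y := by
    by_contra! hc
    have := congrArg card (eq_univ_iff_forall.2 hc)
    rw [huniv, card_union_of_disjoint (hdisj _ _ hy), hcard, hcard] at this
    omega
  rw [mem_union, not_or] at hz
  have hxyz : Disjoint (O x ∪ O y) (O z) :=
    disjoint_union_left.2 ⟨hdisj _ _ hz.1, hdisj _ _ hz.2⟩
  have hun : O x ∪ O y ∪ O z = univ := by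
    refine eq_univ_of_card _ ?_
    rw [card_union_of_disjoint hxyz, card_union_of_disjoint (hdisj _ _ hy), hcard, hcard, hcard,
      ← card_univ, huniv]
    ring
  refine ⟨y, z, fun f hf => ?_⟩
  have hconst : ∀ w, ∑ u ∈ O w, f u = n * f w := by
    intro w
    rw [Finset.sum_congr rfl (g := fun _ => f w), sum_const, hcard, smul_eq_mul]
    intro u hu
    obtain ⟨i, rfl⟩ := (hmem w u).1 hu
    clear hu
    induction i with
    | zero => rw [pow_zero, one_smul]
    | succ k ih => rw [pow_succ', mul_smul, hf, ih]
  rw [← hun, sum_union hxyz, sum_union (hdisj _ _ hy), hconst, hconst, hconst]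
  ring

theorem inv_smul_mem_of_forall {G α : Type*} [Group G] [MulAction G α] {a : G} {Y : Finset α}
    (hY : ∀ x ∈ Y, a • x ∈ Y) {x : α} (hx : x ∈ Y) : a⁻¹ • x ∈ Y := by
  have h := Finset.eq_of_subset_of_card_le (s := Y.image (a • ·)) (t := Y)
    (image_subset_iff.2 hY) (card_image_of_injective _ (MulAction.injective a)).ge
  rw [← h] at hx
  obtain ⟨y, hy, rfl⟩ := mem_image.1 hx
  rwa [inv_smul_smul]

theorem card_inter_polar_smul {a : SL(3, F)} {X : Finset (Plane F)} (hX : ∀ x ∈ X, a • x ∈ X)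
    (l : Plane F) : (X ∩ polar (inverseTranspose a • l)).card = (X ∩ polar l).card := by
  refine card_bij' (fun x _ => a⁻¹ • x) (fun x _ => a • x) (fun x hx => ?_) (fun x hx => ?_)
    (fun x _ => smul_inv_smul _ _) fun x _ => inv_smul_smul _ _
  · rw [mem_inter] at hx ⊢
    refine ⟨inv_smul_mem_of_forall hX hx.1, ?_⟩
    rw [← smul_mem_polar_iff a, smul_inv_smul]
    exact hx.2
  · rw [mem_inter] at hx ⊢
    exact ⟨hX x hx.1, (smul_mem_polar_iff _ _ _).2 hx.2⟩

theorem mod_four_eq_three {q n c₁ c₂ c₃ : ℕ} (hq : 16 ∣ q) (hn : n * 3 = q ^ 2 + q + 1)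
    (h1 : c₁ + c₂ + c₃ = q + 1) (h2 : c₁ ^ 2 + c₂ ^ 2 + c₃ ^ 2 = n + q) : c₁ % 4 = 3 := by
  obtain ⟨r, rfl⟩ := hq
  have hn' : (n : ZMod 16) = 11 := by
    have := congrArg (Nat.cast : ℕ → ZMod 16) hn
    push_cast at this
    rw [show (16 : ZMod 16) = 0 from rfl] at this
    have h11 : (3 : ZMod 16) * 11 = 1 := rfl
    linear_combination (11 : ZMod 16) * this - (n : ZMod 16) * h11
  have h16 : (16 : ZMod 16) = 0 := rfl
  have key : ∀ a b : ZMod 16, a ^ 2 + b ^ 2 + (1 - a - b) ^ 2 = 11 → a.val % 4 = 3 := by decide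
  have h1' := congrArg (Nat.cast : ℕ → ZMod 16) h1
  have h2' := congrArg (Nat.cast : ℕ → ZMod 16) h2
  push_cast at h1' h2'
  rw [h16, zero_mul, zero_add] at h1'
  rw [h16, zero_mul, add_zero, hn'] at h2'
  have h3 : (c₃ : ZMod 16) = 1 - c₁ - c₂ := by linear_combination h1'
  rw [h3] at h2'
  have := key _ _ h2'
  rw [ZMod.val_natCast] at this
  omega

theorem sixteen_dvd_of_three_dvd {f : ℕ} (h1 : 1 < 2 ^ f) (h3 : 3 ∣ 2 ^ f - 1) (h4 : 2 ^ f ≠ 4) :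
    16 ∣ 2 ^ f := by
  rcases Nat.lt_or_ge f 4 with h | h
  · interval_cases f <;> omega
  · exact pow_dvd_pow 2 h

theorem IsSinger.eq_univ_or {a : SL(3, F)} (ha : IsSinger a) (hq4 : Nat.card F ≠ 4) {p : ℕ}
    [CharP F p] {X : Finset (Plane F)} (hX : ∀ x ∈ X, a • x ∈ X) (hmod : X.card ≡ 1 [MOD p]) :
    X = univ ∨ (p = 2 ∧ 4 < Nat.card F ∧ ∀ l, (X ∩ polar l).card % 4 = 3) := by
  have := Fintype.ofFinite F
  obtain ⟨f, hp, hf⟩ := FiniteField.card F p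
  rw [← Nat.card_eq_fintype_card] at hf
  have hpq : p ∣ Nat.card F := by rw [hf]; exact dvd_pow_self p f.ne_zero
  have hmul := singerOrder_mul (F := F)
  have hn1 := one_lt_singerOrder (F := F)
  obtain ⟨j, hj⟩ := dvd_card_of_forall_pow_smul_eq_iff (by omega) hX fun x _ => ha.point x
  have hcard : X.card ≤ singerOrder F * Nat.gcd 3 (Nat.card F - 1) := by
    rw [hmul, ← card_plane]
    exact card_le_univ X
  have hj1 : j ≠ 0 := by
    rintro rfl
    rw [hj, mul_zero] at hmod
    have := (Nat.modEq_iff_dvd' (by omega)).1 hmod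
    exact hp.one_lt.ne' (Nat.dvd_one.1 this)
  rw [hj] at hcard hmod
  have hjd := Nat.le_of_mul_le_mul_left hcard (by omega)
  rw [← card_eq_iff_eq_univ, card_plane, ← hmul, hj]
  rcases (Nat.dvd_prime Nat.prime_three).1 (Nat.gcd_dvd_left 3 (Nat.card F - 1)) with hd | hd
  · left
    rw [hd] at hjd ⊢
    rw [show j = 1 by omega]
  rw [hd] at hjd hmul ⊢
  by_cases hj3 : j = 3
  · left; rw [hj3]
  right
  have h3n : singerOrder F * 3 ≡ 1 [MOD p] := by
    rw [hmul]
    exact (Nat.modEq_iff_dvd' (by omega)).2 (by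
      rw [Nat.add_sub_cancel]
      exact dvd_add (hpq.trans (dvd_pow_self _ two_ne_zero)) hpq) |>.symm
  have hj3' : j ≡ 3 [MOD p] := by
    have h1 : j * (singerOrder F * 3) ≡ j * 1 [MOD p] := h3n.mul_left j
    have h2 : 3 * (singerOrder F * j) ≡ 3 * 1 [MOD p] := hmod.mul_left 3
    rw [mul_one] at h1 h2
    exact h1.symm.trans ((by ring : j * (singerOrder F * 3) = 3 * (singerOrder F * j)) ▸ h2)
  have hdvd := (Nat.modEq_iff_dvd' hjd).1 hj3'
  have hp2 : p = 2 ∧ j = 1 := by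
    have h12 : j = 1 ∨ j = 2 := by omega
    rcases h12 with rfl | rfl
    · exact ⟨(Nat.prime_dvd_prime_iff_eq hp Nat.prime_two).1 hdvd, rfl⟩
    · exact absurd (Nat.dvd_one.1 hdvd) hp.one_lt.ne'
  obtain ⟨rfl, rfl⟩ := hp2
  rw [mul_one] at hj
  have h3q : 3 ∣ 2 ^ (f : ℕ) - 1 := by rw [← hf, ← hd]; exact Nat.gcd_dvd_right _ _
  have hq1 := one_lt_natCard (F := F)
  have h16 : 16 ∣ Nat.card F := by
    rw [hf] at hq1 hq4 ⊢
    exact sixteen_dvd_of_three_dvd hq1 h3q hq4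
  refine ⟨rfl, lt_of_lt_of_le (by norm_num) (Nat.le_of_dvd (by omega) h16), fun l => ?_⟩
  obtain ⟨y, z, hsum⟩ := ha.dual.sum_eq hmul l
  have h1 := hsum (fun l => (X ∩ polar l).card) (card_inter_polar_smul hX)
  have h2 := hsum (fun l => (X ∩ polar l).card ^ 2) fun l => by rw [card_inter_polar_smul hX]
  rw [sum_card_inter_polar, hj, mul_comm] at h1
  rw [sum_card_inter_polar_sq, hj] at h2
  refine mod_four_eq_three h16 hmul (Nat.eq_of_mul_eq_mul_left (by omega) h1).symm
    (Nat.eq_of_mul_eq_mul_left (by omega : 0 < singerOrder F) ?_)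
  rw [← h2]
  ring

end Singer

section SingerGeneration

open Matrix Projectivization Finset
open scoped LinearAlgebra.Projectivization Classical

variable {F : Type*} [Field F] [Finite F]

theorem smul_mem_erase_and_ne {t : SL(3, F)} {v φ : Fin 3 → F} (ht : t.1 = 1 + vecMulVec v φ)
    (hv : v ≠ 0) (hφ : φ ≠ 0) {l : Plane F} (hl : mk F v hv ∈ polar l) (hlm : l ≠ mk F φ hφ)
    {X : Finset (Plane F)} (hX : ∀ x ∈ X, t • x ∈ X) {x : Plane F}
    (hx : x ∈ (X ∩ polar l).erase (mk F v hv)) :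
    t • x ∈ (X ∩ polar l).erase (mk F v hv) ∧ t • x ≠ x := by
  have hfix := smul_mk_eq_iff_of_coe_eq ht hv hφ
  have hPm : orthogonal (mk F φ hφ) (mk F v hv) := by
    rw [orthogonal_mk, dotProduct_eq_zero_of_coe_eq ht]
  have htP := (hfix _).2 hPm
  have htl := inverseTranspose_smul_eq_self ht hv hφ (mem_polar.1 hl)
  rw [mem_erase, mem_inter] at hx ⊢
  refine ⟨⟨fun h => hx.1 ?_, hX x hx.2.1, ?_⟩, fun h => ?_⟩
  · rwa [← htP, smul_left_cancel_iff] at h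
  · rw [← htl, smul_mem_polar_iff]
    exact hx.2.2
  · rw [hfix, ← mem_polar] at h
    exact hx.1 (eq_of_mem_polar hlm hx.2.2 h hl (mem_polar.2 hPm))

theorem IsElationFlag.prime_dvd_card_of_ne {K : Subgroup SL(3, F)} {P m₁ m₂ l : Plane F}
    (h₁ : IsElationFlag K P m₁) (h₂ : IsElationFlag K P m₂) (h : m₁ ≠ m₂) {p : ℕ} (hp : p.Prime)
    [CharP F p] (hl : P ∈ polar l) {X : Finset (Plane F)}
    (hX : ∀ g ∈ K, inverseTranspose g • l = l → ∀ x ∈ X, g • x ∈ X) :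
    p ∣ ((X ∩ polar l).erase P).card := by
  by_cases hl1 : l = m₁
  · exact h₂.prime_dvd_card hp hl (hl1 ▸ h) hX
  · exact h₁.prime_dvd_card hp hl hl1 hX

theorem card_mod_of_forall_dvd {p : ℕ} {X : Finset (Plane F)} {P : Plane F} (hP : P ∈ X)
    (h : ∀ l ∈ polar P, p ∣ ((X ∩ polar l).erase P).card) : X.card ≡ 1 [MOD p] := by
  have h1 : p ∣ (X.erase P).card := by
    rw [card_erase_eq_sum]
    exact dvd_sum h
  rw [card_erase_of_mem hP] at h1
  exact ((Nat.modEq_iff_dvd' (card_pos.2 ⟨P, hP⟩)).2 h1).symm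

theorem four_dvd_card_of_two_axes [CharP F 2] {K : Subgroup SL(3, F)} {P m₁ m₂ : Plane F}
    (hq : 4 < Nat.card F) (h₁ : IsElationFlag K P m₁) (h₂ : IsElationFlag K P m₂) (h : m₁ ≠ m₂)
    {X : Finset (Plane F)} (hX : ∀ g ∈ K, ∀ x ∈ X, g • x ∈ X) :
    ∃ l, P ∈ polar l ∧ 4 ∣ ((X ∩ polar l).erase P).card := by
  obtain ⟨v, φ, hv, hφ, rfl, rfl, hel⟩ := h₁
  obtain ⟨w, ψ', hw, hψ', hvw, rfl, hel'⟩ := h₂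
  obtain ⟨c, hc⟩ := (mk_eq_mk_iff F w v hw hv).1 hvw.symm
  obtain ⟨ψ, hψ, h, hel''⟩ : ∃ (ψ : Fin 3 → F) (hψ : ψ ≠ 0), mk F φ hφ ≠ mk F ψ hψ ∧
      HasElation K v ψ := by
    refine ⟨(c : F) • ψ', smul_ne_zero c.ne_zero hψ', ?_, ?_⟩
    · exact fun h' => h (h'.trans ((mk_eq_mk_iff F _ _ _ _).2 ⟨c, rfl⟩))
    · rw [← HasElation.smul_comm_iff]
      exact (show (c : F) • v = w from hc).symm ▸ hel'
  have hsum : φ + ψ ≠ 0 := fun h0 => h ((mk_eq_mk_iff F _ _ _ _).2 ⟨-1, by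
    rw [eq_neg_of_add_eq_zero_left h0, Units.neg_smul, one_smul]⟩)
  obtain ⟨s, hs, hsm⟩ := hel
  obtain ⟨t, ht, htm⟩ := hel''
  have h0 := dotProduct_eq_zero_of_coe_eq hsm
  have h0' := dotProduct_eq_zero_of_coe_eq htm
  have hst : (s * t).1 = 1 + vecMulVec v (φ + ψ) := by
    rw [Matrix.SpecialLinearGroup.coe_mul, hsm, htm]
    simp [mul_add, add_mul, vecMulVec_mul_vecMulVec, h0, vecMulVec_add]
    abel
  have hts : (t * s).1 = 1 + vecMulVec v (φ + ψ) := by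
    rw [Matrix.SpecialLinearGroup.coe_mul, hsm, htm]
    simp [mul_add, add_mul, vecMulVec_mul_vecMulVec, h0', vecMulVec_add]
    abel
  have hsq : ∀ {g : SL(3, F)} {χ : Fin 3 → F}, g.1 = 1 + vecMulVec v χ → g * g = 1 := by
    intro g χ hg
    apply Subtype.ext
    rw [← sq, pow_coe_of_coe_eq hg, CharP.cast_eq_zero, zero_smul, zero_vecMulVec, add_zero,
      Matrix.SpecialLinearGroup.coe_one]
  obtain ⟨l, hl, hl'⟩ : ∃ l ∈ polar (mk F v hv), l ∉ ({mk F φ hφ, mk F ψ hψ, mk F _ hsum} :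
      Finset (Plane F)) := by
    refine exists_mem_notMem_of_card_lt_card (lt_of_le_of_lt card_le_three ?_)
    rw [card_polar]
    omega
  rw [mem_polar_comm] at hl
  simp only [mem_insert, mem_singleton, not_or] at hl'
  refine ⟨l, hl, four_dvd_card_of_involutions (s := s) (t := t)
    (Subtype.ext (hst.trans hts.symm)) (hsq hsm) (hsq htm)
    (fun x hx => (smul_mem_erase_and_ne hsm hv hφ hl hl'.1 (hX s hs) hx).1)
    (fun x hx => (smul_mem_erase_and_ne htm hv hψ hl hl'.2.1 (hX t ht) hx).1)
    (fun x hx => (smul_mem_erase_and_ne hsm hv hφ hl hl'.1 (hX s hs) hx).2)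
    (fun x hx => (smul_mem_erase_and_ne htm hv hψ hl hl'.2.1 (hX t ht) hx).2)
    (fun x hx => (smul_mem_erase_and_ne hst hv hsum hl hl'.2.2 (hX _ (K.mul_mem hs ht)) hx).2)⟩

theorem eq_top_of_forall_two_axes {K : Subgroup SL(3, F)} (hK : NoFixedPoint K)
    (hK' : NoFixedPoint (dualSubgroup K))
    (h : ∀ P, ∃ m₁ m₂, IsElationFlag K P m₁ ∧ IsElationFlag K P m₂ ∧ m₁ ≠ m₂) {P m : Plane F}
    (hPm : IsElationFlag K P m) : K = ⊤ := by
  have := Fintype.ofFinite F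
  obtain ⟨p, _⟩ := CharP.exists F
  obtain ⟨-, hp, -⟩ := FiniteField.card F p
  obtain ⟨v, φ, hv, hφ, rfl, rfl, hel⟩ := hPm
  refine eq_top_of_fullAxis hφ (fullAxis_of_transitive hφ hv hel ?_) hK hK'
  intro x y hx hy hxφ hyφ
  have hxl : mk F x hx ∈ polar (mk F φ hφ) := by rwa [mem_polar, orthogonal_mk]
  have hyl : mk F y hy ∈ polar (mk F φ hφ) := by rwa [mem_polar, orthogonal_mk]
  set l := mk F φ hφ
  set X : Finset (Plane F) := univ.filter fun z => ∃ g ∈ K, inverseTranspose g • l = l ∧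
    g • mk F x hx = z with hX
  have hmem : ∀ z, z ∈ X ↔ ∃ g ∈ K, inverseTranspose g • l = l ∧ g • mk F x hx = z := by
    intro z
    rw [hX, mem_filter]
    simp only [mem_univ, true_and]
  have hinv : ∀ g ∈ K, inverseTranspose g • l = l → ∀ z ∈ X, g • z ∈ X := by
    intro g hg hgl z hz
    obtain ⟨k, hk, hkl, rfl⟩ := (hmem _).1 hz
    exact (hmem _).2 ⟨g * k, K.mul_mem hg hk, by rw [map_mul, mul_smul, hkl, hgl], mul_smul _ _ _⟩
  have hXl : X ∩ polar l = X := by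
    refine inter_eq_left.2 fun z hz => ?_
    obtain ⟨k, hk, hkl, rfl⟩ := (hmem _).1 hz
    rw [← hkl, smul_mem_polar_iff]
    exact hxl
  have hxX : mk F x hx ∈ X := (hmem _).2 ⟨1, K.one_mem, by rw [map_one, one_smul], one_smul _ _⟩
  rw [← hmem]
  by_contra hyX
  obtain ⟨m₁, m₂, h₁, h₂, h₁₂⟩ := h (mk F x hx)
  obtain ⟨n₁, n₂, h₃, h₄, h₃₄⟩ := h (mk F y hy)
  have hdx := h₁.prime_dvd_card_of_ne h₂ h₁₂ hp hxl hinv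
  have hdy := h₃.prime_dvd_card_of_ne h₄ h₃₄ hp hyl hinv
  rw [hXl, card_erase_of_mem hxX] at hdx
  rw [hXl, erase_eq_of_notMem hyX] at hdy
  have := (Nat.dvd_sub_iff_right (card_pos.2 ⟨_, hxX⟩) hdy).1 hdx
  exact hp.one_lt.ne' (Nat.dvd_one.1 this)

theorem eq_top_of_singer_of_two_axes {K : Subgroup SL(3, F)} {a : SL(3, F)} (ha : IsSinger a)
    (haK : a ∈ K) (hq : Nat.card F ≠ 4) {P m₁ m₂ : Plane F} (h₁ : IsElationFlag K P m₁)
    (h₂ : IsElationFlag K P m₂) (h : m₁ ≠ m₂) : K = ⊤ := by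
  have := Fintype.ofFinite F
  obtain ⟨p, _⟩ := CharP.exists F
  obtain ⟨-, hp, -⟩ := FiniteField.card F p
  have hself := self_mem_pointOrbit K P
  have hinv : ∀ g ∈ K, ∀ x ∈ pointOrbit K P, g • x ∈ pointOrbit K P := fun g hg x =>
    smul_mem_pointOrbit hg
  rcases ha.eq_univ_or hq (hinv a haK) (card_mod_of_forall_dvd hself fun l hl =>
      h₁.prime_dvd_card_of_ne h₂ h hp (mem_polar_comm.1 hl) fun g hg _ => hinv g hg) with
    huniv | ⟨rfl, hq4, hmod⟩
  · refine eq_top_of_forall_two_axes (ha.noFixedPoint haK)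
      (ha.dual.noFixedPoint (inverseTranspose_mem_dualSubgroup.2 haK)) (fun x => ?_) h₁
    obtain ⟨g, hg, rfl⟩ := mem_pointOrbit.1 (huniv ▸ mem_univ x)
    exact ⟨_, _, h₁.conj hg, h₂.conj hg, fun h' => h ((smul_left_cancel_iff _).1 h')⟩
  · obtain ⟨l, hl, h4⟩ := four_dvd_card_of_two_axes hq4 h₁ h₂ h hinv
    rw [card_erase_of_mem (mem_inter.2 ⟨hself, hl⟩)] at h4
    have := hmod l
    omega

/-- A subgroup of `SL₃` containing a Singer cycle and an elation is the whole group. -/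
theorem eq_top_of_singer_of_elation {K : Subgroup SL(3, F)} {a : SL(3, F)} (ha : IsSinger a)
    (haK : a ∈ K) (hq : Nat.card F ≠ 4) {P m : Plane F} (hPm : IsElationFlag K P m) : K = ⊤ := by
  have := Fintype.ofFinite F
  obtain ⟨p, _⟩ := CharP.exists F
  obtain ⟨-, hp, -⟩ := FiniteField.card F p
  by_contra hK
  have huniq : ∀ {x y n}, IsElationFlag K x n → IsElationFlag K y n → x = y := by
    intro x y n hx hy
    by_contra hxy
    exact hK (eq_top_of_dualSubgroup_eq_top (eq_top_of_singer_of_two_axes ha.dual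
      (inverseTranspose_mem_dualSubgroup.2 haK) hq hx.dual hy.dual hxy))
  have hself := self_mem_pointOrbit K P
  have hinv : ∀ g ∈ K, ∀ x ∈ pointOrbit K P, g • x ∈ pointOrbit K P := fun g hg x =>
    smul_mem_pointOrbit hg
  have hsing : pointOrbit K P ∩ polar m = {P} := by
    refine eq_singleton_iff_unique_mem.2 ⟨mem_inter.2 ⟨hself, hPm.mem_polar⟩, fun x hx => ?_⟩
    rw [mem_inter] at hx
    obtain ⟨⟨g, hg, rfl⟩, hxm⟩ := mem_pointOrbit.1 hx.1, hx.2
    by_contra hne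
    have hflag := hPm.conj hg
    have hnm : inverseTranspose g • m ≠ m := fun h => hne (huniq (h ▸ hflag) hPm)
    obtain ⟨t, ht, -, hfix, hline⟩ := hflag.exists_elation p
    have h1 := hPm.conj ht
    rw [hline m (mem_polar.1 hxm)] at h1
    have h2 := (hfix P).1 (huniq h1 hPm)
    exact hne (eq_of_mem_polar hnm hflag.mem_polar hxm (mem_polar.2 h2) hPm.mem_polar)
  have hdvd : ∀ l ∈ polar P, p ∣ ((pointOrbit K P ∩ polar l).erase P).card := by
    intro l hl
    by_cases hlm : l = m
    · rw [hlm, hsing, erase_singleton, card_empty]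
      exact dvd_zero p
    · exact hPm.prime_dvd_card hp (mem_polar_comm.1 hl) hlm fun g hg _ => hinv g hg
  rcases ha.eq_univ_or hq (hinv a haK) (card_mod_of_forall_dvd hself hdvd) with
    huniv | ⟨rfl, -, hmod⟩
  · have := congrArg card hsing
    rw [huniv, univ_inter, card_polar, card_singleton] at this
    have := one_lt_natCard (F := F)
    omega
  · have := hmod m
    rw [hsing, card_singleton] at this
    omega

end SingerGeneration

section PrimitivePolynomials

open Polynomial

variable (F : Type*) [Field F] [Finite F]

theorem Polynomial.Monic.eq_cubic {F : Type*} [Field F] {f : F[X]} (hm : f.Monic) (hd : f.natDegree = 3)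
    (h0 : f.coeff 0 = -1) : f = X ^ 3 - C (-f.coeff 2) * X ^ 2 + C (f.coeff 1) * X - 1 := by
  have h3 : f.coeff 3 = 1 := hd ▸ hm.coeff_natDegree
  conv_lhs => rw [f.as_sum_range_C_mul_X_pow' (n := 4) (by omega)]
  simp only [Finset.sum_range_succ, Finset.sum_range_zero, h0, h3, map_neg, map_one]
  ring

theorem Polynomial.Monic.eq_quadratic {F : Type*} [Field F] {f : F[X]} (hm : f.Monic) (hd : f.natDegree = 2) :
    f = X ^ 2 - C (-f.coeff 1) * X + C (f.coeff 0) := by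
  have h2 : f.coeff 2 = 1 := hd ▸ hm.coeff_natDegree
  conv_lhs => rw [f.as_sum_range_C_mul_X_pow' (n := 3) (by omega)]
  simp only [Finset.sum_range_succ, Finset.sum_range_zero, h2, map_neg, map_one]
  ring

theorem exists_extension_generator (r : ℕ) [NeZero r] :
    ∃ (K : Type) (_ : Field K) (_ : Algebra F K) (_ : Finite K) (γ : K),
      Module.finrank F K = r ∧ Nat.card K = Nat.card F ^ r ∧
      orderOf γ = Nat.card F ^ r - 1 ∧ ∀ x : K, x ≠ 0 → ∃ j : ℕ, γ ^ j = x := by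
  obtain ⟨p, hp⟩ := CharP.exists F
  have : Fact p.Prime := ⟨CharP.char_is_prime F p⟩
  let K := FiniteField.Extension F p r
  have : Fintype K := Fintype.ofFinite K
  obtain ⟨g, hg⟩ := IsCyclic.exists_generator (α := Kˣ)
  refine ⟨K, inferInstance, inferInstance, inferInstance, (g : K),
    FiniteField.finrank_extension F p r, FiniteField.natCard_extension F p r, ?_, fun x hx => ?_⟩
  · rw [orderOf_units, orderOf_eq_card_of_forall_mem_zpowers hg, Nat.card_units,
      FiniteField.natCard_extension]
  · obtain ⟨j, hj⟩ := (mem_powers_iff_mem_zpowers (x := g)).2 (hg (Units.mk0 x hx))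
    exact ⟨j, by simpa using congrArg Units.val hj⟩

variable {F} {K : Type*} [Field K] [Algebra F K]

omit [Finite F] in
theorem minpoly_eq_charpoly_of_prime_finrank [Finite K] (hr : (Module.finrank F K).Prime) {α : K}
    (hα : ∀ a, algebraMap F K a ≠ α) :
    minpoly F α = (Algebra.lmul F K α).charpoly := by
  have hInt : IsIntegral F α := Algebra.IsIntegral.isIntegral α
  have hdeg : (minpoly F α).natDegree = Module.finrank F K := by
    refine ((Nat.dvd_prime hr).1 (minpoly.degree_dvd hInt)).resolve_left fun h => ?_
    obtain ⟨a, ha⟩ := (minpoly.natDegree_eq_one_iff).1 h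
    exact hα a ha
  refine (eq_of_monic_of_dvd_of_natDegree_le (minpoly.monic hInt) (LinearMap.charpoly_monic _)
    (minpoly.dvd F α ?_) (by rw [LinearMap.charpoly_natDegree, hdeg])).symm
  have h := LinearMap.aeval_self_charpoly (Algebra.lmul F K α)
  rw [aeval_algHom_apply] at h
  simpa using congrArg (fun f => f 1) h

omit [Finite F] in
theorem minpoly_dvd_X_pow_sub_C_iff {α : K} {s : ℕ} {c : F} :
    minpoly F α ∣ X ^ s - C c ↔ α ^ s = algebraMap F K c := by
  rw [minpoly.dvd_iff]
  simp [sub_eq_zero]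

theorem pow_mul_card_sub_one_eq_one {γ : K} (h0 : γ ≠ 0) {j : ℕ} {a : F}
    (ha : algebraMap F K a = γ ^ j) : γ ^ (j * (Nat.card F - 1)) = 1 := by
  have := Fintype.ofFinite F
  have ha0 : a ≠ 0 := by
    rintro rfl
    exact pow_ne_zero j h0 (by rw [← ha, map_zero])
  rw [pow_mul, ← ha, ← map_pow, Nat.card_eq_fintype_card,
    FiniteField.pow_card_sub_one_eq_one a ha0, map_one]

omit [Algebra F K] [Finite F] in
theorem ne_zero_of_orderOf_pos {γ : K} (h : 0 < orderOf γ) : γ ≠ 0 := by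
  rintro rfl
  have := pow_orderOf_eq_one (0 : K)
  rw [zero_pow h.ne'] at this
  exact zero_ne_one this

theorem ne_algebraMap_of_generator_pow {γ : K} {j : ℕ} (hj : 0 < j * (Nat.card F - 1))
    (hjγ : j * (Nat.card F - 1) < orderOf γ) (a : F) : algebraMap F K a ≠ γ ^ j := by
  intro ha
  have := Nat.le_of_dvd hj (orderOf_dvd_of_pow_eq_one
    (pow_mul_card_sub_one_eq_one (ne_zero_of_orderOf_pos (by omega)) ha))
  omega

variable (F)

theorem Nat.sub_one_dvd_sq_sub_one (q : ℕ) : q - 1 ∣ q ^ 2 - 1 := by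
  simpa using Nat.sub_dvd_pow_sub_pow q 1 2

theorem Nat.gcd_sq_sub_one_add_two {q : ℕ} (hq : 1 < q) :
    Nat.gcd (q ^ 2 - 1) (q + 2) = Nat.gcd 3 (q - 1) := by
  obtain ⟨m, rfl⟩ : ∃ m, q = m + 2 := ⟨q - 2, by omega⟩
  have h1 : (m + 2) ^ 2 - 1 = m * (m + 2 + 2) + 3 := by
    rw [Nat.sub_eq_iff_eq_add (Nat.one_le_pow _ _ (by omega))]; ring
  rw [h1, Nat.gcd_comm, Nat.gcd_mul_right_add_right, show m + 2 + 2 = (m + 2 - 1) + 3 by omega,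
    Nat.gcd_comm, Nat.gcd_add_self_right]

theorem Nat.dvd_mul_iff_div_gcd_dvd {a b s : ℕ} (ha : 0 < a) :
    a ∣ b * s ↔ a / Nat.gcd a b ∣ s := by
  have hg := Nat.gcd_pos_of_pos_left b ha
  have hc := Nat.coprime_div_gcd_div_gcd hg
  conv_rhs =>
    rw [← hc.dvd_mul_left, ← Nat.mul_dvd_mul_iff_left hg, ← mul_assoc,
      Nat.mul_div_cancel' (Nat.gcd_dvd_left a b), Nat.mul_div_cancel' (Nat.gcd_dvd_right a b)]

theorem exists_singer_polynomial :
    ∃ a b : F, Irreducible (X ^ 3 - C a * X ^ 2 + C b * X - 1 : F[X]) ∧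
      ∀ (s : ℕ) (c : F), (X ^ 3 - C a * X ^ 2 + C b * X - 1 : F[X]) ∣ X ^ s - C c →
        singerOrder F ∣ s := by
  obtain ⟨K, _, _, _, γ, hfin, hcard, hγ, -⟩ := exists_extension_generator F 3
  have hq : 1 < Nat.card F := one_lt_natCard
  have hgeom : Nat.card F ^ 3 - 1 =
      (Nat.card F - 1) * (Nat.card F ^ 2 + Nat.card F + 1) := by
    obtain ⟨m, hm⟩ : ∃ m, Nat.card F = m + 1 := ⟨Nat.card F - 1, by omega⟩
    rw [hm, Nat.add_sub_cancel, Nat.sub_eq_iff_eq_add (Nat.one_le_pow _ _ (by omega))]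
    ring
  have hα := ne_algebraMap_of_generator_pow (F := F) (γ := γ) (j := Nat.card F - 1)
    (Nat.mul_pos (by omega) (by omega))
    (by rw [hγ, hgeom]; exact Nat.mul_lt_mul_of_pos_left (by nlinarith [Nat.sub_le (Nat.card F) 1]) (by omega))
  have hmin := minpoly_eq_charpoly_of_prime_finrank (by rw [hfin]; norm_num) hα
  have hInt : IsIntegral F (γ ^ (Nat.card F - 1)) := Algebra.IsIntegral.isIntegral _
  have hnorm : Algebra.norm F (γ ^ (Nat.card F - 1)) = 1 := by
    apply (algebraMap F K).injective
    rw [FiniteField.algebraMap_norm_eq_pow, hcard, hgeom, Nat.mul_div_cancel_left _ (by omega),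
      ← pow_mul, ← hgeom, ← hγ, pow_orderOf_eq_one, map_one]
  have hdeg : (minpoly F (γ ^ (Nat.card F - 1))).natDegree = 3 := by
    rw [hmin, LinearMap.charpoly_natDegree, hfin]
  have hc0 : (minpoly F (γ ^ (Nat.card F - 1))).coeff 0 = -1 := by
    have := LinearMap.det_eq_sign_charpoly_coeff (Algebra.lmul F K (γ ^ (Nat.card F - 1)))
    rw [← Algebra.norm_apply, hnorm, hfin, ← hmin] at this
    linear_combination this
  have heq : minpoly F (γ ^ (Nat.card F - 1)) =
      X ^ 3 - C (-(minpoly F (γ ^ (Nat.card F - 1))).coeff 2) * X ^ 2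
        + C ((minpoly F (γ ^ (Nat.card F - 1))).coeff 1) * X - 1 :=
    (minpoly.monic hInt).eq_cubic hdeg hc0
  refine ⟨_, _, heq ▸ minpoly.irreducible hInt, fun s c h => ?_⟩
  rw [← heq, minpoly_dvd_X_pow_sub_C_iff] at h
  rw [← pow_mul] at h
  have h0 : γ ≠ 0 := ne_zero_of_orderOf_pos (by rw [hγ, hgeom]; exact Nat.mul_pos (by omega) (by omega))
  have h1 := orderOf_dvd_of_pow_eq_one (pow_mul_card_sub_one_eq_one h0 h.symm)
  rw [hγ, hgeom, mul_assoc] at h1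
  have h2 := Nat.dvd_of_mul_dvd_mul_left (by omega) h1
  have h3 : singerOrder F ∣ Nat.card F ^ 2 + Nat.card F + 1 :=
    Dvd.intro _ (singerOrder_mul F)
  have h4 : Nat.Coprime (singerOrder F) (Nat.card F - 1) :=
    Nat.Coprime.coprime_dvd_right (Nat.sub_one_dvd_sq_sub_one _) singerOrder_coprime_sq_sub_one
  exact h4.dvd_of_dvd_mul_right (h3.trans h2)

variable {F} in
/-- `X ^ 2 - t X + ν` is the minimal polynomial of a generator of the multiplicative group of the
quadratic extension of `F`, expressed through the properties used below. -/
structure IsPrimitiveQuadratic (t ν : F) : Prop where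
  orderOf_eq : orderOf ν = Nat.card F - 1
  irreducible : Irreducible (X ^ 2 - C t * X + C ν : F[X])
  dvd_X_pow_sub_C : (X ^ 2 - C t * X + C ν : F[X]) ∣ X ^ (Nat.card F + 1) - C ν
  exists_dvd_sub_X_pow : ∀ r : F[X], ¬ (X ^ 2 - C t * X + C ν : F[X]) ∣ r →
    ∃ j : ℕ, (X ^ 2 - C t * X + C ν : F[X]) ∣ r - X ^ j
  dvd_iff : ∀ s : ℕ, (X ^ 2 - C t * X + C ν : F[X]) ∣ X ^ s - C (ν⁻¹ ^ s) ↔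
    (Nat.card F ^ 2 - 1) / Nat.gcd 3 (Nat.card F - 1) ∣ s

theorem exists_isPrimitiveQuadratic : ∃ t ν : F, IsPrimitiveQuadratic t ν := by
  obtain ⟨K, _, _, _, β, hfin, hcard, hβ, hgen⟩ := exists_extension_generator F 2
  have hq1 : 1 < Nat.card F := one_lt_natCard
  have hgeom : Nat.card F ^ 2 - 1 = (Nat.card F - 1) * (Nat.card F + 1) := by
    obtain ⟨m, hm⟩ : ∃ m, Nat.card F = m + 1 := ⟨Nat.card F - 1, by omega⟩
    rw [hm, Nat.add_sub_cancel, Nat.sub_eq_iff_eq_add (Nat.one_le_pow _ _ (by omega))]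
    ring
  have hα := ne_algebraMap_of_generator_pow (F := F) (γ := β) (j := 1)
    (by omega) (by rw [hβ, hgeom]; nlinarith [Nat.sub_pos_of_lt hq1])
  rw [pow_one] at hα
  have hmin := minpoly_eq_charpoly_of_prime_finrank (by rw [hfin]; norm_num) hα
  have hInt : IsIntegral F β := Algebra.IsIntegral.isIntegral _
  have hnorm : algebraMap F K (Algebra.norm F β) = β ^ (Nat.card F + 1) := by
    rw [FiniteField.algebraMap_norm_eq_pow, hcard, hgeom, Nat.mul_div_cancel_left _ (by omega)]
  have hdeg : (minpoly F β).natDegree = 2 := by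
    rw [hmin, LinearMap.charpoly_natDegree, hfin]
  have hc0 : (minpoly F β).coeff 0 = Algebra.norm F β := by
    have := LinearMap.det_eq_sign_charpoly_coeff (Algebra.lmul F K β)
    rw [← Algebra.norm_apply, hfin, ← hmin] at this
    linear_combination -this
  have heq : minpoly F β =
      X ^ 2 - C (-(minpoly F β).coeff 1) * X + C (Algebra.norm F β) :=
    hc0 ▸ (minpoly.monic hInt).eq_quadratic hdeg
  refine ⟨_, _, ?_, heq ▸ minpoly.irreducible hInt, ?_, fun r hr => ?_, fun s => ?_⟩
  · rw [← orderOf_injective (algebraMap F K : F →* K) (algebraMap F K).injective, MonoidHom.coe_coe, hnorm, orderOf_pow' _ (by omega), hβ, hgeom,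
      Nat.gcd_mul_left_left, Nat.mul_div_cancel _ (by omega)]
  · rw [← heq, minpoly_dvd_X_pow_sub_C_iff, hnorm]
  · rw [← heq, minpoly.dvd_iff] at hr
    obtain ⟨j, hj⟩ := hgen _ hr
    refine ⟨j, ?_⟩
    rw [← heq, minpoly.dvd_iff]
    simp [hj]
  · rw [← heq, minpoly_dvd_X_pow_sub_C_iff]
    have h0 : β ≠ 0 := ne_zero_of_orderOf_pos
      (by rw [hβ, hgeom]; exact Nat.mul_pos (by omega) (by omega))
    have h1 : β ^ s = algebraMap F K ((Algebra.norm F β)⁻¹ ^ s) ↔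
        β ^ ((Nat.card F + 2) * s) = 1 := by
      rw [map_pow, map_inv₀, hnorm, inv_pow, eq_comm, inv_eq_iff_eq_inv, eq_comm, inv_eq_iff_eq_inv, ← mul_eq_one_iff_eq_inv₀ (pow_ne_zero _ (pow_ne_zero _ h0)), ← pow_mul,
        ← pow_add]
      ring_nf
    rw [h1, ← orderOf_dvd_iff_pow_eq_one, hβ]
    rw [Nat.dvd_mul_iff_div_gcd_dvd (by rw [hgeom]; exact Nat.mul_pos (by omega) (by omega)),
      Nat.gcd_sq_sub_one_add_two hq1]

end PrimitivePolynomials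

section SingerTriple

open Matrix Projectivization Polynomial
open scoped LinearAlgebra.Projectivization

variable {F : Type*} [Field F]

theorem dvd_of_aeval_mulVec_eq_zero {ι : Type*} [Fintype ι] [DecidableEq ι] {M : Matrix ι ι F}
    {v : ι → F} (hv : v ≠ 0) {p r : F[X]} (hp : Irreducible p) (h1 : aeval M p *ᵥ v = 0)
    (h2 : aeval M r *ᵥ v = 0) : p ∣ r := by
  by_contra h
  obtain ⟨a, b, hab⟩ := (hp.coprime_iff_not_dvd).2 h
  apply hv
  have := congrArg (fun t => aeval M t *ᵥ v) hab
  simpa [Matrix.add_mulVec, ← Matrix.mulVec_mulVec, h1, h2] using this.symm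

theorem aeval_X_pow_sub_C (M : Matrix (Fin 3) (Fin 3) F) (s : ℕ) (c : F) :
    aeval M (X ^ s - C c) = M ^ s - scalar (Fin 3) c := by
  rw [map_sub, map_pow, aeval_X, aeval_C]
  rfl

theorem scalar_mulVec (c : F) (v : Fin 3 → F) : scalar (Fin 3) c *ᵥ v = c • v := by
  ext i
  simp [mulVec_diagonal]

theorem aeval_transpose (M : Matrix (Fin 3) (Fin 3) F) (f : F[X]) :
    aeval Mᵀ f = (aeval M f)ᵀ := by
  simp only [aeval_eq_sum_range, transpose_sum, transpose_smul, transpose_pow]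

theorem coe_inv_inverseTranspose (g : SL(3, F)) :
    ((inverseTranspose g)⁻¹ : SL(3, F)).1 = g.1ᵀ := by
  rw [← map_inv]
  change ((g⁻¹)⁻¹ : SL(3, F)).1ᵀ = g.1ᵀ
  rw [inv_inv]

theorem orderOf_mk_eq {g : SL(3, F)} {n : ℕ}
    (h : ∀ s, (∃ c, (g : Matrix (Fin 3) (Fin 3) F) ^ s = scalar (Fin 3) c) ↔ n ∣ s) :
    orderOf (QuotientGroup.mk g : PSL(3, F)) = n :=
  Nat.dvd_antisymm
    (orderOf_dvd_of_pow_eq_one ((mk_pow_eq_one_iff _).2 ((h n).2 dvd_rfl)))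
    ((h _).1 ((mk_pow_eq_one_iff _).1 (pow_orderOf_eq_one _)))

variable [Finite F]

/-- An irreducible cubic with constant term `-1` whose roots have maximal order modulo scalars. -/
structure IsSingerPolynomial (f : F[X]) : Prop where
  monic : f.Monic
  irreducible : Irreducible f
  natDegree : f.natDegree = 3
  coeff_zero : f.coeff 0 = -1
  dvd_of_dvd : ∀ (s : ℕ) (c : F), f ∣ X ^ s - C c → singerOrder F ∣ s

theorem IsSingerPolynomial.dvd_iff {f : F[X]} (hf : IsSingerPolynomial f) (s : ℕ) :
    (∃ c, f ∣ X ^ s - C c) ↔ singerOrder F ∣ s := by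
  refine ⟨fun ⟨c, h⟩ => hf.dvd_of_dvd s c h, ?_⟩
  rintro ⟨t, rfl⟩
  obtain ⟨c, hc⟩ := dvd_X_pow_singerOrder_sub_C hf.monic hf.irreducible hf.natDegree hf.coeff_zero
  refine ⟨c ^ t, hc.trans ?_⟩
  rw [pow_mul, map_pow]
  exact sub_dvd_pow_sub_pow _ _ t

theorem IsSingerPolynomial.exists_pow_eq_scalar {f : F[X]} (hf : IsSingerPolynomial f)
    {M : Matrix (Fin 3) (Fin 3) F} (hM : aeval M f = 0) {s : ℕ} (hs : singerOrder F ∣ s) :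
    ∃ c, M ^ s = scalar (Fin 3) c := by
  obtain ⟨c, r, hr⟩ := (hf.dvd_iff s).2 hs
  refine ⟨c, ?_⟩
  have := congrArg (aeval M) hr
  rw [map_mul, hM, zero_mul] at this
  rwa [aeval_X_pow_sub_C, sub_eq_zero] at this

theorem IsSingerPolynomial.smul_eq_iff {f : F[X]} (hf : IsSingerPolynomial f)
    {g : SL(3, F)} (hg : aeval (g : Matrix (Fin 3) (Fin 3) F) f = 0) (x : Plane F) (s : ℕ) :
    g ^ s • x = x ↔ singerOrder F ∣ s := by
  induction x using Projectivization.ind with | h v hv => ?_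
  rw [mk_smul_eq_mk_iff]
  constructor
  · rintro ⟨c, hc, h⟩
    refine hf.dvd_of_dvd s c (dvd_of_aeval_mulVec_eq_zero (M := g.1) hv hf.irreducible
      (by rw [hg, zero_mulVec]) ?_)
    rw [SL_smul_eq, Matrix.SpecialLinearGroup.coe_pow] at h
    rw [aeval_X_pow_sub_C, Matrix.sub_mulVec, h, scalar_mulVec, sub_self]
  · intro h
    obtain ⟨c, hc⟩ := hf.exists_pow_eq_scalar hg h
    refine ⟨c, ?_, ?_⟩
    · rintro rfl
      have := congrArg Matrix.det hc
      rw [Matrix.det_pow, g.2] at this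
      simp at this
    · rw [SL_smul_eq, Matrix.SpecialLinearGroup.coe_pow, hc, scalar_mulVec]

theorem IsSingerPolynomial.isSinger {f : F[X]} (hf : IsSingerPolynomial f)
    {g : SL(3, F)} (hg : aeval (g : Matrix (Fin 3) (Fin 3) F) f = 0) : IsSinger g where
  point := hf.smul_eq_iff hg
  line x s := by
    have h : aeval ((inverseTranspose g)⁻¹ : SL(3, F)).1 f = 0 := by
      rw [coe_inv_inverseTranspose, aeval_transpose, hg, transpose_zero]
    rw [← hf.smul_eq_iff h x s, inv_pow, inv_smul_eq_iff, eq_comm]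

theorem IsSingerPolynomial.orderOf_mk {f : F[X]} (hf : IsSingerPolynomial f)
    {g : SL(3, F)} (hg : aeval (g : Matrix (Fin 3) (Fin 3) F) f = 0) :
    orderOf (QuotientGroup.mk g : PSL(3, F)) = singerOrder F := by
  refine orderOf_mk_eq fun s => ⟨?_, hf.exists_pow_eq_scalar hg⟩
  rintro ⟨c, hc⟩
  refine hf.dvd_of_dvd s c (dvd_of_aeval_mulVec_eq_zero (M := g.1) (v := Pi.single 0 1)
    (by simp) hf.irreducible (by rw [hg, zero_mulVec]) ?_)
  rw [aeval_X_pow_sub_C, hc, sub_self, zero_mulVec]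

theorem exists_isSingerPolynomial (F : Type*) [Field F] [Finite F] :
    ∃ a b : F, IsSingerPolynomial (X ^ 3 - C a * X ^ 2 + C b * X - 1) := by
  obtain ⟨a, b, h1, h2⟩ := exists_singer_polynomial F
  refine ⟨a, b, ?_, h1, ?_, ?_, h2⟩
  · monicity!
  · compute_degree!
  · simp

/-- The companion matrix of `X ^ 3 - a X ^ 2 + b X - 1`. -/
def cubicCompanion (a b : F) : SL(3, F) :=
  ⟨!![0, 0, 1; 1, 0, -b; 0, 1, a], by simp [det_fin_three]⟩

/-- The upper unitriangular matrix with entries `s`, `r`, `w` above the diagonal. -/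
def unitriangular (s r w : F) : SL(3, F) :=
  ⟨!![1, s, r; 0, 1, w; 0, 0, 1], by simp [det_fin_three]⟩

omit [Finite F] in
theorem aeval_cubic_eq_zero (M : Matrix (Fin 3) (Fin 3) F) (hM : M.det = 1) {a b : F}
    (ha : a = M 0 0 + M 1 1 + M 2 2)
    (hb : b = M 0 0 * M 1 1 - M 0 1 * M 1 0 + (M 0 0 * M 2 2 - M 0 2 * M 2 0)
      + (M 1 1 * M 2 2 - M 1 2 * M 2 1)) :
    aeval M (X ^ 3 - C a * X ^ 2 + C b * X - 1) = 0 := by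
  rw [det_fin_three] at hM
  simp only [map_sub, map_add, map_mul, map_pow, aeval_X, aeval_C, map_one,
    Algebra.algebraMap_eq_smul_one, smul_mul_assoc, one_mul]
  subst ha hb
  ext i j
  simp only [pow_succ, pow_zero, one_mul, Matrix.add_apply, Matrix.sub_apply, Matrix.smul_apply,
    Matrix.mul_apply, Fin.sum_univ_three, Matrix.zero_apply, smul_eq_mul]
  fin_cases i <;> fin_cases j <;> simp
  · linear_combination hM
  · ring
  · ring
  · ring
  · linear_combination hM
  · ring
  · ring
  · ring
  · linear_combination hM

omit [Finite F] in
theorem cubicCompanion_mul_unitriangular (a b s r w : F) :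
    (cubicCompanion a b * unitriangular s r w).1 = !![0, 0, 1; 1, s, r - b; 0, 1, w + a] := by
  change (cubicCompanion a b).1 * (unitriangular s r w).1 = _
  ext i j
  fin_cases i <;> fin_cases j <;> simp [cubicCompanion, unitriangular, sub_eq_add_neg]

omit [Finite F] in
theorem aeval_cubicCompanion (a b : F) :
    aeval (cubicCompanion a b).1 (X ^ 3 - C a * X ^ 2 + C b * X - 1) = 0 := by
  refine aeval_cubic_eq_zero _ (Matrix.SpecialLinearGroup.det_coe _) ?_ ?_ <;>
  simp [cubicCompanion]

omit [Finite F] in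
theorem aeval_inv_cubicCompanion_mul (a b : F) :
    aeval ((cubicCompanion a b * unitriangular 0 (b - a) (b - a))⁻¹ : SL(3, F)).1
      (X ^ 3 - C a * X ^ 2 + C b * X - 1) = 0 := by
  refine aeval_cubic_eq_zero _ (Matrix.SpecialLinearGroup.det_coe _) ?_ ?_ <;>
  rw [Matrix.SpecialLinearGroup.coe_inv, cubicCompanion_mul_unitriangular, adjugate_fin_three] <;>
  simp

omit [Finite F] in
theorem aeval_cubicCompanion_mul_of_two [CharP F 2] (a b : F) :
    aeval (cubicCompanion a b * unitriangular 1 (1 + a) 1 : SL(3, F)).1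
      (X ^ 3 - C a * X ^ 2 + C b * X - 1) = 0 := by
  refine aeval_cubic_eq_zero _ (Matrix.SpecialLinearGroup.det_coe _) ?_ ?_ <;>
  rw [cubicCompanion_mul_unitriangular] <;> simp
  rw [← add_assoc, CharTwo.add_self_eq_zero, zero_add]

omit [Finite F] in
theorem unitriangular_eq (r : F) :
    (unitriangular 0 r r).1 = 1 + vecMulVec ![r, r, 0] ![0, 0, 1] := by
  ext i j
  fin_cases i <;> fin_cases j <;> simp [unitriangular]

omit [Finite F] in
theorem unitriangular_sq_eq [CharP F 2] (s r w : F) :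
    (unitriangular s r w ^ 2).1 = 1 + vecMulVec ![s * w, 0, 0] ![0, 0, 1] := by
  rw [Matrix.SpecialLinearGroup.coe_pow, pow_two]
  ext i j
  fin_cases i <;> fin_cases j <;> simp [unitriangular]
  · exact CharTwo.add_self_eq_zero s
  · rw [add_left_comm, CharTwo.add_self_eq_zero, add_zero]
  · exact CharTwo.add_self_eq_zero w

omit [Finite F] in
theorem mk_ne_one_of_coe_eq {g : SL(3, F)} {v φ : Fin 3 → F} (hv : v ≠ 0) (hφ : φ ≠ 0)
    (hg : g.1 = 1 + vecMulVec v φ) : (QuotientGroup.mk g : PSL(3, F)) ≠ 1 := by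
  intro h
  obtain ⟨c, hc⟩ := (mk_pow_eq_one_iff 1).1 ((pow_one _).trans h)
  rw [pow_one, hg] at hc
  have h1 := congrArg (· *ᵥ v) hc
  simp only [add_mulVec, one_mulVec, scalar_mulVec, vecMulVec_mulVec,
    dotProduct_eq_zero_of_coe_eq hg] at h1
  obtain rfl : c = 1 := by
    have : (c - 1) • v = 0 := by rw [sub_smul, ← h1]; simp
    exact sub_eq_zero.1 ((smul_eq_zero.1 this).resolve_right hv)
  rw [map_one, add_eq_left, vecMulVec_eq_zero] at hc
  exact hc.elim hv hφ

omit [Finite F] in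
theorem mk_pow_char_eq_one {p : ℕ} [CharP F p] {g : SL(3, F)} {v φ : Fin 3 → F}
    (hg : g.1 = 1 + vecMulVec v φ) : (QuotientGroup.mk g : PSL(3, F)) ^ p = 1 := by
  rw [← QuotientGroup.mk_pow, QuotientGroup.eq_one_iff]
  convert Subgroup.one_mem _
  apply Subtype.ext
  rw [pow_coe_of_coe_eq hg, CharP.cast_eq_zero, zero_smul, zero_vecMulVec, add_zero,
    Matrix.SpecialLinearGroup.coe_one]

omit [Finite F] in
theorem isElationFlag_of_mem {K : Subgroup SL(3, F)} {g : SL(3, F)} (hgK : g ∈ K)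
    {v φ : Fin 3 → F} (hv : v ≠ 0) (hφ : φ ≠ 0) (hg : g.1 = 1 + vecMulVec v φ) :
    IsElationFlag K (mk F v hv) (mk F φ hφ) :=
  ⟨v, φ, hv, hφ, rfl, rfl, g, hgK, hg⟩

theorem exists_singer_triple (hq : Nat.card F ≠ 4) (p : ℕ) [Fact p.Prime] [CharP F p] :
    ∃ x u : SL(3, F), orderOf (QuotientGroup.mk x : PSL(3, F)) = singerOrder F ∧
      orderOf (QuotientGroup.mk u : PSL(3, F)) = (if p = 2 then 4 else p) ∧
      orderOf (QuotientGroup.mk (x * u) : PSL(3, F)) = singerOrder F ∧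
      Subgroup.closure {x, u} = ⊤ := by
  obtain ⟨a, b, hf⟩ := exists_isSingerPolynomial F
  have hx := aeval_cubicCompanion a b
  have hgen : ∀ u : SL(3, F), ∀ P m, IsElationFlag (Subgroup.closure {cubicCompanion a b, u}) P m →
      Subgroup.closure {cubicCompanion a b, u} = ⊤ := fun u P m h =>
    eq_top_of_singer_of_elation (hf.isSinger hx) (Subgroup.subset_closure (by simp)) hq h
  have he : (![0, 0, 1] : Fin 3 → F) ≠ 0 := fun h => one_ne_zero (congrFun h 2)
  have hmem : ∀ u : SL(3, F), u ∈ Subgroup.closure {cubicCompanion a b, u} := fun u =>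
    Subgroup.subset_closure (by simp)
  by_cases h2 : p = 2
  · subst h2
    have hv : (![1 * 1, 0, 0] : Fin 3 → F) ≠ 0 := fun h => one_ne_zero (α := F) (by simpa using congrFun h 0)
    have hu := unitriangular_sq_eq (1 : F) (1 + a) 1
    refine ⟨cubicCompanion a b, unitriangular 1 (1 + a) 1, hf.orderOf_mk hx, ?_,
      hf.orderOf_mk (aeval_cubicCompanion_mul_of_two a b), hgen _ _ _
      (isElationFlag_of_mem (Subgroup.pow_mem _ (hmem _) 2) hv he hu)⟩
    rw [if_pos rfl]
    refine orderOf_eq_prime_pow (p := 2) (n := 1) ?_ ?_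
    · rw [pow_one, ← QuotientGroup.mk_pow]
      exact mk_ne_one_of_coe_eq hv he hu
    · have := mk_pow_char_eq_one (p := 2) hu
      rwa [QuotientGroup.mk_pow, ← pow_mul] at this
  · have hr : b - a ≠ 0 := by
      intro hr
      have hroot : (X ^ 3 - C a * X ^ 2 + C b * X - 1 : F[X]).IsRoot 1 := by
        simp [← sub_eq_zero.1 hr]
      have := degree_eq_one_of_irreducible_of_root hf.irreducible hroot
      rw [degree_eq_natDegree hf.monic.ne_zero, hf.natDegree] at this
      norm_num at this
    have hv : (![b - a, b - a, 0] : Fin 3 → F) ≠ 0 := fun h => hr (congrFun h 0)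
    have hu := unitriangular_eq (b - a)
    refine ⟨cubicCompanion a b, unitriangular 0 (b - a) (b - a), hf.orderOf_mk hx, ?_, ?_,
      hgen _ _ _ (isElationFlag_of_mem (hmem _) hv he hu)⟩
    · rw [if_neg h2]
      exact orderOf_eq_prime (mk_pow_char_eq_one hu) (mk_ne_one_of_coe_eq hv he hu)
    · rw [← hf.orderOf_mk (aeval_inv_cubicCompanion_mul a b), QuotientGroup.mk_inv, orderOf_inv]

end SingerTriple

section TorusPair

open Matrix Projectivization Polynomial
open scoped LinearAlgebra.Projectivization

variable {F : Type*} [Field F]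

/-- The block diagonal matrix with blocks the companion matrix of `X ^ 2 - t X + ν` and `ν⁻¹`. -/
def blockCompanion (t : F) {ν : F} (hν : ν ≠ 0) : SL(3, F) :=
  ⟨!![0, -ν, 0; 1, t, 0; 0, 0, ν⁻¹], by simp [det_fin_three, hν]⟩

/-- A one-parameter family of base changes moving the eigenvector of `blockCompanion`. -/
def blockTwist (s : F) : SL(3, F) :=
  ⟨!![0, 0, 1; s, 1, -s; -1, 0, 1], by simp [det_fin_three]⟩

theorem coe_inv_blockTwist (s : F) :
    ((blockTwist s)⁻¹ : SL(3, F)).1 = !![1, 0, -1; 0, 1, s; 1, 0, 0] := by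
  rw [Matrix.SpecialLinearGroup.coe_inv]
  change adjugate !![0, 0, 1; s, 1, -s; -1, 0, 1] = _
  rw [adjugate_fin_three]
  ext i j
  fin_cases i <;> fin_cases j <;> simp

theorem coe_inv_blockCompanion (t : F) {ν : F} (hν : ν ≠ 0) :
    ((blockCompanion t hν)⁻¹ : SL(3, F)).1 = !![t * ν⁻¹, 1, 0; -ν⁻¹, 0, 0; 0, 0, ν] := by
  rw [Matrix.SpecialLinearGroup.coe_inv]
  change adjugate !![0, -ν, 0; 1, t, 0; 0, 0, ν⁻¹] = _
  rw [adjugate_fin_three]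
  ext i j
  fin_cases i <;> fin_cases j <;> simp [hν]

theorem blockCompanion_pow_eq {t ν : F} (hν : ν ≠ 0) {s : ℕ} {d : F}
    (h : (X ^ 2 - C t * X + C ν : F[X]) ∣ X ^ s - C d) :
    (blockCompanion t hν).1 ^ s =
      scalar (Fin 3) d + vecMulVec ((ν⁻¹ ^ s - d) • ![0, 0, 1]) ![0, 0, 1] := by
  have h3 : (blockCompanion t hν).1 ^ s *ᵥ ![0, 0, 1] = ν⁻¹ ^ s • ![0, 0, 1] := by
    clear h
    induction s with
    | zero => simp
    | succ s ih =>
      have h0 : (blockCompanion t hν).1 *ᵥ ![0, 0, 1] = ν⁻¹ • ![0, 0, 1] := by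
        ext i
        fin_cases i <;> simp [blockCompanion]
      rw [pow_succ, ← mulVec_mulVec, h0, mulVec_smul, ih, smul_smul, pow_succ']
  obtain ⟨r, hr⟩ := h
  have h2 : aeval (blockCompanion t hν).1 (X ^ 2 - C t * X + C ν) =
      vecMulVec ((ν⁻¹ ^ 2 - t * ν⁻¹ + ν) • ![0, 0, 1]) ![0, 0, 1] := by
    simp only [map_sub, map_add, map_mul, map_pow, aeval_X, aeval_C,
      Algebra.algebraMap_eq_smul_one, smul_mul_assoc, one_mul]
    ext i j
    fin_cases i <;> fin_cases j <;>
      simp [blockCompanion, pow_two]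
    all_goals ring
  have h1 := congrArg (aeval (blockCompanion t hν).1) hr
  rw [mul_comm, map_mul, aeval_X_pow_sub_C, h2, mul_vecMulVec] at h1
  obtain ⟨w, hw⟩ : ∃ w : Fin 3 → F, (blockCompanion t hν).1 ^ s - scalar (Fin 3) d =
    vecMulVec w ![0, 0, 1] := ⟨_, h1⟩
  have h4 := congrArg (· *ᵥ ![0, 0, 1]) hw
  have h5 : ![0, 0, 1] ⬝ᵥ ![0, 0, (1 : F)] = 1 := by simp
  simp only [sub_mulVec, h3, scalar_mulVec, vecMulVec_mulVec, h5, MulOpposite.op_one, one_smul]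
    at h4
  rw [sub_smul, h4, ← hw, add_sub_cancel]

theorem Irreducible.quadratic_ne_zero {t ν : F}
    (hirr : Irreducible (X ^ 2 - C t * X + C ν : F[X])) (c : F) : c ^ 2 - t * c + ν ≠ 0 := by
  intro h
  have hroot : (X ^ 2 - C t * X + C ν : F[X]).IsRoot c := by simpa using h
  have h1 := degree_eq_one_of_irreducible_of_root hirr hroot
  have h2 : (X ^ 2 - C t * X + C ν : F[X]).degree = 2 := by compute_degree!
  rw [h2] at h1
  norm_num at h1

theorem mk_eq_mk_of_eq_zero {v : Fin 3 → F} (h0 : v 0 = 0) (h1 : v 1 = 0) (hv : v ≠ 0)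
    (he : (![0, 0, 1] : Fin 3 → F) ≠ 0) : mk F v hv = mk F ![0, 0, 1] he := by
  rw [mk_eq_mk_iff']
  refine ⟨v 2, ?_⟩
  ext i
  fin_cases i <;> simp [h0, h1]

theorem eq_mk_of_blockCompanion_smul_eq {t ν : F} (hν : ν ≠ 0)
    (hirr : Irreducible (X ^ 2 - C t * X + C ν : F[X])) (he : (![0, 0, 1] : Fin 3 → F) ≠ 0)
    {x : Plane F} (hx : blockCompanion t hν • x = x) : x = mk F ![0, 0, 1] he := by
  induction x using Projectivization.ind with | h v hv => ?_
  obtain ⟨c, hc, h⟩ := (mk_smul_eq_mk_iff hv hv).1 hx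
  rw [SL_smul_eq] at h
  have h0 := congrFun h 0
  have h1 := congrFun h 1
  simp [blockCompanion, mulVec, dotProduct, Fin.sum_univ_three] at h0 h1
  have hv1 : v 1 = 0 := (mul_eq_zero.1 (show (c ^ 2 - t * c + ν) * v 1 = 0 by
    linear_combination -h0 - c * h1)).resolve_left (hirr.quadratic_ne_zero c)
  have hv0 : v 0 = 0 := by simpa [hv1] using h1
  exact mk_eq_mk_of_eq_zero hv0 hv1 _ _

theorem eq_mk_of_inverseTranspose_blockCompanion_smul_eq {t ν : F} (hν : ν ≠ 0)
    (hirr : Irreducible (X ^ 2 - C t * X + C ν : F[X])) (he : (![0, 0, 1] : Fin 3 → F) ≠ 0)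
    {x : Plane F} (hx : inverseTranspose (blockCompanion t hν) • x = x) :
    x = mk F ![0, 0, 1] he := by
  induction x using Projectivization.ind with | h v hv => ?_
  rw [eq_comm, ← inv_smul_eq_iff] at hx
  obtain ⟨c, hc, h⟩ := (mk_smul_eq_mk_iff hv hv).1 hx
  rw [SL_smul_eq, coe_inv_inverseTranspose] at h
  have h0 := congrFun h 0
  have h1 := congrFun h 1
  simp [blockCompanion, mulVec, dotProduct, Fin.sum_univ_three] at h0 h1
  have hv0 : v 0 = 0 := (mul_eq_zero.1 (show (c ^ 2 - t * c + ν) * v 0 = 0 by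
    linear_combination -h1 - (c - t) * h0)).resolve_left (hirr.quadratic_ne_zero c)
  have hv1 : v 1 = 0 := by simpa [hv0] using h0
  exact mk_eq_mk_of_eq_zero hv0 hv1 _ _

theorem noFixedPoint_of_conj {K : Subgroup SL(3, F)} {b T : SL(3, F)} (hb : b ∈ K)
    (hc : T * b * T⁻¹ ∈ K) {x₀ : Plane F} (h : ∀ x : Plane F, b • x = x → x = x₀)
    (hT : T • x₀ ≠ x₀) : NoFixedPoint K := by
  intro x
  by_contra! hx
  have h1 := h x (hx b hb)
  have h2 : b • T⁻¹ • x = T⁻¹ • x := by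
    rw [eq_inv_smul_iff, smul_smul, smul_smul, hx _ hc]
  have h3 := h _ h2
  rw [inv_smul_eq_iff, h1] at h3
  exact hT h3.symm

theorem exists_blockCompanion_pow_transpose_mulVec_eq {t ν : F} (hν : ν ≠ 0)
    (hirr : Irreducible (X ^ 2 - C t * X + C ν : F[X]))
    (hgen : ∀ r : F[X], ¬ (X ^ 2 - C t * X + C ν : F[X]) ∣ r →
      ∃ j : ℕ, (X ^ 2 - C t * X + C ν : F[X]) ∣ r - X ^ j)
    {x y : Fin 3 → F} (hx : x ≠ 0) (hy : y ≠ 0) (hx2 : x 2 = 0) (hy2 : y 2 = 0) :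
    ∃ j : ℕ, ((blockCompanion t hν).1ᵀ) ^ j *ᵥ x = y := by
  set M := (blockCompanion t hν).1ᵀ with hM
  have hD : ν * x 0 ^ 2 - t * x 0 * x 1 + x 1 ^ 2 ≠ 0 := by
    intro h
    have hx0 : x 0 ≠ 0 := by
      intro h0
      apply hx
      have h1 : x 1 = 0 := by simpa [h0] using h
      ext i
      fin_cases i <;> simp [h0, h1, hx2]
    apply hirr.quadratic_ne_zero (x 1 / x 0)
    field_simp
    linear_combination h
  set D := ν * x 0 ^ 2 - t * x 0 * x 1 + x 1 ^ 2 with hDdef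
  have h2 : aeval M (X ^ 2 - C t * X + C ν) *ᵥ x = 0 := by
    simp only [map_sub, map_add, map_mul, aeval_X, aeval_C,
      Algebra.algebraMap_eq_smul_one, smul_mul_assoc, one_mul, pow_two, add_mulVec, sub_mulVec,
      ← mulVec_mulVec, smul_mulVec, one_mulVec]
    ext i
    fin_cases i <;>
      simp [M, blockCompanion, mulVec, dotProduct, Fin.sum_univ_three, Matrix.mul_apply, hx2]
    ring
  obtain ⟨r, hr⟩ : ∃ r : F[X], aeval M r *ᵥ x = y := by
    refine ⟨C ((y 0 * (ν * x 0 - t * x 1) + y 1 * x 1) / D) +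
      C ((x 0 * y 1 - y 0 * x 1) / -D) * X, ?_⟩
    simp only [map_add, map_mul, aeval_X, aeval_C,
      Algebra.algebraMap_eq_smul_one, smul_mul_assoc, one_mul, add_mulVec, smul_mulVec, one_mulVec]
    ext i
    fin_cases i <;> simp [M, blockCompanion, mulVec, dotProduct, Fin.sum_univ_three, hx2, hy2] <;>
      field_simp <;> (rw [hDdef]; ring)
  have hnd : ¬ (X ^ 2 - C t * X + C ν : F[X]) ∣ r := by
    rintro ⟨r', rfl⟩
    apply hy
    rw [← hr, mul_comm, map_mul, ← mulVec_mulVec, h2, mulVec_zero]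
  obtain ⟨j, r', hj⟩ := hgen r hnd
  refine ⟨j, ?_⟩
  have h3 := congrArg (fun f => aeval M f *ᵥ x) (hj.trans (mul_comm _ _))
  rw [map_sub, map_mul, sub_mulVec, hr, ← mulVec_mulVec, h2, mulVec_zero, map_pow, aeval_X,
    sub_eq_zero] at h3
  exact h3.symm

variable [Finite F]

theorem exists_hasElation_of_conj {t ν : F} (h : IsPrimitiveQuadratic t ν) (hν : ν ≠ 0)
    (hν3 : ν ^ 3 ≠ 1) (s : F) {K : Subgroup SL(3, F)} (hb : blockCompanion t hν ∈ K)
    (hc : blockTwist s * blockCompanion t hν * (blockTwist s)⁻¹ ∈ K) :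
    ∃ k : F, k ≠ 0 ∧ HasElation K ![0, 0, 1] ![k, 0, 0] := by
  have hpow := blockCompanion_pow_eq hν h.dvd_X_pow_sub_C
  set h₁ := blockCompanion t hν ^ (Nat.card F + 1) with hh₁
  have hg := pow_mem hc (Nat.card F + 1)
  rw [conj_pow, ← hh₁] at hg
  set g₁ := blockTwist s * h₁ * (blockTwist s)⁻¹ with hg₁
  have hμ : ν⁻¹ ^ (Nat.card F + 1) = ν⁻¹ ^ 2 := by
    have h1 : ν ^ (Nat.card F - 1) = 1 := h.orderOf_eq ▸ pow_orderOf_eq_one ν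
    rw [show Nat.card F + 1 = Nat.card F - 1 + 2 by have := one_lt_natCard (F := F); omega,
      pow_add, inv_pow ν (_ - 1), h1, inv_one, one_mul]
  obtain ⟨μ, hμ'⟩ : ∃ μ, μ = ν⁻¹ ^ 2 := ⟨_, rfl⟩
  have hμν : μ * ν ^ 2 = 1 := by rw [hμ']; field_simp
  rw [hμ, ← hμ'] at hpow
  have hh : h₁.1 = !![ν, 0, 0; 0, ν, 0; 0, 0, μ] := by
    rw [hh₁, Matrix.SpecialLinearGroup.coe_pow, hpow]
    ext i j
    fin_cases i <;> fin_cases j <;> simp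
  have hgc : g₁.1 = !![μ, 0, 0; -s * (μ - ν), ν, 0; μ - ν, 0, ν] := by
    rw [hg₁, Matrix.SpecialLinearGroup.coe_mul, Matrix.SpecialLinearGroup.coe_mul, hh,
      coe_inv_blockTwist]
    ext i j
    fin_cases i <;> fin_cases j <;> simp [blockTwist, Matrix.mul_apply, Fin.sum_univ_three] <;> ring
  clear_value g₁
  obtain ⟨u, hu⟩ : ∃ u : SL(3, F),
      u.1 = 1 + vecMulVec ![0, 0, 1] ![(μ - ν) ^ 2 * ν, 0, 0] := by
    refine ⟨⟨1 + vecMulVec ![0, 0, 1] ![(μ - ν) ^ 2 * ν, 0, 0], ?_⟩, rfl⟩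
    simp [det_fin_three]
  have hcomm : u * (g₁ * h₁) = h₁ * g₁ := by
    ext1 i j
    rw [Matrix.SpecialLinearGroup.coe_mul, Matrix.SpecialLinearGroup.coe_mul,
      Matrix.SpecialLinearGroup.coe_mul, hu, hh, hgc]
    fin_cases i <;> fin_cases j <;>
      simp [Matrix.mul_apply, Fin.sum_univ_three]
    all_goals try ring1
    linear_combination (μ - ν) ^ 2 * hμν
  have hh₁K : h₁ ∈ K := pow_mem hb _
  refine ⟨(μ - ν) ^ 2 * ν, mul_ne_zero (pow_ne_zero 2 (sub_ne_zero.2 fun he => ?_)) hν, u, ?_, hu⟩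
  · apply hν3
    rw [← hμν, he]
    ring
  · rw [← eq_mul_inv_iff_mul_eq] at hcomm
    rw [hcomm]
    exact mul_mem (mul_mem hh₁K hg) (inv_mem (mul_mem hg hh₁K))

theorem closure_blockCompanion_eq_top {t ν : F} (h : IsPrimitiveQuadratic t ν) (hν : ν ≠ 0)
    (hν3 : ν ^ 3 ≠ 1) (s : F) :
    Subgroup.closure {blockCompanion t hν,
      blockTwist s * (blockCompanion t hν)⁻¹ * (blockTwist s)⁻¹} = ⊤ := by
  set b := blockCompanion t hν with hb
  set T := blockTwist s with hT
  set K := Subgroup.closure {b, T * b⁻¹ * T⁻¹} with hK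
  have hbK : b ∈ K := Subgroup.subset_closure (by simp)
  have hcK : T * b * T⁻¹ ∈ K := by
    rw [← inv_mem_iff]
    have h1 : (T * b * T⁻¹)⁻¹ = T * b⁻¹ * T⁻¹ := by group
    rw [h1]
    exact Subgroup.subset_closure (by simp)
  have he : (![0, 0, 1] : Fin 3 → F) ≠ 0 := fun h => one_ne_zero (congrFun h 2)
  have hfix : NoFixedPoint K := by
    refine noFixedPoint_of_conj hbK hcK (x₀ := mk F ![0, 0, 1] he)
      (fun x hx => eq_mk_of_blockCompanion_smul_eq hν h.irreducible he hx) ?_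
    intro hh
    obtain ⟨c, -, hc⟩ := (mk_smul_eq_mk_iff he he).1 hh
    have := congrFun hc 0
    rw [SL_smul_eq] at this
    simp [T, blockTwist] at this
  have hfix' : NoFixedPoint (dualSubgroup K) := by
    refine noFixedPoint_of_conj (T := inverseTranspose T) (x₀ := mk F ![0, 0, 1] he)
      (inverseTranspose_mem_dualSubgroup.2 hbK)
      (by rw [← map_mul, ← map_inv, ← map_mul]; exact inverseTranspose_mem_dualSubgroup.2 hcK)
      (fun x hx => eq_mk_of_inverseTranspose_blockCompanion_smul_eq hν h.irreducible he hx) ?_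
    intro hh
    obtain ⟨c, -, hc⟩ := (mk_smul_eq_mk_iff he he).1 hh
    have := congrFun hc 0
    rw [inverseTranspose_smul, coe_inv_blockTwist] at this
    simp at this
  obtain ⟨k, hk, hel⟩ := exists_hasElation_of_conj h hν hν3 s hbK hcK
  apply eq_top_of_dualSubgroup_eq_top
  refine eq_top_of_fullAxis he (fullAxis_of_transitive he ?_ hel.dual fun x y hx hy h1 h2 => ?_)
    hfix' (by rwa [dualSubgroup_dualSubgroup])
  · exact fun h0 => hk (congrFun h0 0)
  · obtain ⟨j, hj⟩ := exists_blockCompanion_pow_transpose_mulVec_eq hν h.irreducible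
      h.exists_dvd_sub_X_pow hx hy 
      (by simpa [dotProduct, Fin.sum_univ_three] using h1)
      (by simpa [dotProduct, Fin.sum_univ_three] using h2)
    refine ⟨(inverseTranspose b)⁻¹ ^ j,
      pow_mem (inv_mem (inverseTranspose_mem_dualSubgroup.2 hbK)) j, ?_, ?_⟩
    · rw [← map_inv, ← map_pow, inverseTranspose_inverseTranspose]
      have hfix1 : b • mk F ![0, 0, 1] he = mk F ![0, 0, 1] he := by
        refine (mk_smul_eq_mk_iff he he).2 ⟨ν⁻¹, inv_ne_zero hν, ?_⟩
        rw [SL_smul_eq]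
        ext i
        fin_cases i <;> simp [b, blockCompanion]
      exact pow_mem (inv_mem (MulAction.mem_stabilizer_iff.2 hfix1)) j
    · rw [mk_smul_eq_mk_iff]
      refine ⟨1, one_ne_zero, ?_⟩
      rw [SL_smul_eq, Matrix.SpecialLinearGroup.coe_pow, coe_inv_inverseTranspose, one_smul, hj]

omit [Finite F] in
theorem exists_mulVec_eq_smul {M : Matrix (Fin 3) (Fin 3) F} (hM : M.det = 1) {a b x : F}
    (ha : a = M 0 0 + M 1 1 + M 2 2)
    (hb : b = M 0 0 * M 1 1 - M 0 1 * M 1 0 + (M 0 0 * M 2 2 - M 0 2 * M 2 0)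
      + (M 1 1 * M 2 2 - M 1 2 * M 2 1))
    (hx : x ^ 3 - a * x ^ 2 + b * x - 1 = 0) : ∃ v ≠ 0, M *ᵥ v = x • v := by
  obtain ⟨v, hv, h⟩ := Matrix.exists_mulVec_eq_zero_iff.2
    (show (M - scalar (Fin 3) x).det = 0 by
      rw [det_fin_three] at hM ⊢
      simp only [Matrix.sub_apply, scalar_apply, diagonal_apply, Fin.isValue, Fin.reduceEq,
        if_true, if_false]
      subst ha hb
      linear_combination -hx + hM)
  exact ⟨v, hv, by rwa [sub_mulVec, scalar_mulVec, sub_eq_zero] at h⟩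

omit [Finite F] in
theorem pow_mulVec_eq_smul {M : Matrix (Fin 3) (Fin 3) F} {v : Fin 3 → F} {x : F}
    (h : M *ᵥ v = x • v) (s : ℕ) : M ^ s *ᵥ v = x ^ s • v := by
  induction s with
  | zero => simp
  | succ s ih => rw [pow_succ, ← mulVec_mulVec, h, mulVec_smul, ih, smul_smul, pow_succ']

omit [Finite F] in
theorem pow_eq_of_pow_eq_scalar {M : Matrix (Fin 3) (Fin 3) F} {v : Fin 3 → F} {x c : F} {s : ℕ}
    (hv : v ≠ 0) (h : M *ᵥ v = x • v) (hs : M ^ s = scalar (Fin 3) c) : x ^ s = c := by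
  have h1 := pow_mulVec_eq_smul h s
  rw [hs, scalar_mulVec] at h1
  exact (smul_left_injective F hv h1).symm

omit [Finite F] in
theorem orderOf_mk_blockCompanion {t ν : F} (h : IsPrimitiveQuadratic t ν) (hν : ν ≠ 0) :
    orderOf (QuotientGroup.mk (blockCompanion t hν) : PSL(3, F)) =
      (Nat.card F ^ 2 - 1) / Nat.gcd 3 (Nat.card F - 1) := by
  refine orderOf_mk_eq fun s => ?_
  rw [← h.dvd_iff]
  refine ⟨?_, fun hs => ⟨ν⁻¹ ^ s, by rw [blockCompanion_pow_eq hν hs]; simp⟩⟩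
  rintro ⟨c, hc⟩
  have hcν : c = ν⁻¹ ^ s := by
    refine (pow_eq_of_pow_eq_scalar (v := ![0, 0, 1]) (fun h0 => one_ne_zero (congrFun h0 2)) ?_
      hc).symm
    ext i
    fin_cases i <;> simp [blockCompanion]
  have hb : aeval (blockCompanion t hν).1 (X ^ 2 - C t * X + C ν) *ᵥ ![1, 0, 0] = 0 := by
    simp only [map_sub, map_add, map_mul, aeval_X, aeval_C,
      Algebra.algebraMap_eq_smul_one, smul_mul_assoc, one_mul, pow_two, add_mulVec, sub_mulVec,
      ← mulVec_mulVec, smul_mulVec, one_mulVec]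
    ext i
    fin_cases i <;> simp [blockCompanion, dotProduct, Fin.sum_univ_three, vecHead, vecTail]
  refine dvd_of_aeval_mulVec_eq_zero (v := ![1, 0, 0]) (fun h0 => one_ne_zero (congrFun h0 0))
    h.irreducible hb ?_
  rw [aeval_X_pow_sub_C, hc, hcν, sub_self, zero_mulVec]

omit [Finite F] in
theorem orderOf_mk_eq_of_eigenvalues {g : SL(3, F)} {ν : F} (hν : ν ≠ 0) (hν2 : ν ^ 2 ≠ 1)
    (ha : 1 + (ν + ν⁻¹) = g 0 0 + g 1 1 + g 2 2)
    (hb : 1 + (ν + ν⁻¹) = g 0 0 * g 1 1 - g 0 1 * g 1 0 + (g 0 0 * g 2 2 - g 0 2 * g 2 0)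
      + (g 1 1 * g 2 2 - g 1 2 * g 2 1)) :
    orderOf (QuotientGroup.mk g : PSL(3, F)) = orderOf ν := by
  refine orderOf_mk_eq fun s => ⟨?_, fun hs => ⟨1, ?_⟩⟩
  · rintro ⟨c, hc⟩
    obtain ⟨v, hv, h1⟩ := exists_mulVec_eq_smul (x := 1) g.2 ha hb (by ring)
    obtain ⟨w, hw, h2⟩ := exists_mulVec_eq_smul (x := ν) g.2 ha hb (by field_simp; ring)
    rw [orderOf_dvd_iff_pow_eq_one, pow_eq_of_pow_eq_scalar hw h2 hc,
      ← pow_eq_of_pow_eq_scalar hv h1 hc, one_pow]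
  · have hνs := orderOf_dvd_iff_pow_eq_one.1 hs
    have h1 : ν ≠ 1 := by rintro rfl; simp at hν2
    have h2 : ν ≠ ν⁻¹ := fun h => hν2 (by rw [pow_two]; nth_rw 2 [h]; exact mul_inv_cancel₀ hν)
    have hinv : 1 ≠ ν⁻¹ := fun h => h1 (inv_eq_one.1 h.symm)
    have hroot (x : F) (hx : x ^ s = 1) : (X - C x) ∣ (X ^ s - C 1 : F[X]) := by
      rw [dvd_iff_isRoot]
      simp [hx]
    have hcop {x y : F} (h : x ≠ y) : IsCoprime (X - C x) (X - C y) :=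
      isCoprime_X_sub_C_of_isUnit_sub (sub_ne_zero.2 h).isUnit
    have hdvd := ((hcop h1.symm).mul_left (hcop h2.symm)).mul_dvd
      ((hcop hinv).mul_dvd (hroot 1 (one_pow s)) (hroot ν⁻¹ (by rw [inv_pow, hνs, inv_one])))
      (hroot ν hνs)
    obtain ⟨r, hr⟩ := hdvd
    have hcub := aeval_cubic_eq_zero g.1 g.2 ha hb
    rw [show (X - C 1) * (X - C ν⁻¹) * (X - C ν) =
      (X ^ 3 - C (1 + (ν + ν⁻¹)) * X ^ 2 + C (1 + (ν + ν⁻¹)) * X - 1 : F[X]) by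
        have hνC : C ν * C ν⁻¹ = (1 : F[X]) := by rw [← C_mul, mul_inv_cancel₀ hν, C_1]
        simp only [C_add, C_1]
        linear_combination (X - 1) * hνC] at hr
    rw [← sub_eq_zero, ← aeval_X_pow_sub_C, hr, map_mul, hcub, zero_mul]

omit [Finite F] in
theorem orderOf_mk_eq_four {g : SL(3, F)} (h3 : (3 : F) = 0)
    (ha : 1 = g 0 0 + g 1 1 + g 2 2)
    (hb : 1 = g 0 0 * g 1 1 - g 0 1 * g 1 0 + (g 0 0 * g 2 2 - g 0 2 * g 2 0)
      + (g 1 1 * g 2 2 - g 1 2 * g 2 1)) :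
    orderOf (QuotientGroup.mk g : PSL(3, F)) = 4 := by
  have hcub := aeval_cubic_eq_zero g.1 g.2 ha hb
  have h4 : (QuotientGroup.mk g : PSL(3, F)) ^ 2 ^ (1 + 1) = 1 := by
    refine (mk_pow_eq_one_iff _).2 ⟨1, ?_⟩
    rw [← sub_eq_zero, ← aeval_X_pow_sub_C, show (X ^ 2 ^ (1 + 1) - C 1 : F[X]) =
      (X ^ 3 - C 1 * X ^ 2 + C 1 * X - 1) * (X + 1) by rw [C_1]; ring, map_mul, hcub, zero_mul]
  refine orderOf_eq_prime_pow (fun h2 => ?_) h4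
  obtain ⟨c, hc⟩ := (mk_pow_eq_one_iff _).1 h2
  obtain ⟨v, hv, h1⟩ := exists_mulVec_eq_smul (x := 1) g.2 ha hb (by ring)
  have hc1 : c = 1 := by rw [← pow_eq_of_pow_eq_scalar hv h1 hc, one_pow]
  rw [hc1, pow_one, map_one] at hc
  have h6 : (2 : F) • (g.1 - 1) = 0 := by
    rw [← hcub]
    simp only [map_sub, map_add, map_pow, aeval_X, map_one, one_mul, pow_succ g.1 2, hc]
    module
  have h7 : g.1 = 1 := by
    refine sub_eq_zero.1 ((smul_eq_zero.1 h6).resolve_left fun h => one_ne_zero (α := F) ?_)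
    linear_combination h3 - h
  rw [h7] at ha
  apply one_ne_zero (α := F)
  simp only [Matrix.one_apply_eq] at ha
  linear_combination ha + h3

theorem exists_torus_triple (h2 : Nat.card F ≠ 2) (h4 : Nat.card F ≠ 4) :
    ∃ x y : SL(3, F),
      orderOf (QuotientGroup.mk x : PSL(3, F)) =
        (Nat.card F ^ 2 - 1) / Nat.gcd 3 (Nat.card F - 1) ∧
      orderOf (QuotientGroup.mk y : PSL(3, F)) =
        (Nat.card F ^ 2 - 1) / Nat.gcd 3 (Nat.card F - 1) ∧
      orderOf (QuotientGroup.mk (x * y) : PSL(3, F)) =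
        (if Nat.card F = 3 then 4 else Nat.card F - 1) ∧
      Subgroup.closure {x, y} = ⊤ := by
  obtain ⟨t, ν, h⟩ := exists_isPrimitiveQuadratic F
  have hq1 : 1 < Nat.card F := one_lt_natCard
  have hν : ν ≠ 0 := ne_zero_of_orderOf_pos (by rw [h.orderOf_eq]; omega)
  have hν3 : ν ^ 3 ≠ 1 := by
    intro h1
    have h2 := orderOf_dvd_of_pow_eq_one h1
    rw [h.orderOf_eq, Nat.dvd_prime Nat.prime_three] at h2
    omega
  have hk : ν ^ 2 - ν⁻¹ ≠ 0 := by
    intro h0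
    apply hν3
    field_simp at h0
    linear_combination h0
  obtain ⟨τ, hτ⟩ : ∃ τ, τ = if Nat.card F = 3 then 0 else ν + ν⁻¹ := ⟨_, rfl⟩
  obtain ⟨s, hs⟩ : ∃ s, s * (ν ^ 2 - ν⁻¹) + t * ν⁻¹ ^ 2 = τ :=
    ⟨(τ - t * ν⁻¹ ^ 2) / (ν ^ 2 - ν⁻¹), by field_simp; ring⟩
  have hN : (blockCompanion t hν * (blockTwist s * (blockCompanion t hν)⁻¹ * (blockTwist s)⁻¹)).1
      = !![-s * t + 1 + s * ν ^ 2, -ν * s, s * t - 1 - ν * s ^ 2;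
        ν + t * (s * t * ν⁻¹ - ν⁻¹ - s * ν), t * s, t * (-s * t * ν⁻¹ + ν⁻¹ + s ^ 2);
        ν⁻¹ * (ν - t * ν⁻¹), -ν⁻¹, ν⁻¹ * (t * ν⁻¹ - s)] := by
    rw [Matrix.SpecialLinearGroup.coe_mul, Matrix.SpecialLinearGroup.coe_mul,
      Matrix.SpecialLinearGroup.coe_mul, coe_inv_blockTwist, coe_inv_blockCompanion]
    ext i j
    fin_cases i <;> fin_cases j <;>
      simp [blockCompanion, blockTwist, Matrix.mul_apply, Fin.sum_univ_three]
    all_goals try field_simp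
    all_goals try ring1
    all_goals exact Or.inl (by ring)
  refine ⟨_, _, orderOf_mk_blockCompanion h hν, ?_, ?_, closure_blockCompanion_eq_top h hν hν3 s⟩
  · rw [← orderOf_mk_blockCompanion h hν, QuotientGroup.mk_mul, QuotientGroup.mk_mul,
      QuotientGroup.mk_inv, QuotientGroup.mk_inv, ← MulAut.conj_apply, MulEquiv.orderOf_eq, orderOf_inv]
  · generalize blockCompanion t hν * (blockTwist s * (blockCompanion t hν)⁻¹ * (blockTwist s)⁻¹)
      = g at hN
    have ha : 1 + τ = g 0 0 + g 1 1 + g 2 2 := by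
      rw [hN, ← hs]
      simp
      ring
    have hb : 1 + τ = g 0 0 * g 1 1 - g 0 1 * g 1 0 + (g 0 0 * g 2 2 - g 0 2 * g 2 0)
        + (g 1 1 * g 2 2 - g 1 2 * g 2 1) := by
      rw [hN, ← hs]
      simp
      field_simp
      ring
    split_ifs at hτ ⊢ with h3
    · rw [hτ, add_zero] at ha hb
      refine orderOf_mk_eq_four ?_ ha hb
      cases nonempty_fintype F
      rw [Nat.card_eq_fintype_card] at h3
      exact_mod_cast h3 ▸ Nat.cast_card_eq_zero F
    · rw [hτ] at ha hb
      rw [orderOf_mk_eq_of_eigenvalues hν ?_ ha hb, h.orderOf_eq]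
      intro h1
      have := Nat.le_of_dvd two_pos (orderOf_dvd_of_pow_eq_one h1)
      rw [h.orderOf_eq] at this
      omega

end TorusPair

section LargeFields

theorem isHyperbolic_of_le {G : Type*} [Group G] {a b c : G} (ha : 4 ≤ orderOf a)
    (hb : 4 ≤ orderOf b) (hc : 3 ≤ orderOf c) : IsHyperbolic (a, b, c) := by
  have ha' : ((orderOf a : ℕ) : ℚ)⁻¹ ≤ 4⁻¹ := by gcongr; exact_mod_cast ha
  have hb' : ((orderOf b : ℕ) : ℚ)⁻¹ ≤ 4⁻¹ := by gcongr; exact_mod_cast hb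
  have hc' : ((orderOf c : ℕ) : ℚ)⁻¹ ≤ 3⁻¹ := by gcongr; exact_mod_cast hc
  change ((orderOf a : ℕ) : ℚ)⁻¹ + ((orderOf b : ℕ) : ℚ)⁻¹ + ((orderOf c : ℕ) : ℚ)⁻¹ < 1
  linarith

theorem isGoodTriple_of_closure_eq_top {G : Type*} [Group G] {x y : G}
    (h : Subgroup.closure {x, y} = ⊤) (hx : 4 ≤ orderOf x) (hy : 4 ≤ orderOf y)
    (hxy : 3 ≤ orderOf (x * y)) : IsGoodTriple ![x, y, (x * y)⁻¹] where
  prod := by simp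
  gen := h
  hyp := isHyperbolic_of_le hx hy (by simpa [-mul_inv_rev] using hxy)

theorem isGoodTriple_of_closure_eq_top' {G : Type*} [Group G] {x u : G}
    (h : Subgroup.closure {x, u} = ⊤) (hx : 4 ≤ orderOf x) (hu : 3 ≤ orderOf u)
    (hxu : 4 ≤ orderOf (x * u)) : IsGoodTriple ![(x * u)⁻¹, x, u] where
  prod := by simp
  gen := by
    refine top_unique (h ▸ (Subgroup.closure_le _).2 ?_)
    have h1 : x ∈ Subgroup.closure {(x * u)⁻¹, x} := Subgroup.subset_closure (by simp)
    have h2 : (x * u)⁻¹ ∈ Subgroup.closure {(x * u)⁻¹, x} := Subgroup.subset_closure (by simp)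
    rintro z (rfl | rfl)
    · exact h1
    · exact (Subgroup.mul_mem_cancel_left _ h1).1 (inv_mem_iff.1 h2)
  hyp := isHyperbolic_of_le (by simpa [-mul_inv_rev] using hxu) hx hu

theorem hasBeauvilleStructure_of_orderOf {H : Type*} [Group H] [Finite H] [IsSimpleGroup H]
    (hperf : commutator H = ⊤) {x u y z : H} {q d n m l p P : ℕ} (hA : Subgroup.closure {x, u} = ⊤)
    (hB : Subgroup.closure {y, z} = ⊤) (hx : orderOf x = n) (hu : orderOf u = P)
    (hxu : orderOf (x * u) = n) (hy : orderOf y = m) (hz : orderOf z = m)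
    (hyz : orderOf (y * z) = l) (hn : 4 ≤ n) (hP : 3 ≤ P) (hm : 4 ≤ m) (hl : 3 ≤ l)
    (hlm : l ≠ m) (hp : p.Prime) (hpq : p ∣ q) (hPp : p ∣ P) (hPq : P ∣ p ^ 2)
    (hq : 2 < q) (hmd : m * d = q ^ 2 - 1) (hd : d = Nat.gcd 3 (q - 1)) (hlq : l ∣ q ^ 2 - 1)
    (hl3 : d = 3 → l = q - 1) (hnq : Nat.Coprime n q) (hns : Nat.Coprime n (q ^ 2 - 1))
    (hdich : ∀ g : H, g ^ n = 1 ∨ g ^ ((q ^ 2 - 1) * P) = 1) {k : ℕ} (hk1 : 1 ≤ k)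
    (hk : k * Nat.card (MulAut H) ≤ phi2 H) : HasBeauvilleStructure (Fin k → H) := by
  have hPs : Nat.Coprime P (q ^ 2 - 1) := by
    refine Nat.Coprime.coprime_dvd_left (hPq.trans (pow_dvd_pow_of_dvd hpq 2)) ?_
    rw [Nat.coprime_self_sub_right (Nat.one_le_pow _ _ (by omega))]
    simp
  have hmq : m ∣ q ^ 2 - 1 := ⟨d, hmd.symm⟩
  refine hasBeauvilleStructure_of_rotations hperf ![(x * u)⁻¹, x, u] ![y, z, (y * z)⁻¹]
    (isGoodTriple_of_closure_eq_top' hA (hx ▸ hn) (hu ▸ hP) (hxu ▸ hn))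
    (isGoodTriple_of_closure_eq_top hB (hy ▸ hm) (hz ▸ hm) (hyz ▸ hl))
    ?_ ?_ ?_ ?_ ?_ ?_ hk1 hk
  · simp only [Matrix.cons_val_zero, Matrix.cons_val_one, orderOf_inv, hx, hxu]
  · simp only [Matrix.cons_val_one, Matrix.cons_val, hx, hu]
    rintro rfl
    exact hp.one_lt.ne' (Nat.dvd_one.1 (hnq ▸ Nat.dvd_gcd hPp hpq))
  · simp only [Matrix.cons_val_zero, Matrix.cons_val_one, hy, hz]
  · simp only [Matrix.cons_val_one, Matrix.cons_val, orderOf_inv, hz, hyz]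
    exact hlm.symm
  · have ha (j) : Nat.Coprime (orderOf ((![(x * u)⁻¹, x, u] : Fin 3 → H) j)) (q ^ 2 - 1) := by
      fin_cases j <;> simp [-mul_inv_rev, hx, hu, hxu] <;> assumption
    have hb (j) : orderOf ((![y, z, (y * z)⁻¹] : Fin 3 → H) j) ∣ q ^ 2 - 1 := by
      fin_cases j <;> simp [-mul_inv_rev, hy, hz, hyz] <;> assumption
    exact fun j j' => (ha j).coprime_dvd_right (hb j')
  · intro r hr
    by_cases hrn : r ∣ n
    · refine Or.inl ⟨1, isFull_of_dichotomy hdich ⟨1, by simp, by simp [hx]⟩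
        ⟨(q ^ 2 - 1) * P, ?_, dvd_mul_right _ _⟩⟩
      refine Nat.Coprime.mul_left (hns.coprime_dvd_left hrn).symm ?_
      exact ((hnq.coprime_dvd_left hrn).pow_right 2).coprime_dvd_right
        (hPq.trans (pow_dvd_pow_of_dvd hpq 2)) |>.symm
    have hnr : Nat.Coprime n r := ((Nat.Prime.coprime_iff_not_dvd hr).2 hrn).symm
    by_cases hrP : r ∣ P
    · refine Or.inl ⟨2, isFull_of_dichotomy hdich ⟨n, hnr, dvd_mul_right _ _⟩
        ⟨q ^ 2 - 1, (hPs.coprime_dvd_left hrP).symm, by simp [hu]⟩⟩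
    have hPr : Nat.Coprime P r := ((Nat.Prime.coprime_iff_not_dvd hr).2 hrP).symm
    by_cases hrd : r ∣ d
    · have hr3 : r = 3 := (Nat.prime_dvd_prime_iff_eq hr Nat.prime_three).1
        (hrd.trans (hd ▸ Nat.gcd_dvd_left _ _))
      have h3q : 3 ∣ q - 1 := hr3 ▸ hrd.trans (hd ▸ Nat.gcd_dvd_right _ _)
      have hd3 : d = 3 := hd.trans (Nat.gcd_eq_left h3q)
      refine Or.inr ⟨2, isFull_of_dichotomy hdich ⟨n, hnr, dvd_mul_right _ _⟩
        ⟨(q + 1) * P, Nat.Coprime.mul_left ?_ hPr, ?_⟩⟩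
      · refine (Nat.Prime.coprime_iff_not_dvd hr).2 (fun h => ?_) |>.symm
        rw [hr3] at h
        omega
      · simp only [Matrix.cons_val, orderOf_inv, hyz, hl3 hd3]
        rw [show q ^ 2 - 1 = (q + 1) * (q - 1) by rw [← Nat.sq_sub_sq q 1, one_pow]]
        exact ⟨1, by ring⟩
    · refine Or.inr ⟨0, isFull_of_dichotomy hdich ⟨n, hnr, dvd_mul_right _ _⟩
        ⟨d * P, Nat.Coprime.mul_left ((Nat.Prime.coprime_iff_not_dvd hr).2 hrd).symm hPr, ?_⟩⟩
      simp only [Matrix.cons_val_zero, hy, ← hmd]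
      exact ⟨1, by ring⟩

variable {F : Type*} [Field F]

theorem closure_mk_eq_top {x y : SL(3, F)} (h : Subgroup.closure {x, y} = ⊤) :
    Subgroup.closure {(QuotientGroup.mk x : PSL(3, F)), QuotientGroup.mk y} = ⊤ := by
  have h1 := congrArg (Subgroup.map (QuotientGroup.mk' (Subgroup.center SL(3, F)))) h
  rw [MonoidHom.map_closure, Set.image_pair,
    Subgroup.map_top_of_surjective _ (QuotientGroup.mk'_surjective _)] at h1
  exact h1

variable [Finite F]

theorem hasBeauvilleStructure_of_large (h2 : Nat.card F ≠ 2) (h4 : Nat.card F ≠ 4) {k : ℕ}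
    (hk1 : 1 ≤ k) (hk : k * Nat.card (MulAut PSL(3, F)) ≤ phi2 PSL(3, F)) :
    HasBeauvilleStructure (Fin k → PSL(3, F)) := by
  obtain ⟨p, _⟩ := CharP.exists F
  have hp : p.Prime := CharP.char_is_prime F p
  have : Fact p.Prime := ⟨hp⟩
  obtain ⟨x, u, hx, hu, hxu, hA⟩ := exists_singer_triple (F := F) h4 p
  obtain ⟨y, z, hy, hz, hyz, hB⟩ := exists_torus_triple (F := F) h2 h4
  have hq1 : 1 < Nat.card F := one_lt_natCard
  have hpq : p ∣ Nat.card F := by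
    cases nonempty_fintype F
    rw [Nat.card_eq_fintype_card, ← CharP.cast_eq_zero_iff F p]
    exact Nat.cast_card_eq_zero F
  have hdich := PSL3_pow_dichotomy (F := F) p
  have hnd := singerOrder_mul F
  have hnq := singerOrder_coprime_card (F := F)
  have hns := singerOrder_coprime_sq_sub_one (F := F)
  set d := Nat.gcd 3 (Nat.card F - 1) with hd
  have hd3 : d ∣ 3 := Nat.gcd_dvd_left _ _
  have hdq : d ∣ Nat.card F - 1 := Nat.gcd_dvd_right _ _
  have hd_le : d ≤ 3 := Nat.le_of_dvd three_pos hd3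
  have hsq : Nat.card F ^ 2 - 1 = (Nat.card F + 1) * (Nat.card F - 1) := by
    rw [← Nat.sq_sub_sq _ 1, one_pow]
  obtain ⟨m, hm⟩ : ∃ m, m * d = Nat.card F ^ 2 - 1 := by
    obtain ⟨c, hc⟩ := hdq
    exact ⟨(Nat.card F + 1) * c, by rw [hsq, hc]; ring⟩
  have hdpos : 0 < d := Nat.pos_of_dvd_of_pos hd3 three_pos
  rw [← hm, Nat.mul_div_cancel _ hdpos] at hy hz
  have hmge : Nat.card F + 1 ≤ m := by
    by_contra! h
    have := Nat.mul_le_mul_left m (Nat.le_of_dvd (by omega) hdq)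
    rw [hm, hsq] at this
    have := Nat.mul_lt_mul_of_pos_right h (show 0 < Nat.card F - 1 by omega)
    omega
  refine hasBeauvilleStructure_of_orderOf (q := Nat.card F) (p := p) commutator_PSL3
    (closure_mk_eq_top hA) (closure_mk_eq_top hB) hx hu hxu hy hz hyz ?_ ?_ (by omega) ?_ ?_ hp hpq
    ?_ ?_ (by omega) hm hd ?_ ?_ hnq hns hdich hk1 hk
  · by_contra! h
    have h1 := Nat.mul_le_mul (Nat.le_of_lt_succ h) hd_le
    have h3 : 3 ≤ Nat.card F := by omega
    nlinarith
  · split_ifs with hp2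
    · norm_num
    · have := hp.two_le
      omega
  · split_ifs with h3 <;> omega
  · split_ifs with h3
    · rw [h3] at hd hm
      norm_num at hd
      rw [hd] at hm
      omega
    · omega
  · split_ifs with hp2
    · subst hp2; norm_num
    · exact dvd_rfl
  · split_ifs with hp2
    · subst hp2; norm_num
    · exact dvd_pow_self _ two_ne_zero
  · split_ifs with h3
    · rw [h3]; norm_num
    · exact ⟨_, hsq.trans (mul_comm _ _)⟩
  · intro hd3
    rw [if_neg]
    intro h3
    rw [h3] at hd
    norm_num at hd
    omega

end LargeFields

section ElementaryGeneration

open Matrix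

variable {F : Type*} [Field F] {K : Subgroup SL(3, F)}

theorem transvection_mem_of_commutator {i j k : Fin 3} (hij : i ≠ j) (hjk : j ≠ k) (hik : i ≠ k)
    {a b : F} (h1 : SpecialLinearGroup.transvection hij a ∈ K)
    (h2 : SpecialLinearGroup.transvection hjk b ∈ K) :
    SpecialLinearGroup.transvection hik (a * b) ∈ K := by
  have h : SpecialLinearGroup.transvection hik (a * b) *
      (SpecialLinearGroup.transvection hjk b * SpecialLinearGroup.transvection hij a) =
      SpecialLinearGroup.transvection hij a * SpecialLinearGroup.transvection hjk b := by
    ext1 x y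
    simp only [Matrix.SpecialLinearGroup.coe_mul, Matrix.SpecialLinearGroup.transvection_coe,
      mul_add, add_mul, mul_one, one_mul, single_mul_single_same, Matrix.add_apply,
      mul_zero, single_mul_single_of_ne _ _ _ _ hik.symm, single_mul_single_of_ne _ _ _ _ hjk.symm,
      Matrix.zero_apply]
    ring
  rw [eq_mul_inv_of_mul_eq h]
  exact mul_mem (mul_mem h1 h2) (inv_mem (mul_mem h2 h1))

theorem transvection_mem_of_conj {P : SL(3, F)} (hP : P ∈ K) {i j i' j' : Fin 3} {hij : i ≠ j}
    {hij' : i' ≠ j'} {a a' : F} (h : SpecialLinearGroup.transvection hij a ∈ K)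
    (hc : P.1 * Matrix.single i j a = Matrix.single i' j' a' * P.1) :
    SpecialLinearGroup.transvection hij' a' ∈ K := by
  have h1 : SpecialLinearGroup.transvection hij' a' * P =
      P * SpecialLinearGroup.transvection hij a := by
    ext1 x y
    rw [Matrix.SpecialLinearGroup.coe_mul, Matrix.SpecialLinearGroup.coe_mul,
      Matrix.SpecialLinearGroup.transvection_coe, Matrix.SpecialLinearGroup.transvection_coe,
      mul_add, add_mul, hc, mul_one, one_mul]
  rw [eq_mul_inv_of_mul_eq h1]
  exact mul_mem (mul_mem hP h) (inv_mem hP)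

theorem eq_top_of_cycle_mem {P : SL(3, F)} (hP : P ∈ K) {c : F}
    (hc : P.1 = !![0, c, 0; 0, 0, c; c, 0, 0]) {i j : Fin 3} (hij : i ≠ j)
    (h : ∀ a, SpecialLinearGroup.transvection hij a ∈ K) : K = ⊤ := by
  obtain ⟨p, hp⟩ : ∃ p : Fin 3 → Fin 3 → Prop, ∀ i j, p i j ↔
    ∀ (hij : i ≠ j) a, SpecialLinearGroup.transvection hij a ∈ K := ⟨_, fun _ _ => Iff.rfl⟩
  have hcyc (i j) (h : p (i + 1) (j + 1)) : p i j := by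
    rw [hp] at h ⊢
    intro hij a
    refine transvection_mem_of_conj hP (h (fun h => hij (add_right_cancel h)) a) ?_
    rw [hc]
    ext x y
    fin_cases i <;> fin_cases j <;> fin_cases x <;> fin_cases y <;>
      simp [Matrix.mul_apply, Matrix.single_apply, mul_comm]
  have hcomm (i j k) (hij : i ≠ j) (hjk : j ≠ k) (h1 : p i j) (h2 : p j k) : p i k := by
    rw [hp] at h1 h2 ⊢
    intro hik a
    rw [← mul_one a]
    exact transvection_mem_of_commutator hij hjk hik (h1 hij a) (h2 hjk 1)
  have c1 := hcyc 0 1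
  have c2 := hcyc 1 2
  have c3 := hcyc 2 0
  have c4 := hcyc 0 2
  have c5 := hcyc 1 0
  have c6 := hcyc 2 1
  have d1 := hcomm 0 1 2 (by decide) (by decide)
  have d2 := hcomm 0 2 1 (by decide) (by decide)
  have h0 : p i j := (hp i j).2 fun _ => h
  have h1 : p 0 1 ∧ p 1 2 ∧ p 2 0 ∧ p 0 2 ∧ p 1 0 ∧ p 2 1 := by
    fin_cases i <;> fin_cases j <;> first | exact absurd rfl hij | (simp at *; tauto)
  refine eq_top_of_transvection_mem K fun i' j' => ?_
  have h2 : i' ≠ j' → p i' j' := by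
    fin_cases i' <;> fin_cases j' <;> simp [h1]
  exact fun hij' => (hp i' j').1 (h2 hij') hij'

end ElementaryGeneration

section SmallFields

open Matrix Subgroup

theorem HasBeauvilleStructure.of_mulEquiv {G G' : Type*} [Group G] [Group G'] (e : G ≃* G')
    (h : HasBeauvilleStructure G) : HasBeauvilleStructure G' := by
  have hgen (T : G × G × G) (hT : IsGenTriple T) : IsGenTriple (e T.1, e T.2.1, e T.2.2) := by
    refine ⟨by simpa using congrArg e hT.1, ?_⟩
    have h1 : ({e T.1, e T.2.1, e T.2.2} : Set G') = e.toMonoidHom '' {T.1, T.2.1, T.2.2} := by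
      simp [Set.image_insert_eq]
    rw [h1, ← MonoidHom.map_closure, hT.2]
    exact map_top_of_surjective _ e.surjective
  have hhyp (T : G × G × G) (hT : _root_.IsHyperbolic T) : _root_.IsHyperbolic (e T.1, e T.2.1, e T.2.2) := by
    simpa [_root_.IsHyperbolic] using hT
  have hsig (T : G × G × G) (x : G') (hx : x ∈ SigmaSet (e T.1, e T.2.1, e T.2.2)) :
      e.symm x ∈ SigmaSet T := by
    obtain ⟨g, hg⟩ := hx
    refine ⟨e.symm g, ?_⟩
    have h1 (a : G) (h : g * x * g⁻¹ ∈ zpowers (e a)) :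
        e.symm g * e.symm x * (e.symm g)⁻¹ ∈ zpowers a := by
      obtain ⟨n, hn⟩ := h
      exact ⟨n, by simpa using congrArg e.symm hn⟩
    exact Or.imp (Or.imp (h1 _) (h1 _)) (h1 _) hg
  obtain ⟨T, T', hT, hT1, hT', hT1', hTT'⟩ := h
  refine ⟨_, _, hgen T hT, hhyp T hT1, hgen T' hT', hhyp T' hT1', ?_⟩
  ext x
  refine ⟨fun ⟨hx, hx'⟩ => ?_, ?_⟩
  · have h1 : e.symm x ∈ SigmaSet T ∩ SigmaSet T' := ⟨hsig T x hx, hsig T' x hx'⟩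
    rw [hTT'] at h1
    simpa using h1
  · rintro rfl
    exact ⟨⟨1, by simp [one_mem]⟩, ⟨1, by simp [one_mem]⟩⟩

theorem phi2_congr {G G' : Type*} [Group G] [Group G'] (e : G ≃* G') : phi2 G = phi2 G' := by
  refine Nat.card_congr ((e.toEquiv.prodCongr e.toEquiv).subtypeEquiv fun p => ?_)
  have h : closure {e p.1, e p.2} = (closure {p.1, p.2}).map e.toMonoidHom := by
    rw [MonoidHom.map_closure, Set.image_pair]
    rfl
  change _ ↔ closure {e p.1, e p.2} = ⊤
  rw [h, ← map_top_of_surjective e.toMonoidHom e.surjective]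
  exact (Subgroup.map_injective (f := e.toMonoidHom) e.injective).eq_iff.symm

theorem nonempty_mulEquiv_PSL3 {R F : Type*} [Field R] [Field F] (f : R ≃+* F) :
    Nonempty (PSL(3, R) ≃* PSL(3, F)) := by
  let e : SL(3, R) ≃* SL(3, F) := MonoidHom.toMulEquiv
    (Matrix.SpecialLinearGroup.map (f : R →+* F)) (Matrix.SpecialLinearGroup.map (f.symm : F →+* R))
    (by ext; simp) (by ext; simp)
  refine ⟨QuotientGroup.congr _ _ e ?_⟩
  ext x
  simp only [Subgroup.mem_map, mem_center_iff]
  constructor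
  · rintro ⟨y, hy, rfl⟩ g
    have := congrArg e (hy (e.symm g))
    simpa using this
  · intro h
    refine ⟨e.symm x, fun g => e.injective ?_, by simp⟩
    simpa using h (e g)

theorem hasBeauvilleStructure_congr {R F : Type*} [Field R] [Field F] [Fintype R] [Fintype F]
    (h : Fintype.card R = Fintype.card F) {k : ℕ}
    (hR : k * Nat.card (MulAut PSL(3, R)) ≤ phi2 PSL(3, R) →
      HasBeauvilleStructure (Fin k → PSL(3, R)))
    (hk : k * Nat.card (MulAut PSL(3, F)) ≤ phi2 PSL(3, F)) :
    HasBeauvilleStructure (Fin k → PSL(3, F)) := by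
  obtain ⟨e⟩ := nonempty_mulEquiv_PSL3 (FiniteField.ringEquivOfCardEq h)
  refine (hR ?_).of_mulEquiv (MulEquiv.piCongrRight fun _ => e)
  rwa [Nat.card_congr (MulAut.congr e).toEquiv, phi2_congr e]

theorem mk_ne_one_of_not_commute {F : Type*} [Field F] {g h : SL(3, F)} (hgh : h * g ≠ g * h) :
    (QuotientGroup.mk g : PSL(3, F)) ≠ 1 := fun h1 =>
  hgh (mem_center_iff.1 ((QuotientGroup.eq_one_iff g).1 h1) h)

theorem orderOf_mk_eq_prime {F : Type*} [Field F] {g h : SL(3, F)} {p : ℕ} [Fact p.Prime]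
    (c : F) (hg : (g ^ p).1 = scalar (Fin 3) c) (hgh : h * g ≠ g * h) :
    orderOf (QuotientGroup.mk g : PSL(3, F)) = p :=
  orderOf_eq_prime ((mk_pow_eq_one_iff p).2 ⟨c, hg⟩) (mk_ne_one_of_not_commute hgh)

/-- The field with four elements. -/
abbrev GFour := QuadraticAlgebra (ZMod 2) 1 1

instance : Fact (∀ r : ZMod 2, r ^ 2 ≠ 1 + 1 * r) := ⟨by decide⟩

namespace GFour

/-- A primitive cube root of unity. -/
def ω : GFour := ⟨0, 1⟩

instance : Fintype GFour := Fintype.ofEquiv _ (QuadraticAlgebra.equivProd (1 : ZMod 2) 1).symm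

theorem card_eq : Fintype.card GFour = 4 := by decide +kernel

instance : CharP GFour 2 := by
  refine CharTwo.of_one_ne_zero_of_two_eq_zero one_ne_zero ?_
  decide +kernel

theorem eq_top_of_mem {K : Subgroup SL(3, GFour)} {P D : SL(3, GFour)} (hP : P ∈ K) (hD : D ∈ K)
    (hP1 : P.1 = !![0, ω ^ 2, 0; 0, 0, ω ^ 2; ω ^ 2, 0, 0])
    (hD1 : ∀ a, D.1 * Matrix.single 2 0 a = Matrix.single 2 0 (ω ^ 2 * a) * D.1)
    (h : SpecialLinearGroup.transvection (show (2 : Fin 3) ≠ 0 by decide) (ω ^ 2) ∈ K) :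
    K = ⊤ := by
  refine eq_top_of_cycle_mem hP hP1 (show (2 : Fin 3) ≠ 0 by decide) fun a => ?_
  have h20 : (2 : Fin 3) ≠ 0 := by decide
  have h0 := transvection_mem_of_conj (hij' := h20) hD h (hD1 _)
  have h1 := transvection_mem_of_conj (hij' := h20) hD h0 (hD1 _)
  have h2 : a = 0 ∨ a = ω ^ 2 ∨ a = ω ^ 2 * ω ^ 2 ∨ a = ω ^ 2 * (ω ^ 2 * ω ^ 2) := by
    revert a; decide +kernel
  rcases h2 with rfl | rfl | rfl | rfl
  · convert one_mem K
    exact Subtype.ext (by rw [Matrix.SpecialLinearGroup.transvection_coe]; simp)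
  all_goals assumption

/-- An element of order 7. -/
def x : SL(3, GFour) := ⟨!![1, 0, ω; ω, 1, ω ^ 2; ω ^ 2, ω, 0], by decide +kernel⟩

/-- An element of order 4 whose product with `x` has order 7. -/
def u : SL(3, GFour) := ⟨!![ω, 1, 1; 1, 1, ω; ω, ω ^ 2, ω], by decide +kernel⟩

/-- An element with projective order 5. -/
def y : SL(3, GFour) := ⟨!![1, 1, 0; ω ^ 2, 0, 0; 1, 1, ω], by decide +kernel⟩

/-- An element with projective order 5 whose product with `y` has order 3. -/
def z : SL(3, GFour) := ⟨!![ω ^ 2, ω ^ 2, 1; 1, ω, 0; 0, 0, ω ^ 2], by decide +kernel⟩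

theorem closure_x_u : closure {x, u} = ⊤ := by
  have hx : x ∈ closure {x, u} := subset_closure (by simp)
  have hu : u ∈ closure {x, u} := subset_closure (by simp)
  refine eq_top_of_mem (P := u * u * x⁻¹ * u * u * x) (D := x⁻¹ * u * x * u) ?_ ?_
    (by decide +kernel) (by decide +kernel) ?_
  · exact mul_mem (mul_mem (mul_mem (mul_mem (mul_mem hu hu) (inv_mem hx)) hu) hu) hx
  · exact mul_mem (mul_mem (mul_mem (inv_mem hx) hu) hx) hu
  · rw [show SpecialLinearGroup.transvection (show (2 : Fin 3) ≠ 0 by decide) (ω ^ 2) =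
      x * u * u * x⁻¹ by decide +kernel]
    exact mul_mem (mul_mem (mul_mem hx hu) hu) (inv_mem hx)

theorem closure_y_z : closure {y, z} = ⊤ := by
  have hy : y ∈ closure {y, z} := subset_closure (by simp)
  have hz : z ∈ closure {y, z} := subset_closure (by simp)
  have hw : y * y * z * z * y * y * z ∈ closure {y, z} :=
    mul_mem (mul_mem (mul_mem (mul_mem (mul_mem (mul_mem hy hy) hz) hz) hy) hy) hz
  refine eq_top_of_mem (P := z * z * y * z⁻¹) (D := y⁻¹ * z⁻¹ * y * y * z * y⁻¹ * z) ?_ ?_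
    (by decide +kernel) (by decide +kernel) ?_
  · exact mul_mem (mul_mem (mul_mem hz hz) hy) (inv_mem hz)
  · exact mul_mem (mul_mem (mul_mem (mul_mem (mul_mem (mul_mem (inv_mem hy) (inv_mem hz)) hy) hy)
      hz) (inv_mem hy)) hz
  · have h1 : (y * y * z * z * y * y * z).1 = !![ω, 0, 0; 0, ω, 0; 1, 0, ω] := by decide +kernel
    convert pow_mem hw 3
    refine Subtype.ext ?_
    rw [Matrix.SpecialLinearGroup.coe_pow, h1]
    decide +kernel

theorem hasBeauvilleStructure {k : ℕ} (hk1 : 1 ≤ k)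
    (hk : k * Nat.card (MulAut PSL(3, GFour)) ≤ phi2 PSL(3, GFour)) :
    HasBeauvilleStructure (Fin k → PSL(3, GFour)) := by
  have h5 : Fact (Nat.Prime 5) := ⟨by norm_num⟩
  have h7 : Fact (Nat.Prime 7) := ⟨by norm_num⟩
  have hcard : Nat.card GFour = 4 := by rw [Nat.card_eq_fintype_card, card_eq]
  have hs : singerOrder GFour = 7 := by
    have := singerOrder_mul GFour
    rw [hcard] at this
    norm_num at this
    omega
  refine hasBeauvilleStructure_of_orderOf (q := 4) (d := 3) (n := 7) (m := 5) (l := 3) (p := 2)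
    (P := 4) commutator_PSL3 (closure_mk_eq_top closure_x_u) (closure_mk_eq_top closure_y_z)
    (orderOf_mk_eq_prime (h := u) 1 (by decide +kernel) (by decide +kernel))
    (orderOf_eq_prime_pow (p := 2) (n := 1) ?_ ?_)
    (orderOf_mk_eq_prime (g := x * u) (h := u) 1 (by decide +kernel) (by decide +kernel))
    (orderOf_mk_eq_prime (h := z) (ω ^ 2) (by decide +kernel) (by decide +kernel))
    (orderOf_mk_eq_prime (h := y) ω (by decide +kernel) (by decide +kernel))
    (orderOf_mk_eq_prime (g := y * z) (h := z) 1 (by decide +kernel) (by decide +kernel))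
    (by norm_num) (by norm_num) (by norm_num) (by norm_num) (by norm_num) (by norm_num)
    (by norm_num) (by norm_num) (by norm_num) (by norm_num) (by norm_num) (by norm_num)
    (by norm_num) (by norm_num) (by norm_num) (by norm_num) (fun g => ?_) hk1 hk
  · exact mk_ne_one_of_not_commute (g := u ^ 2) (h := x) (by decide +kernel)
  · exact (mk_pow_eq_one_iff (g := u) 4).2 ⟨1, by decide +kernel⟩
  · have := PSL3_pow_dichotomy 2 g
    rwa [hs, hcard] at this

end GFour

end SmallFields

section SmallFields

open Subgroup

theorem hasBeauvilleStructure_of_orderOf_two {H : Type*} [Group H] [Finite H] [IsSimpleGroup H]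
    (hperf : commutator H = ⊤) {x y x' y' u v u' v' : H}
    (hxy : closure {x, y} = ⊤) (hxy' : closure {x', y'} = ⊤)
    (huv : closure {u, v} = ⊤) (huv' : closure {u', v'} = ⊤)
    (hx : orderOf x = 7) (hy : orderOf y = 7) (hm : orderOf (x * y) = 3)
    (hx' : orderOf x' = 3) (hy' : orderOf y' = 3) (hm' : orderOf (x' * y') = 7)
    (hu : orderOf u = 4) (hv : orderOf v = 4) (hw : orderOf (u * v) = 4)
    (hu' : orderOf u' = 4) (hv' : orderOf v' = 4) (hw' : orderOf (u' * v') = 4)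
    (hne : orderOf (u * v⁻¹) ≠ orderOf (u' * v'⁻¹)) (hdich : ∀ g : H, g ^ 7 = 1 ∨ g ^ 12 = 1)
    {k : ℕ} (hk1 : 1 ≤ k) (hk : k * Nat.card (MulAut H) ≤ phi2 H) :
    HasBeauvilleStructure (Fin k → H) := by
  obtain ⟨A, hA0, hA1⟩ : ∃ A : ℕ → Fin 3 → H, A 0 = ![x, y, (x * y)⁻¹] ∧
      A 1 = ![x', y', (x' * y')⁻¹] := ⟨fun i => if i = 0 then _ else _, rfl, rfl⟩
  obtain ⟨B, hB0, hB1⟩ : ∃ B : ℕ → Fin 3 → H, B 0 = ![u, v, (u * v)⁻¹] ∧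
      B 1 = ![u', v', (u' * v')⁻¹] := ⟨fun i => if i = 0 then _ else _, rfl, rfl⟩
  have hA (i) (hi : i < 2) (j) : orderOf (A i j) = 7 ∨ orderOf (A i j) = 3 := by
    interval_cases i <;> fin_cases j <;> simp [-mul_inv_rev, *]
  have hB (i) (hi : i < 2) (j) : orderOf (B i j) = 4 := by
    interval_cases i <;> fin_cases j <;> simp [-mul_inv_rev, *]
  refine hasBeauvilleStructure_of_special hperf two_pos A B (fun i hi => ?_) (fun i hi => ?_)
    (fun i hi j hj hij α h0 h1 => ?_) (fun i hi j hj hij α h0 h1 => ?_)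
    (fun i hi j j' => ?_) (fun r hr => ?_) hk1 hk
  · interval_cases i
    · rw [hA0]
      exact isGoodTriple_of_closure_eq_top hxy (by omega) (by omega) (by omega)
    · rw [hA1]
      refine ⟨by simp, hxy', ?_⟩
      simp only [IsHyperbolic, Matrix.cons_val_zero, Matrix.cons_val_one, Matrix.cons_val,
        orderOf_inv, hx', hy', hm']
      norm_num
  · interval_cases i
    · rw [hB0]
      exact isGoodTriple_of_closure_eq_top huv (by omega) (by omega) (by omega)
    · rw [hB1]
      exact isGoodTriple_of_closure_eq_top huv' (by omega) (by omega) (by omega)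
  · have h2 := congrArg orderOf h0
    rw [MulEquiv.orderOf_eq] at h2
    interval_cases i <;> interval_cases j <;> simp [hA0, hA1, hx, hx'] at h2 hij
  · have h2 : orderOf (B i 0 * (B i 1)⁻¹) = orderOf (B j 0 * (B j 1)⁻¹) := by
      rw [← h0, ← h1, ← map_inv, ← map_mul, MulEquiv.orderOf_eq]
    interval_cases i <;> interval_cases j <;> simp [hB0, hB1, hne, hne.symm] at h2 hij
  · rw [hB i hi]
    rcases hA i hi j with h | h <;> rw [h] <;> norm_num
  · by_cases h2 : r = 2
    · exact Or.inr fun j => ⟨0, two_pos, isFull_of_dichotomy hdich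
        ⟨7, by rw [h2]; norm_num, dvd_mul_right _ _⟩
        ⟨3, by rw [h2]; norm_num, by rw [hB 0 two_pos]⟩⟩
    by_cases h3 : r = 3
    · refine Or.inl fun j => ?_
      obtain ⟨i, hi, h⟩ : ∃ i < 2, orderOf (A i j) = 3 := by
        fin_cases j
        · exact ⟨1, one_lt_two, by simp [hA1, hx']⟩
        · exact ⟨1, one_lt_two, by simp [hA1, hy']⟩
        · exact ⟨0, two_pos, by simp [-mul_inv_rev, hA0, hm]⟩
      exact ⟨i, hi, isFull_of_dichotomy hdich ⟨7, by rw [h3]; norm_num, dvd_mul_right _ _⟩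
        ⟨4, by rw [h3]; norm_num, by rw [h]⟩⟩
    · refine Or.inl fun j => ?_
      obtain ⟨i, hi, h⟩ : ∃ i < 2, orderOf (A i j) = 7 := by
        fin_cases j
        · exact ⟨0, two_pos, by simp [hA0, hx]⟩
        · exact ⟨0, two_pos, by simp [hA0, hy]⟩
        · exact ⟨1, one_lt_two, by simp [-mul_inv_rev, hA1, hm']⟩
      refine ⟨i, hi, isFull_of_dichotomy hdich ⟨1, by simp, by simp [h]⟩
        ⟨12, ?_, dvd_mul_right _ _⟩⟩
      refine Nat.Coprime.mul_left (m := 4) (n := 3) ?_ ((Nat.coprime_primes Nat.prime_three hr).2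
        (Ne.symm h3))
      exact Nat.Coprime.pow_left 2 ((Nat.coprime_primes Nat.prime_two hr).2 (Ne.symm h2))

namespace GTwo

open Matrix

theorem eq_top_of_mem {K : Subgroup SL(3, ZMod 2)} {P : SL(3, ZMod 2)} (hP : P ∈ K)
    (hP1 : P.1 = !![0, 1, 0; 0, 0, 1; 1, 0, 0]) {i j : Fin 3} (hij : i ≠ j)
    (h : SpecialLinearGroup.transvection hij 1 ∈ K) : K = ⊤ := by
  refine eq_top_of_cycle_mem hP hP1 hij fun a => ?_
  have h2 : a = 0 ∨ a = 1 := by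
    revert a; decide
  rcases h2 with rfl | rfl
  · convert one_mem K
    exact Subtype.ext (by rw [Matrix.SpecialLinearGroup.transvection_coe]; simp)
  · exact h

theorem orderOf_mk_eq_four {g h : SL(3, ZMod 2)} (hg : (g ^ 4).1 = scalar (Fin 3) 1)
    (hgh : h * g ^ 2 ≠ g ^ 2 * h) : orderOf (QuotientGroup.mk g : PSL(3, ZMod 2)) = 4 :=
  orderOf_eq_prime_pow (p := 2) (n := 1) (mk_ne_one_of_not_commute hgh)
    ((mk_pow_eq_one_iff 4).2 ⟨1, hg⟩)

/-- An element of order 7. -/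
def x : SL(3, ZMod 2) := ⟨!![0, 0, 1; 1, 0, 0; 0, 1, 1], by decide +kernel⟩

/-- An element of order 7 whose product with `x` has order 3. -/
def y : SL(3, ZMod 2) := ⟨!![0, 0, 1; 1, 1, 0; 0, 1, 0], by decide +kernel⟩

/-- An element of order 3. -/
def x' : SL(3, ZMod 2) := ⟨!![0, 0, 1; 1, 0, 0; 0, 1, 0], by decide +kernel⟩

/-- An element of order 3 whose product with `x'` has order 7. -/
def y' : SL(3, ZMod 2) := ⟨!![0, 0, 1; 1, 0, 1; 1, 1, 0], by decide +kernel⟩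

/-- An element of order 4. -/
def u : SL(3, ZMod 2) := ⟨!![0, 0, 1; 0, 1, 0; 1, 1, 0], by decide +kernel⟩

/-- An element of order 4 with `u * v` of order 4 and `u * v⁻¹` of order 3. -/
def v : SL(3, ZMod 2) := ⟨!![0, 1, 0; 1, 0, 0; 1, 0, 1], by decide +kernel⟩

/-- An element of order 4 with `u * v'` of order 4 and `u * v'⁻¹` of order 7. -/
def v' : SL(3, ZMod 2) := ⟨!![1, 0, 0; 0, 1, 1; 1, 0, 1], by decide +kernel⟩

theorem closure_x_y : Subgroup.closure {x, y} = ⊤ := by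
  have hx : x ∈ Subgroup.closure {x, y} := subset_closure (by simp)
  have hy : y ∈ Subgroup.closure {x, y} := subset_closure (by simp)
  refine eq_top_of_mem (mul_mem hx hy) (by decide +kernel) (show (2 : Fin 3) ≠ 0 by decide) ?_
  rw [show SpecialLinearGroup.transvection (show (2 : Fin 3) ≠ 0 by decide) 1 = x * x * y by
    decide +kernel]
  exact mul_mem (mul_mem hx hx) hy

theorem closure_x_y_two : Subgroup.closure {x', y'} = ⊤ := by
  have hx : x' ∈ Subgroup.closure {x', y'} := subset_closure (by simp)
  have hy : y' ∈ Subgroup.closure {x', y'} := subset_closure (by simp)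
  refine eq_top_of_mem (inv_mem hx) (by decide +kernel) (show (2 : Fin 3) ≠ 0 by decide) ?_
  rw [show SpecialLinearGroup.transvection (show (2 : Fin 3) ≠ 0 by decide) 1 =
    x' * y'⁻¹ * x' * y'⁻¹ by decide +kernel]
  exact mul_mem (mul_mem (mul_mem hx (inv_mem hy)) hx) (inv_mem hy)

theorem closure_u_v : Subgroup.closure {u, v} = ⊤ := by
  have hu : u ∈ Subgroup.closure {u, v} := subset_closure (by simp)
  have hv : v ∈ Subgroup.closure {u, v} := subset_closure (by simp)
  refine eq_top_of_mem (mul_mem (inv_mem hv) hu) (by decide +kernel)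
    (show (0 : Fin 3) ≠ 2 by decide) ?_
  rw [show SpecialLinearGroup.transvection (show (0 : Fin 3) ≠ 2 by decide) 1 =
    u * v * v * u⁻¹ by decide +kernel]
  exact mul_mem (mul_mem (mul_mem hu hv) hv) (inv_mem hu)

theorem closure_u_v' : Subgroup.closure {u, v'} = ⊤ := by
  have hu : u ∈ Subgroup.closure {u, v'} := subset_closure (by simp)
  have hv : v' ∈ Subgroup.closure {u, v'} := subset_closure (by simp)
  refine eq_top_of_mem (mul_mem (mul_mem (mul_mem hu (inv_mem hv)) hu) hv) (by decide +kernel)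
    (show (1 : Fin 3) ≠ 0 by decide) ?_
  rw [show SpecialLinearGroup.transvection (show (1 : Fin 3) ≠ 0 by decide) 1 = v' * v' by
    decide +kernel]
  exact mul_mem hv hv

theorem hasBeauvilleStructure {k : ℕ} (hk1 : 1 ≤ k)
    (hk : k * Nat.card (MulAut PSL(3, ZMod 2)) ≤ phi2 PSL(3, ZMod 2)) :
    HasBeauvilleStructure (Fin k → PSL(3, ZMod 2)) := by
  have h7 : Fact (Nat.Prime 7) := ⟨by norm_num⟩
  have hcard : Nat.card (ZMod 2) = 2 := by simp
  have hs : singerOrder (ZMod 2) = 7 := by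
    have := singerOrder_mul (ZMod 2)
    rw [hcard] at this
    norm_num at this
    omega
  have h3 : orderOf (QuotientGroup.mk (u * v⁻¹) : PSL(3, ZMod 2)) = 3 :=
    orderOf_mk_eq_prime (h := u) 1 (by decide +kernel) (by decide +kernel)
  have h7' : orderOf (QuotientGroup.mk (u * v'⁻¹) : PSL(3, ZMod 2)) = 7 :=
    orderOf_mk_eq_prime (h := u) 1 (by decide +kernel) (by decide +kernel)
  refine hasBeauvilleStructure_of_orderOf_two commutator_PSL3
    (closure_mk_eq_top closure_x_y) (closure_mk_eq_top closure_x_y_two)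
    (closure_mk_eq_top closure_u_v) (closure_mk_eq_top closure_u_v')
    (orderOf_mk_eq_prime (h := y) 1 (by decide +kernel) (by decide +kernel))
    (orderOf_mk_eq_prime (h := x) 1 (by decide +kernel) (by decide +kernel))
    (orderOf_mk_eq_prime (g := x * y) (h := x) 1 (by decide +kernel) (by decide +kernel))
    (orderOf_mk_eq_prime (h := y) 1 (by decide +kernel) (by decide +kernel))
    (orderOf_mk_eq_prime (h := x) 1 (by decide +kernel) (by decide +kernel))
    (orderOf_mk_eq_prime (g := x' * y') (h := x) 1 (by decide +kernel) (by decide +kernel))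
    (orderOf_mk_eq_four (h := v) (by decide +kernel) (by decide +kernel))
    (orderOf_mk_eq_four (h := u) (by decide +kernel) (by decide +kernel))
    (orderOf_mk_eq_four (g := u * v) (h := u) (by decide +kernel) (by decide +kernel))
    (orderOf_mk_eq_four (h := v) (by decide +kernel) (by decide +kernel))
    (orderOf_mk_eq_four (h := u) (by decide +kernel) (by decide +kernel))
    (orderOf_mk_eq_four (g := u * v') (h := u) (by decide +kernel) (by decide +kernel))
    ?_ (fun g => ?_) hk1 hk
  · exact fun h => absurd (h3.symm.trans (h.trans h7')) (by norm_num)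
  · have := PSL3_pow_dichotomy 2 g
    rwa [hs, hcard] at this

end GTwo

end SmallFields

theorem hasBeauvilleStructure_PSL3 (F : Type*) [Field F] [Finite F] {k : ℕ} (hk1 : 1 ≤ k)
    (hk : k * Nat.card (MulAut PSL(3, F)) ≤ phi2 PSL(3, F)) :
    HasBeauvilleStructure (Fin k → PSL(3, F)) := by
  cases nonempty_fintype F
  by_cases h2 : Nat.card F = 2
  · refine hasBeauvilleStructure_congr (R := ZMod 2) ?_ (GTwo.hasBeauvilleStructure hk1) hk
    rw [← Nat.card_eq_fintype_card (α := F), h2, ZMod.card]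
  by_cases h4 : Nat.card F = 4
  · refine hasBeauvilleStructure_congr (R := GFour) ?_ (GFour.hasBeauvilleStructure hk1) hk
    rw [← Nat.card_eq_fintype_card (α := F), h4, GFour.card_eq]
  exact hasBeauvilleStructure_of_large h2 h4 hk1 hk

/-- Theorem 2 for `L₃(q)`: for `H = PSL₃(F_q)` with `q ≥ 2` a prime power and `G = Hᵏ`, `k ≥ 1`,
the following are equivalent: (a) `G` admits an unmixed Beauville structure;
(b) `G` is 2-generated; (c) `k·|Aut H| ≤ φ₂(H)`. -/
theorem beauville_psl3_tfae (F : Type*) [Field F] [Fintype F] (hq : 2 ≤ Fintype.card F)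
    (k : ℕ) (hk : 1 ≤ k) :
    List.TFAE
      [ HasBeauvilleStructure (Fin k → PSL(3, F)),
        ∃ x y : Fin k → PSL(3, F), Subgroup.closure {x, y} = ⊤,
        k * Nat.card (MulAut PSL(3, F)) ≤ phi2 PSL(3, F) ] := by
  exact tfae_of_construction (hasBeauvilleStructure_PSL3 F hk)
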